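/- Let λ ≥ 1 be an integer, let G be a λ-connected finite simple graph with minimum degree δ, and let C be a longest cycle in G. Then either |C| ≥ λ(δ − λ + 2) or c̄ ≤ min{λ − 2, δ − λ}, where c̄ is the length of a longest cycle in the subgraph of G induced by the vertices not on C. -/

import Mathlib

open SimpleGraph

/-- A cycle `C` is a longest cycle in `G` if no cycle of `G` has greater length. -/
def IsLongestCycle {V : Type*} (G : SimpleGraph V) {v : V} (C : G.Walk v v) : Prop :=
  C.IsCycle ∧ ∀ (u : V) (D : G.Walk u u), D.IsCycle → D.length ≤ C.length

open scoped Classical in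
/-- The length of a longest path in `H`, with the convention that it is `-1`
when `H` has no vertices. -/
noncomputable def pbar {W : Type*} (H : SimpleGraph W) : ℤ :=
  if Nonempty W then
    ((sSup {n : ℕ | ∃ (u v : W) (p : H.Walk u v), p.IsPath ∧ p.length = n} : ℕ) : ℤ)
  else -1

/-- The length of a longest cycle in `H`, where a single vertex counts as a cycle of
length 1 and a single edge as a cycle of length 2, with the convention that it is `0`
when `H` has no vertices. -/
noncomputable def cbar {W : Type*} (H : SimpleGraph W) : ℕ :=
  sSup {n : ℕ | (n = 1 ∧ Nonempty W) ∨ (n = 2 ∧ ∃ u v : W, H.Adj u v) ∨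
    ∃ (v : W) (c : H.Walk v v), c.IsCycle ∧ c.length = n}

/-- `G` is `k`-connected: it has at least `k+1` vertices and remains connected
after the deletion of any set of fewer than `k` vertices. -/
def IsKConnected {V : Type*} [Fintype V] (G : SimpleGraph V) (k : ℕ) : Prop :=
  k + 1 ≤ Fintype.card V ∧
    ∀ S : Finset V, S.card < k → (G.induce ((↑S : Set V)ᶜ)).Connected

namespace LongCycle

section


variable {V : Type*} {G : SimpleGraph V}

/-- There is a path from `a` to `b` of length at least `n` all of whose vertices lie in `S`. -/
def LinkedBy (G : SimpleGraph V) (S : Set V) (a b : V) (n : ℕ) : Prop :=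
  ∃ p : G.Walk a b, p.IsPath ∧ (∀ x ∈ p.support, x ∈ S) ∧ n ≤ p.length

namespace LinkedBy

variable {S T : Set V} {a b c d : V} {n m : ℕ}

theorem single (h : a ∈ S) : LinkedBy G S a a 0 :=
  ⟨Walk.nil, Walk.IsPath.nil, by simpa using h, le_rfl⟩

theorem mono (h : LinkedBy G S a b n) (hS : S ⊆ T) (hn : m ≤ n) : LinkedBy G T a b m := by
  obtain ⟨p, hp, hs, hl⟩ := h
  exact ⟨p, hp, fun x hx => hS (hs x hx), hn.trans hl⟩

theorem symm (h : LinkedBy G S a b n) : LinkedBy G S b a n := by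
  obtain ⟨p, hp, hs, hl⟩ := h
  exact ⟨p.reverse, hp.reverse, by simpa using hs, by simpa using hl⟩

theorem left_mem (h : LinkedBy G S a b n) : a ∈ S := by
  obtain ⟨p, hp, hs, hl⟩ := h
  exact hs _ p.start_mem_support

theorem right_mem (h : LinkedBy G S a b n) : b ∈ S := h.symm.left_mem

theorem join (h : LinkedBy G S a b n) (hbc : G.Adj b c) (h' : LinkedBy G T c d m)
    (hd : Disjoint S T) : LinkedBy G (S ∪ T) a d (n + 1 + m) := by
  obtain ⟨p, hp, hs, hl⟩ := h
  obtain ⟨q, hq, hs', hl'⟩ := h'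
  refine ⟨p.append (Walk.cons hbc q), ?_, ?_, ?_⟩
  · rw [Walk.isPath_def, Walk.support_append, Walk.support_cons, List.tail_cons,
      List.nodup_append]
    refine ⟨hp.support_nodup, hq.support_nodup, ?_⟩
    rintro x hx y hy rfl
    exact Set.disjoint_left.1 hd (hs x hx) (hs' x hy)
  · intro x hx
    rw [Walk.support_append, Walk.support_cons, List.tail_cons, List.mem_append] at hx
    exact hx.imp (hs x) (hs' x)
  · simp; omega

theorem append (h : LinkedBy G S a b n) (h' : LinkedBy G T b d m)
    (hd : S ∩ T ⊆ {b}) : LinkedBy G (S ∪ T) a d (n + m) := by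
  obtain ⟨p, hp, hs, hl⟩ := h
  obtain ⟨q, hq, hs', hl'⟩ := h'
  refine ⟨p.append q, ?_, ?_, ?_⟩
  · rw [Walk.isPath_def, Walk.support_append, List.nodup_append]
    refine ⟨hp.support_nodup, hq.support_nodup.tail, ?_⟩
    rintro x hx y hy rfl
    have hxb : x = b := hd ⟨hs x hx, hs' x (List.mem_of_mem_tail hy)⟩
    subst hxb
    have := hq.support_nodup
    rw [← Walk.cons_tail_support, List.nodup_cons] at this
    exact this.1 hy
  · intro x hx
    rw [Walk.support_append, List.mem_append] at hx
    exact hx.imp (hs x) (fun h => hs' x (List.mem_of_mem_tail h))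
  · simp; omega

theorem cons (hab : G.Adj a b) (h : LinkedBy G S b d n) (ha : a ∉ S) :
    LinkedBy G (insert a S) a d (n + 1) := by
  have := (LinkedBy.single (G := G) (Set.mem_singleton a)).join hab h (by simpa using ha)
  rw [Set.insert_eq]
  exact this.mono le_rfl (by omega)

theorem exists_isCycle (h : LinkedBy G S a b n) (hn : 2 ≤ n) (hba : G.Adj b a) :
    ∃ (v : V) (c : G.Walk v v), c.IsCycle ∧ n + 1 ≤ c.length ∧ ∀ x ∈ c.support, x ∈ S := by
  obtain ⟨p, hp, hs, hl⟩ := h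
  refine ⟨b, Walk.cons hba p, ?_, by simp; omega, ?_⟩
  · rw [Walk.isCycle_iff_isPath_tail_and_le_length]
    simp [hp]; omega
  · intro x hx
    rw [Walk.support_cons, List.mem_cons] at hx
    rcases hx with rfl | hx
    · exact hs _ p.end_mem_support
    · exact hs x hx

end LinkedBy

end

section


/-- In a cyclic arrangement, weights dominated by the pairwise gaps sum to at most the
perimeter. -/
theorem sum_le_of_gaps (n : ℕ) (w : ℤ → ℕ) (X : Finset ℤ)
    (h1 : ∀ i ∈ X, w i ≤ n)
    (h2 : ∀ i ∈ X, ∀ j ∈ X, i < j →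
      (w i : ℤ) + w j ≤ 2 * (j - i) ∧ (w i : ℤ) + w j ≤ 2 * (n - (j - i))) :
    ∑ i ∈ X, w i ≤ n := by
  have key : ∀ Y : Finset ℤ, Y ⊆ X → ∀ a ∈ Y, ∀ b ∈ Y, (∀ x ∈ Y, a ≤ x) → (∀ x ∈ Y, x ≤ b) →
      2 * ((∑ i ∈ Y, w i : ℕ) : ℤ) ≤ 2 * (b - a) + w a + w b := by
    intro Y
    induction Y using Finset.induction_on_max with
    | empty => intro _ a ha; simp at ha
    | insert c Y hc ih =>
      intro hY a ha b hb hmin hmax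
      have hcY : c ∉ Y := fun h => lt_irrefl _ (hc c h)
      have hbc : b = c := by
        have := hmax c (Finset.mem_insert_self _ _)
        rcases Finset.mem_insert.1 hb with h | h
        · exact h
        · have := hc b h; omega
      subst hbc
      rw [Finset.sum_insert hcY]
      rcases Y.eq_empty_or_nonempty with rfl | hne
      · have : a = b := by simpa using ha
        subst this
        simp; omega
      · have haY : a ∈ Y := by
          rcases Finset.mem_insert.1 ha with h | h
          · obtain ⟨y, hy⟩ := hne
            have := hc y hy
            have := hmin y (Finset.mem_insert_of_mem hy)
            omega
          · exact h
        have hd := Y.max'_mem hne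
        have := ih (fun x hx => hY (Finset.mem_insert_of_mem hx)) a haY _ hd
          (fun x hx => hmin x (Finset.mem_insert_of_mem hx)) (fun x hx => Y.le_max' x hx)
        have h3 := (h2 _ (hY (Finset.mem_insert_of_mem hd)) b (hY hb) (hc _ hd)).1
        push_cast at this ⊢
        omega
  rcases X.eq_empty_or_nonempty with rfl | hne
  · simp
  · have := key X le_rfl _ (X.min'_mem hne) _ (X.max'_mem hne) (fun x hx => X.min'_le x hx)
      (fun x hx => X.le_max' x hx)
    rcases (X.min'_le _ (X.max'_mem hne)).eq_or_lt with h | h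
    · have := h1 _ (X.min'_mem hne)
      rw [← h] at *
      omega
    · have := (h2 _ (X.min'_mem hne) _ (X.max'_mem hne) h).2
      omega

variable {V : Type*} {G : SimpleGraph V}

/-- A cycle of length `n`, parametrised by the integers. -/
structure CycMap (G : SimpleGraph V) (n : ℕ) (u : ℤ → V) : Prop where
  three_le : 3 ≤ n
  periodic : ∀ i : ℤ, u (i + n) = u i
  adj : ∀ i, G.Adj (u i) (u (i + 1))
  inj : ∀ i j : ℤ, i ≤ j → j < i + n → u i = u j → i = j

/-- Every cycle of `G` inside `W` has length at most `n`. -/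
def CyclesBounded (G : SimpleGraph V) (W : Set V) (n : ℕ) : Prop :=
  ∀ (v : V) (c : G.Walk v v), c.IsCycle → (∀ x ∈ c.support, x ∈ W) → c.length ≤ n

theorem CyclesBounded.linked {W S : Set V} {n k : ℕ} {a b : V} (hW : CyclesBounded G W n)
    (h : LinkedBy G S a b k) (hS : S ⊆ W) (hk : 2 ≤ k) (hba : G.Adj b a) : k + 1 ≤ n := by
  obtain ⟨v, c, hc, hl, hs⟩ := h.exists_isCycle hk hba
  exact hl.trans (hW v c hc fun x hx => hS (hs x hx))

namespace CycMap

variable {n : ℕ} {u : ℤ → V}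

theorem shift (hu : CycMap G n u) (s : ℤ) : CycMap G n (fun i => u (i + s)) where
  three_le := hu.three_le
  periodic i := by
    have := hu.periodic (i + s)
    rwa [show i + s + n = i + n + s by ring] at this
  adj i := by
    have := hu.adj (i + s)
    rwa [show i + s + 1 = i + 1 + s by ring] at this
  inj i j h h' e := by
    have := hu.inj (i + s) (j + s) (by omega) (by omega) e
    omega

theorem neg (hu : CycMap G n u) : CycMap G n (fun i => u (-i)) where
  three_le := hu.three_le
  periodic i := by
    have := hu.periodic (-(i + n))
    rw [← this]; congr 1; ring
  adj i := by
    have := (hu.adj (-(i + 1))).symm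
    rwa [show -(i + 1) + 1 = -i by ring] at this
  inj i j h h' e := by
    have := hu.inj (-j) (-i) (by omega) (by omega) e.symm
    omega

theorem periodic_mul (hu : CycMap G n u) (i k : ℤ) : u (i + k * n) = u i := by
  have hn : ∀ (k : ℕ) i, u (i + k * n) = u i := by
    intro k
    induction k with
    | zero => simp
    | succ k ih =>
      intro i
      have := hu.periodic (i + k * n)
      rw [← ih i, ← this]; congr 1; push_cast; ring
  rcases Int.eq_nat_or_neg k with ⟨m, rfl | rfl⟩
  · exact hn m i
  · rw [← hn m (i + _)]; congr 1; ring

theorem exists_window (hu : CycMap G n u) (i j : ℤ) : ∃ k, i ≤ k ∧ k < i + n ∧ u k = u j := by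
  have h3 := hu.three_le
  refine ⟨i + (j - i) % n, ?_, ?_, ?_⟩
  · have := Int.emod_nonneg (j - i) (b := n) (by omega)
    omega
  · have := Int.emod_lt_of_pos (j - i) (b := n) (by omega)
    omega
  · rw [← hu.periodic_mul _ ((j - i) / n)]
    congr 1
    have := Int.emod_add_ediv_mul (j - i) n
    omega

theorem exists_window_of_mem (hu : CycMap G n u) {x : V} (hx : x ∈ Set.range u) (i : ℤ) :
    ∃ k, i ≤ k ∧ k < i + n ∧ u k = x := by
  obtain ⟨j, rfl⟩ := hx
  exact hu.exists_window i j

theorem shift_range (u : ℤ → V) (s : ℤ) : Set.range (fun i => u (i + s)) = Set.range u := by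
  ext x; constructor
  · rintro ⟨i, rfl⟩; exact ⟨_, rfl⟩
  · rintro ⟨i, rfl⟩; exact ⟨i - s, by simp⟩

theorem neg_range (u : ℤ → V) : Set.range (fun i => u (-i)) = Set.range u := by
  ext x; constructor
  · rintro ⟨i, rfl⟩; exact ⟨_, rfl⟩
  · rintro ⟨i, rfl⟩; exact ⟨-i, by simp⟩

theorem ne (hu : CycMap G n u) {i j : ℤ} (h : i < j) (h' : j < i + n) : u i ≠ u j := by
  intro e; have := hu.inj i j h.le h' e; omega

theorem arc (hu : CycMap G n u) {i j : ℤ} (h : i ≤ j) (h' : j < i + n) :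
    LinkedBy G (u '' Set.Icc i j) (u i) (u j) (j - i).toNat := by
  obtain ⟨k, rfl⟩ : ∃ k : ℕ, j = i + k := ⟨(j - i).toNat, by omega⟩
  induction k with
  | zero =>
    simpa using LinkedBy.single (G := G) (Set.mem_singleton (u i))
  | succ k ih =>
    have h1 := ih (by omega) (by omega)
    have h2 := LinkedBy.single (G := G) (Set.mem_singleton (u (i + (k + 1 : ℕ))))
    have := h1.join (by simpa [add_assoc] using hu.adj (i + k)) h2 (by
      rw [Set.disjoint_singleton_right]
      rintro ⟨x, hx, e⟩
      rw [Set.mem_Icc] at hx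
      have := hu.inj x (i + (k + 1 : ℕ)) (by push_cast; omega) (by omega) e
      push_cast at this; omega)
    refine this.mono ?_ (by omega)
    rintro x (⟨y, hy, rfl⟩ | hx)
    · exact ⟨y, ⟨hy.1, by have := hy.2; push_cast; omega⟩, rfl⟩
    · rw [Set.mem_singleton_iff.1 hx]
      exact ⟨_, ⟨by omega, le_rfl⟩, rfl⟩

theorem card_image (hu : CycMap G n u) [DecidableEq V] (i : ℤ) :
    ((Finset.Ico i (i + n)).image u).card = n := by
  rw [Finset.card_image_of_injOn]
  · simp
  · intro a ha b hb e
    simp only [Finset.coe_Ico, Set.mem_Ico] at ha hb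
    rcases le_total a b with h | h
    · exact hu.inj a b h (by omega) e
    · exact (hu.inj b a h (by omega) e.symm).symm

theorem coe_image (hu : CycMap G n u) [DecidableEq V] (i : ℤ) :
    (((Finset.Ico i (i + n)).image u : Finset V) : Set V) = Set.range u := by
  ext x
  simp only [Finset.coe_image, Finset.coe_Ico, Set.mem_image, Set.mem_range, Set.mem_Ico]
  constructor
  · rintro ⟨j, -, rfl⟩; exact ⟨j, rfl⟩
  · rintro ⟨j, rfl⟩
    obtain ⟨k, h1, h2, h3⟩ := hu.exists_window i j
    exact ⟨k, ⟨h1, h2⟩, h3⟩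

theorem exists_isCycle (hu : CycMap G n u) :
    ∃ (v : V) (c : G.Walk v v), c.IsCycle ∧ n ≤ c.length ∧ ∀ x ∈ c.support, x ∈ Set.range u := by
  have h3 := hu.three_le
  have h := hu.arc (i := 0) (j := n - 1) (by omega) (by omega)
  obtain ⟨v, c, hc, hl, hs⟩ := h.exists_isCycle (by omega) (by
    have := hu.adj (n - 1)
    have h0 := hu.periodic 0
    rwa [show (n : ℤ) - 1 + 1 = 0 + n by ring, h0] at this)
  exact ⟨v, c, hc, by omega, fun x hx => Set.image_subset_range _ _ (hs x hx)⟩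

theorem _root_.LongCycle.exists_cycMap {v : V} (c : G.Walk v v) (hc : c.IsCycle) :
    ∃ u, CycMap G c.length u ∧ Set.range u = {x | x ∈ c.support} := by
  have h3 := hc.three_le_length
  have hn : (c.length : ℤ) ≠ 0 := by omega
  have hpos : (0 : ℤ) < c.length := by omega
  refine ⟨fun i => c.getVert (i % c.length).toNat, ⟨h3, ?_, ?_, ?_⟩, ?_⟩
  · intro i; simp
  · intro i
    have h1 := Int.emod_nonneg i hn
    have h2 := Int.emod_lt_of_pos i hpos
    have h4 := c.adj_getVert_succ (i := (i % c.length).toNat) (by omega)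
    rcases lt_or_ge (i % c.length + 1) c.length with h | h
    · have : (i + 1) % c.length = i % c.length + 1 := by
        rw [Int.add_emod, Int.emod_eq_of_lt (a := 1) (by omega) (by omega),
          Int.emod_eq_of_lt (by omega) h]
      rw [this, show (i % (c.length : ℤ) + 1).toNat = (i % c.length).toNat + 1 by omega]
      exact h4
    · have h5 : i % c.length + 1 = c.length := by omega
      have : (i + 1) % c.length = 0 := by
        rw [Int.add_emod, Int.emod_eq_of_lt (a := 1) (by omega) (by omega), h5, Int.emod_self]
      rw [this]
      rw [show (i % (c.length : ℤ)).toNat + 1 = c.length by omega, c.getVert_length] at h4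
      simpa using h4
  · intro i j hij hj e
    have h1 := Int.emod_nonneg i hn
    have h2 := Int.emod_lt_of_pos i hpos
    have h1' := Int.emod_nonneg j hn
    have h2' := Int.emod_lt_of_pos j hpos
    have : (i % c.length).toNat = (j % c.length).toNat :=
      hc.getVert_injOn' (by simp; omega) (by simp; omega) e
    have h6 : i % c.length = j % c.length := by omega
    have h7 : (j - i) % c.length = 0 := by rw [Int.sub_emod, h6]; simp
    rw [Int.emod_eq_of_lt (by omega) (by omega)] at h7
    omega
  · ext x
    simp only [Set.mem_range, Set.mem_ofPred_eq, Walk.mem_support_iff_exists_getVert]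
    constructor
    · rintro ⟨i, rfl⟩
      have h1 := Int.emod_nonneg i hn
      have h2 := Int.emod_lt_of_pos i hpos
      exact ⟨_, rfl, by omega⟩
    · rintro ⟨k, rfl, hk⟩
      rcases hk.lt_or_eq with h | h
      · refine ⟨k, ?_⟩
        rw [Int.emod_eq_of_lt (by omega) (by omega)]; simp
      · exact ⟨0, by simp [h]⟩

variable {W T : Set V}

theorem chord_gap (hu : CycMap G n u) (hW : CyclesBounded G W n) (huW : Set.range u ⊆ W)
    (hTW : T ⊆ W) (hTu : Disjoint T (Set.range u)) {a b : V} {ℓ : ℕ} (hab : LinkedBy G T a b ℓ)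
    {i k : ℤ} (hik : i < k) (hki : k < i + n) (ha : G.Adj a (u i)) (hb : G.Adj b (u k)) :
    (ℓ : ℤ) + 2 ≤ k - i := by
  have h1 := hu.arc (i := k) (j := i + n) (by omega) (by omega)
  rw [hu.periodic] at h1
  have h2 := h1.join ha.symm hab
    (hTu.symm.mono_left (Set.image_subset_range _ _))
  have := hW.linked h2 (Set.union_subset ((Set.image_subset_range _ _).trans huW) hTW)
    (by omega) hb
  omega

theorem chord_gap' (hu : CycMap G n u) (hW : CyclesBounded G W n) (huW : Set.range u ⊆ W)
    (hTW : T ⊆ W) (hTu : Disjoint T (Set.range u)) {a b : V} {ℓ : ℕ} (hab : LinkedBy G T a b ℓ)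
    {i k : ℤ} (hik : i < k) (hki : k < i + n) (ha : G.Adj a (u i)) (hb : G.Adj b (u k)) :
    (ℓ : ℤ) + 2 ≤ n - (k - i) := by
  have := hu.chord_gap hW huW hTW hTu hab.symm (i := k) (k := i + n) (by omega) (by omega) hb
    (by rwa [hu.periodic])
  omega

theorem chord_self (hW : CyclesBounded G W n) (huW : Set.range u ⊆ W)
    (hTW : T ⊆ W) (hTu : Disjoint T (Set.range u)) {a b : V} {ℓ : ℕ} (hab : LinkedBy G T a b ℓ)
    (hℓ : 1 ≤ ℓ) {i : ℤ} (ha : G.Adj a (u i)) (hb : G.Adj b (u i)) : ℓ + 2 ≤ n := by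
  have h1 := LinkedBy.single (G := G) (Set.mem_singleton (u i))
  have h2 := h1.join ha.symm hab (by
    rw [Set.disjoint_singleton_left]
    exact fun h => Set.disjoint_left.1 hTu h ⟨i, rfl⟩)
  have := hW.linked h2 (Set.union_subset (by simpa using huW ⟨i, rfl⟩) hTW) (by omega) hb
  omega

end CycMap

end

section


variable {V : Type*} [Fintype V] {G : SimpleGraph V}

open Classical in
/-- The neighbours of `v` inside `S`. -/
noncomputable def nbrs (G : SimpleGraph V) (S : Set V) (v : V) : Finset V :=
  Finset.univ.filter fun x => x ∈ S ∧ G.Adj v x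

@[simp] theorem mem_nbrs {S : Set V} {v x : V} : x ∈ nbrs G S v ↔ x ∈ S ∧ G.Adj v x := by
  simp [nbrs]

open Classical in
/-- In `F`, every vertex reaches all but `k` of the others by paths in `K` longer than `k`. -/
def WellLinked (G : SimpleGraph V) (K : Set V) (F : Finset V) : Prop :=
  ∀ v ∈ F, ∀ k : ℕ, (F.filter fun v' => v' ≠ v ∧ ¬ LinkedBy G K v v' (k + 1)).card ≤ k

open Classical in
theorem WellLinked.card_lt {K : Set V} {F A B : Finset V} (hF : WellLinked G K F) {D : ℕ}
    (hA : A ⊆ F) (hB : B ⊆ F) (hAn : A.Nonempty) (hBn : B.Nonempty)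
    (h : ∀ a ∈ A, ∀ b ∈ B, ∀ ℓ, LinkedBy G K a b ℓ → ℓ + 2 ≤ D)
    (hFK : ∀ v ∈ F, v ∈ K) : B.card < D := by
  obtain ⟨a, ha⟩ := hAn
  have h2 : 2 ≤ D := by
    obtain ⟨b, hb⟩ := hBn
    by_cases hab : b = a
    · subst hab
      simpa using h b ha b hb 0 (LinkedBy.single (hFK b (hA ha)))
    · by_contra hD
      have h0 := hF a (hA ha) 0
      have : b ∈ F.filter fun v' => v' ≠ a ∧ ¬ LinkedBy G K a v' (0 + 1) := by
        simp only [Finset.mem_filter]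
        exact ⟨hB hb, hab, fun hl => by have := h a ha b hb _ hl; omega⟩
      have := Finset.card_pos.2 ⟨b, this⟩
      omega
  have hk := hF a (hA ha) (D - 2)
  have hs : B.erase a ⊆ F.filter fun v' => v' ≠ a ∧ ¬ LinkedBy G K a v' (D - 2 + 1) := by
    intro b hb
    simp only [Finset.mem_erase, Finset.mem_filter] at hb ⊢
    exact ⟨hB hb.2, hb.1, fun hl => by have := h a ha b hb.2 _ hl; omega⟩
  have h3 := Finset.card_le_card hs
  have h4 := B.pred_card_le_card_erase (a := a)
  omega

open Classical in
/-- A well-linked set off a longest cycle forces that cycle to be long. -/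
theorem WellLinked.sum_card_add_le {n : ℕ} {u : ℤ → V} (hu : CycMap G n u)
    (hlong : CyclesBounded G Set.univ n) {F : Finset V} (hFK : ∀ v ∈ F, v ∈ (Set.range u)ᶜ)
    (hF : WellLinked G (Set.range u)ᶜ F) :
    ∑ v ∈ F, (nbrs G (Set.range u) v).card + (F.biUnion (nbrs G (Set.range u))).card ≤ n := by
  set K := (Set.range u)ᶜ with hK
  let A : ℤ → Finset V := fun i => F.filter fun v => G.Adj v (u i)
  let X : Finset ℤ := (Finset.Ico (0 : ℤ) n).filter fun i => (A i).Nonempty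
  have hinj : ∀ i ∈ Finset.Ico (0 : ℤ) n, ∀ j ∈ Finset.Ico (0 : ℤ) n, u i = u j → i = j := by
    intro i hi j hj e
    rw [Finset.mem_Ico] at hi hj
    rcases le_total i j with h | h
    · exact hu.inj i j h (by omega) e
    · exact (hu.inj j i h (by omega) e.symm).symm
  have hd : Disjoint K (Set.range u) := disjoint_compl_left
  have hn3 := hu.three_le
  have main := sum_le_of_gaps n (fun i => 1 + (A i).card) X ?_ ?_
  · have e1 : (F.biUnion (nbrs G (Set.range u))).card = X.card := by
      rw [← Finset.card_image_of_injOn (s := X) (f := u)]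
      · congr 1
        ext x
        simp only [Finset.mem_biUnion, mem_nbrs, Finset.mem_image, X, A, Finset.mem_filter,
          Finset.mem_Ico]
        constructor
        · rintro ⟨v, hv, hx, hvx⟩
          obtain ⟨k, h1, h2, rfl⟩ := hu.exists_window_of_mem hx 0
          exact ⟨k, ⟨⟨h1, by omega⟩, v, by simp [hv, hvx]⟩, rfl⟩
        · rintro ⟨k, ⟨h1, v, hv⟩, rfl⟩
          rw [Finset.mem_filter] at hv
          exact ⟨v, hv.1, ⟨k, rfl⟩, hv.2⟩
      · intro i hi j hj e
        exact hinj i (Finset.filter_subset _ _ hi) j (Finset.filter_subset _ _ hj) e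
    have e2 : ∑ v ∈ F, (nbrs G (Set.range u) v).card = ∑ i ∈ X, (A i).card := by
      have : ∀ v ∈ F, (nbrs G (Set.range u) v).card = (X.filter fun i => G.Adj v (u i)).card := by
        intro v hv
        rw [← Finset.card_image_of_injOn (s := X.filter fun i => G.Adj v (u i)) (f := u)]
        · congr 1
          ext x
          simp only [mem_nbrs, Finset.mem_image, X, A, Finset.mem_filter, Finset.mem_Ico]
          constructor
          · rintro ⟨hx, hvx⟩
            obtain ⟨k, h1, h2, rfl⟩ := hu.exists_window_of_mem hx 0
            exact ⟨k, ⟨⟨⟨h1, by omega⟩, v, by simp [hv, hvx]⟩, hvx⟩, rfl⟩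
          · rintro ⟨k, ⟨h1, hv⟩, rfl⟩
            exact ⟨⟨k, rfl⟩, hv⟩
        · intro i hi j hj e
          exact hinj i (Finset.filter_subset _ _ (Finset.filter_subset _ _ hi)) j
            (Finset.filter_subset _ _ (Finset.filter_subset _ _ hj)) e
      rw [Finset.sum_congr rfl this]
      exact Finset.sum_card_bipartiteAbove_eq_sum_card_bipartiteBelow
        (s := F) (t := X) fun v i => G.Adj v (u i)
    rw [e1, e2]
    rw [Finset.sum_add_distrib] at main
    simp only [Finset.sum_const, smul_eq_mul, mul_one] at main
    omega
  · intro i hi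
    obtain ⟨hi, a, ha⟩ := Finset.mem_filter.1 hi
    have hk := hF a (Finset.mem_filter.1 ha).1 (n - 2)
    have hs : (A i).erase a ⊆ F.filter fun v' => v' ≠ a ∧ ¬ LinkedBy G K a v' (n - 2 + 1) := by
      intro b hb
      simp only [Finset.mem_erase, Finset.mem_filter, A] at hb ⊢
      refine ⟨hb.2.1, hb.1, fun hl => ?_⟩
      have := CycMap.chord_self hlong (Set.subset_univ _) (Set.subset_univ _) hd hl (by omega)
        (Finset.mem_filter.1 ha).2 hb.2.2
      omega
    have h3 := Finset.card_le_card hs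
    have h4 := (A i).pred_card_le_card_erase (a := a)
    omega
  · intro i hi j hj hij
    obtain ⟨hi, hAi⟩ := Finset.mem_filter.1 hi
    obtain ⟨hj, hAj⟩ := Finset.mem_filter.1 hj
    rw [Finset.mem_Ico] at hi hj
    have hsub : ∀ i, A i ⊆ F := fun i => Finset.filter_subset _ _
    have hadj : ∀ i, ∀ a ∈ A i, G.Adj a (u i) := fun i a ha => (Finset.mem_filter.1 ha).2
    have g1 : ∀ a ∈ A i, ∀ b ∈ A j, ∀ ℓ, LinkedBy G K a b ℓ → ℓ + 2 ≤ (j - i).toNat := by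
      intro a ha b hb ℓ hl
      have := hu.chord_gap hlong (Set.subset_univ _) (Set.subset_univ _) hd hl hij (by omega)
        (hadj i a ha) (hadj j b hb)
      omega
    have g2 : ∀ a ∈ A i, ∀ b ∈ A j, ∀ ℓ, LinkedBy G K a b ℓ → ℓ + 2 ≤ (n - (j - i)).toNat := by
      intro a ha b hb ℓ hl
      have := hu.chord_gap' hlong (Set.subset_univ _) (Set.subset_univ _) hd hl hij (by omega)
        (hadj i a ha) (hadj j b hb)
      omega
    have r1 := hF.card_lt (hsub i) (hsub j) hAi hAj g1 hFK
    have r2 := hF.card_lt (hsub j) (hsub i) hAj hAi (fun a ha b hb ℓ h => g1 b hb a ha ℓ h.symm) hFK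
    have r3 := hF.card_lt (hsub i) (hsub j) hAi hAj g2 hFK
    have r4 := hF.card_lt (hsub j) (hsub i) hAj hAi (fun a ha b hb ℓ h => g2 b hb a ha ℓ h.symm) hFK
    push_cast
    omega

end

section


section Menger

variable {V : Type*}

/-- `S` separates `A` from `B`, as witnessed by the set of vertices on the side of `A`. -/
def Separates (G : SimpleGraph V) (A B S : Set V) : Prop :=
  ∃ R : Set V, Disjoint R S ∧ A ⊆ R ∪ S ∧ (∀ x ∈ R, ∀ y, G.Adj x y → y ∈ R ∪ S) ∧ Disjoint B R

/-- There are `k` disjoint paths from `A` to `B`, each meeting `A ∪ B` only in its ends. -/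
def Linkage (G : SimpleGraph V) (A B : Set V) (k : ℕ) : Prop :=
  ∃ (a b : Fin k → V) (p : ∀ i, G.Walk (a i) (b i)), (∀ i, (p i).IsPath) ∧
    (∀ i j, i ≠ j → ∀ x ∈ (p i).support, x ∉ (p j).support) ∧
    (∀ i, a i ∈ A ∧ b i ∈ B) ∧
    ∀ i, ∀ x ∈ (p i).support, (x ∈ A → x = a i) ∧ (x ∈ B → x = b i)

theorem support_subset_of_closed {G : SimpleGraph V} {R S : Set V}
    (hR : ∀ x ∈ R, ∀ y, G.Adj x y → y ∈ R ∪ S) {a b : V} (p : G.Walk a b) (hp : p.IsPath)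
    (ha : a ∈ R ∪ S) (hS : ∀ x ∈ p.support, x ∈ S → x = b) :
    ∀ x ∈ p.support, x ∈ R ∪ S := by
  induction p with
  | nil => simpa using ha
  | cons h p ih =>
    rw [Walk.cons_isPath_iff] at hp
    rename_i w _ _
    have haR : w ∈ R := by
      refine ha.resolve_right fun haS => ?_
      have := hS _ (Walk.start_mem_support _) haS
      exact hp.2 (this ▸ p.end_mem_support)
    intro x hx
    rw [Walk.support_cons, List.mem_cons] at hx
    rcases hx with rfl | hx
    · exact ha
    · refine ih hp.1 (hR _ haR _ h) (fun y hy => hS y ?_) x hx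
      rw [Walk.support_cons]
      exact List.mem_cons_of_mem _ hy

theorem Linkage.mono {G G' : SimpleGraph V} (h : G ≤ G') {A B : Set V} {k : ℕ}
    (hl : Linkage G A B k) : Linkage G' A B k := by
  obtain ⟨a, b, p, h1, h2, h3, h4⟩ := hl
  refine ⟨a, b, fun i => (p i).mapLe h, fun i => (Walk.isPath_mapLe h).2 (h1 i), ?_, h3, ?_⟩
  · intro i j hij x hx
    rw [Walk.support_mapLe_eq_support] at hx ⊢
    exact h2 i j hij x hx
  · intro i x hx
    rw [Walk.support_mapLe_eq_support] at hx
    exact h4 i x hx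

theorem Linkage.exists_start {G : SimpleGraph V} {k : ℕ}
    {a b : Fin k → V} {p : ∀ i, G.Walk (a i) (b i)}
    (h2 : ∀ i j, i ≠ j → ∀ x ∈ (p i).support, x ∉ (p j).support) :
    Function.Injective a ∧ Function.Injective b := by
  constructor
  · intro i j hij
    by_contra hne
    exact h2 i j hne _ (p i).start_mem_support (by rw [hij]; exact (p j).start_mem_support)
  · intro i j hij
    by_contra hne
    exact h2 i j hne _ (p i).end_mem_support (by rw [hij]; exact (p j).end_mem_support)

open Classical in
theorem exists_eq_of_injective {k : ℕ} {S : Finset V} (hS : S.card = k) {b : Fin k → V}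
    (hb : Function.Injective b) (hbS : ∀ i, b i ∈ S) {s : V} (hs : s ∈ S) : ∃ i, b i = s := by
  have : Finset.univ.image b = S := by
    apply Finset.eq_of_subset_of_card_le
    · intro x hx
      obtain ⟨i, -, rfl⟩ := Finset.mem_image.1 hx
      exact hbS i
    · rw [Finset.card_image_of_injective _ hb]; simp [hS]
  rw [← this] at hs
  simpa using hs

open Classical in
theorem linkage_of_cut {G : SimpleGraph V} {A B : Set V} {k : ℕ} {x y : V} (hxy : G.Adj x y)
    {S : Finset V} {R : Set V} (hRS : Disjoint R (S : Set V))
    (hAR : A ⊆ R ∪ S) (hR : ∀ a ∈ R, ∀ b, (G.deleteEdges {s(x, y)}).Adj a b → b ∈ R ∪ (S : Set V))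
    (hBR : Disjoint B R) (hx : x ∈ R) (hyS : y ∉ S) (hk : S.card + 1 = k)
    (hp : Linkage (G.deleteEdges {s(x, y)}) A (insert x (S : Set V)) k)
    (hq : Linkage (G.deleteEdges {s(x, y)}) (insert y (S : Set V)) B k) :
    Linkage G A B k := by
  have hle : G.deleteEdges {s(x, y)} ≤ G := deleteEdges_le _
  have hR' : ∀ a ∈ (R ∪ (S : Set V))ᶜ, ∀ b, (G.deleteEdges {s(x, y)}).Adj a b →
      b ∈ (R ∪ (S : Set V))ᶜ ∪ (S : Set V) := by
    intro a ha b hab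
    by_cases hbS : b ∈ (S : Set V)
    · exact Or.inr hbS
    · left
      rintro (hb | hb)
      · exact ha (hR b hb a hab.symm)
      · exact hbS hb
  have hxS : x ∉ S := fun h => Set.disjoint_left.1 hRS hx h
  obtain ⟨a, s, p, p1, p2, p3, p4⟩ := hp
  obtain ⟨t, b, q, q1, q2, q3, q4⟩ := hq
  have hpR : ∀ i, ∀ v ∈ (p i).support, v ∈ R ∪ (S : Set V) := fun i =>
    support_subset_of_closed hR (p i) (p1 i) (hAR (p3 i).1)
      (fun v hv hvS => (p4 i v hv).2 (Or.inr hvS))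
  have hqR : ∀ i, ∀ v ∈ (q i).support, v ∉ R := by
    intro i v hv hvR
    have := support_subset_of_closed hR' (q i).reverse (q1 i).reverse (by
      by_cases h : b i ∈ (S : Set V)
      · exact Or.inr h
      · left
        rintro (h' | h')
        · exact Set.disjoint_left.1 hBR (q3 i).2 h'
        · exact h h') (fun w hw hwS => (q4 i w (by simpa using hw)).1 (Or.inr hwS)) v
        (by simpa using hv)
    rcases this with h | h
    · exact h (Or.inl hvR)
    · exact Set.disjoint_left.1 hRS hvR h
  have hmeet : ∀ i j, ∀ v ∈ (p i).support, v ∈ (q j).support → v ∈ S ∧ v = s i ∧ v = t j := by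
    intro i j v hv hv'
    have hvS := (hpR i v hv).resolve_left (hqR j v hv')
    exact ⟨hvS, (p4 i v hv).2 (Or.inr hvS), (q4 j v hv').1 (Or.inr hvS)⟩
  obtain ⟨ainj, sinj⟩ := Linkage.exists_start p2
  obtain ⟨tinj, binj⟩ := Linkage.exists_start q2
  let f : V → V := fun v => if v = x then y else v
  have hσ : ∀ i, ∃ j, t j = f (s i) := by
    intro i
    refine exists_eq_of_injective (S := insert y S) ?_ tinj
      (fun j => by simpa using (q3 j).1) ?_
    · rw [Finset.card_insert_of_notMem hyS, hk]
    · have := (p3 i).2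
      simp only [f]
      split_ifs with h
      · simp
      · exact Finset.mem_insert_of_mem (by simpa [h] using this)
  choose σ hσ using hσ
  have hsS : ∀ i, s i = x ∨ s i ∈ S := fun i => by simpa using (p3 i).2
  have hfinj : ∀ i j, f (s i) = f (s j) → s i = s j := by
    intro i j e
    have hi := hsS i
    have hj := hsS j
    simp only [f] at e
    split_ifs at e with h h' h'
    · rw [h, h']
    · rcases hj with hj | hj
      · exact absurd hj h'
      · rw [← e] at hj; exact absurd hj hyS
    · rcases hi with hi | hi
      · exact absurd hi h
      · rw [e] at hi; exact absurd hi hyS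
    · exact e
  have σinj : Function.Injective σ := by
    intro i j e
    apply sinj
    apply hfinj
    rw [← hσ, ← hσ, e]
  have hT : ∀ i, LinkedBy G ({v | v ∈ (p i).support} ∪ {v | v ∈ (q (σ i)).support})
      (a i) (b (σ i)) 0 := by
    intro i
    have hP : LinkedBy G {v | v ∈ (p i).support} (a i) (s i) 0 :=
      ⟨(p i).mapLe hle, (Walk.isPath_mapLe hle).2 (p1 i), by simp, Nat.zero_le _⟩
    have hQ : LinkedBy G {v | v ∈ (q (σ i)).support} (t (σ i)) (b (σ i)) 0 :=
      ⟨(q (σ i)).mapLe hle, (Walk.isPath_mapLe hle).2 (q1 _), by simp, Nat.zero_le _⟩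
    rcases eq_or_ne (s i) x with h | h
    · have ht : t (σ i) = y := by rw [hσ]; simp [f, h]
      refine (hP.join (by rw [h, ht]; exact hxy) hQ ?_).mono le_rfl (Nat.zero_le _)
      rw [Set.disjoint_left]
      intro v hv hv'
      have := hmeet i (σ i) v hv hv'
      apply hxS
      rw [← h, ← this.2.1]; exact this.1
    · have ht : t (σ i) = s i := by rw [hσ]; simp [f, h]
      have hm : ∀ v ∈ {v | v ∈ (p i).support}, v ∈ {v | v ∈ (q (σ i)).support} → v = s i :=
        fun v hv hv' => (hmeet i (σ i) v hv hv').2.1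
      generalize {v | v ∈ (q (σ i)).support} = Q at hQ hm ⊢
      rw [ht] at hQ
      refine hP.append hQ ?_
      rintro v ⟨hv, hv'⟩
      exact hm v hv hv'
  choose P hP1 hP2 hP3 using hT
  refine ⟨a, fun i => b (σ i), P, hP1, ?_, fun i => ⟨(p3 i).1, (q3 _).2⟩, ?_⟩
  · intro i j hij v hv hv'
    have hst : ∀ i j, s i ∈ S → s i = t (σ j) → i = j := by
      intro i j hi e
      rw [hσ] at e
      apply sinj; apply hfinj; rw [← e]
      simp only [f]
      rw [if_neg]
      rintro h
      exact hxS (h ▸ hi)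
    rcases hP2 i v hv with h | h <;> rcases hP2 j v hv' with h' | h'
    · exact p2 i j hij v h h'
    · obtain ⟨e1, e2, e3⟩ := hmeet i (σ j) v h h'
      exact hij (hst i j (e2 ▸ e1) (e2 ▸ e3))
    · obtain ⟨e1, e2, e3⟩ := hmeet j (σ i) v h' h
      exact hij (hst j i (e2 ▸ e1) (e2 ▸ e3)).symm
    · exact q2 _ _ (fun e => hij (σinj e)) v h h'
  · intro i v hv
    have hstart : ∀ v ∈ S, v = t (σ i) → v ∈ (p i).support := by
      intro v hvS e
      rw [hσ] at e
      have : v = s i := by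
        simp only [f] at e
        split_ifs at e with h
        · exact absurd (e ▸ hvS) hyS
        · exact e
      rw [this]; exact (p i).end_mem_support
    rcases hP2 i v hv with h | h
    · refine ⟨(p4 i v h).1, fun hvB => ?_⟩
      have hvS := (hpR i v h).resolve_left (Set.disjoint_left.1 hBR hvB)
      have e := (p4 i v h).2 (Or.inr hvS)
      have ht : t (σ i) = v := by
        rw [hσ]; simp only [f]; rw [if_neg, e]
        intro h'; exact hxS (h' ▸ e ▸ hvS)
      exact (q4 (σ i) v (ht ▸ (q (σ i)).start_mem_support)).2 hvB
    · refine ⟨fun hvA => ?_, (q4 _ v h).2⟩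
      have hvS := (hAR hvA).resolve_left (hqR _ v h)
      have e := (q4 _ v h).1 (Or.inr hvS)
      exact (p4 i v (hstart v hvS e)).1 hvA

open Classical in
/-- **Menger's theorem**, set version. -/
theorem menger [Fintype V] (G : SimpleGraph V) (k : ℕ) : ∀ A B : Set V,
    (∀ S : Finset V, Separates G A B S → k ≤ S.card) → Linkage G A B k := by
  induction G using WellFoundedLT.induction with
  | ind G ih =>
  intro A B hsep
  by_cases hG : ∃ x y, G.Adj x y
  swap
  · have h1 := hsep (Finset.univ.filter fun v => v ∈ A ∩ B) ⟨A \ B, by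
      rw [Set.disjoint_left]; intro v hv; simp [hv.1, hv.2], by
      intro v hv; by_cases h : v ∈ B <;> simp [hv], by
      intro x _ y h; exact absurd ⟨x, y, h⟩ hG, Set.disjoint_sdiff_right⟩
    obtain ⟨T, hT, hTk⟩ := Finset.exists_subset_card_eq h1
    let e := (Finset.equivFinOfCardEq hTk).symm
    have hmem : ∀ i, (e i : V) ∈ A ∩ B := fun i => (Finset.mem_filter.1 (hT (e i).2)).2
    refine ⟨fun i => e i, fun i => e i, fun i => Walk.nil, fun i => Walk.IsPath.nil, ?_,
      fun i => hmem i, ?_⟩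
    · intro i j hij v hv hv'
      simp only [Walk.support_nil, List.mem_singleton] at hv hv'
      exact hij (e.injective (Subtype.ext (hv ▸ hv')))
    · intro i v hv
      simp only [Walk.support_nil, List.mem_singleton] at hv
      exact ⟨fun _ => hv, fun _ => hv⟩
  obtain ⟨x₀, y₀, hxy₀⟩ := hG
  have hlt : G.deleteEdges {s(x₀, y₀)} < G := by
    refine lt_of_le_of_ne (deleteEdges_le _) fun e => ?_
    have : (G.deleteEdges {s(x₀, y₀)}).Adj x₀ y₀ := by rw [e]; exact hxy₀
    simp at this
  by_cases hS : ∃ S : Finset V, Separates (G.deleteEdges {s(x₀, y₀)}) A B S ∧ S.card < k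
  swap
  · push Not at hS
    exact (ih _ hlt A B hS).mono (deleteEdges_le _)
  obtain ⟨S, ⟨R, hRS, hAR, hR, hBR⟩, hSk⟩ := hS
  obtain ⟨x, y, hxy, hG', hxR, hyR, hyS⟩ : ∃ x y, G.Adj x y ∧
      G.deleteEdges {s(x₀, y₀)} = G.deleteEdges {s(x, y)} ∧ x ∈ R ∧ y ∉ R ∧ y ∉ S := by
    by_contra hcon
    push Not at hcon
    refine absurd (hsep S ⟨R, hRS, hAR, ?_, hBR⟩) (by omega)
    intro a ha b hab
    by_cases he : s(a, b) = s(x₀, y₀)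
    · by_contra hb
      exact hb (Or.inr (hcon a b hab (by rw [he]) ha (fun h => hb (Or.inl h))))
    · exact hR a ha b (by rw [deleteEdges_adj]; exact ⟨hab, he⟩)
  rw [hG'] at hlt hR
  have hdel : ∀ a b, G.Adj a b → (G.deleteEdges {s(x, y)}).Adj a b ∨
      (a = x ∧ b = y) ∨ (a = y ∧ b = x) := by
    intro a b hab
    by_cases he : s(a, b) = s(x, y)
    · right; simpa using he
    · left; rw [deleteEdges_adj]; exact ⟨hab, he⟩
  have hxS : x ∉ S := fun h => Set.disjoint_left.1 hRS hxR h
  have hcard : S.card + 1 = k := by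
    have := hsep (insert y S) ⟨R, by
      rw [Finset.coe_insert, Set.disjoint_insert_right]; exact ⟨hyR, hRS⟩, by
      rw [Finset.coe_insert]
      exact hAR.trans (Set.union_subset_union_right _ (Set.subset_insert _ _)), by
      intro a ha b hab
      rcases hdel a b hab with h | ⟨rfl, rfl⟩ | ⟨rfl, rfl⟩
      · rw [Finset.coe_insert]
        exact Set.union_subset_union_right _ (Set.subset_insert _ _) (hR a ha b h)
      · simp
      · exact Or.inl hxR, hBR⟩
    rw [Finset.card_insert_of_notMem hyS] at this
    omega
  refine linkage_of_cut hxy hRS hAR hR hBR hxR hyS hcard (ih _ hlt _ _ ?_) (ih _ hlt _ _ ?_)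
  · rintro Z ⟨Q, hQZ, hAQ, hQ, hBQ⟩
    apply hsep Z
    rw [Set.disjoint_insert_left] at hBQ
    have hnS : ∀ w ∈ Q, w ∉ S := fun w hw h => Set.disjoint_left.1 hBQ.2 h hw
    refine ⟨Q ∩ R, hQZ.mono_left Set.inter_subset_left, ?_, ?_,
      hBR.mono_right Set.inter_subset_right⟩
    · intro w hw
      rcases hAQ hw with h | h
      · exact Or.inl ⟨h, (hAR hw).resolve_right (hnS w h)⟩
      · exact Or.inr h
    · intro w hw w' hww
      rcases hdel w w' hww with h | ⟨rfl, rfl⟩ | ⟨rfl, rfl⟩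
      · rcases hQ w hw.1 w' h with h' | h'
        · exact Or.inl ⟨h', (hR w hw.2 w' h).resolve_right (hnS w' h')⟩
        · exact Or.inr h'
      · exact absurd hw.1 hBQ.1
      · exact absurd hw.2 hyR
  · rintro Z ⟨Q, hQZ, hAQ, hQ, hBQ⟩
    apply hsep Z
    rw [Set.insert_subset_iff] at hAQ
    have hback : ∀ w, w ∈ R ∪ (S : Set V) → w ∈ (Q ∪ R \ Z) ∪ (Z : Set V) := by
      rintro w (h | h)
      · by_cases hZ : w ∈ (Z : Set V)
        · exact Or.inr hZ
        · exact Or.inl (Or.inr ⟨h, hZ⟩)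
      · exact (hAQ.2 h).imp Or.inl id
    refine ⟨Q ∪ R \ Z, ?_, fun w hw => hback w (hAR hw), ?_, ?_⟩
    · rw [Set.disjoint_union_left]; exact ⟨hQZ, Set.disjoint_sdiff_left⟩
    · intro w hw w' hww
      rcases hdel w w' hww with h | ⟨rfl, rfl⟩ | ⟨rfl, rfl⟩
      · rcases hw with hw | hw
        · exact (hQ w hw w' h).imp Or.inl id
        · exact hback w' (hR w hw.1 w' h)
      · exact hAQ.1.imp Or.inl id
      · exact hback _ (Or.inl hxR)
    · rw [Set.disjoint_union_right]; exact ⟨hBQ, hBR.mono_right Set.sdiff_subset⟩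

end Menger

end

section


variable {V : Type*} [Fintype V] {G : SimpleGraph V}

open Classical in
/-- Distinct feet on a longest cycle whose attached vertices are pairwise linked by paths of
length `ℓ` off the cycle are pairwise `ℓ + 2` apart. -/
theorem card_mul_le_of_feet {n : ℕ} {u : ℤ → V} (hu : CycMap G n u)
    (hlong : CyclesBounded G Set.univ n) {k ℓ : ℕ} (hk : 2 ≤ k) (x ξ : Fin k → V)
    (hξ : Function.Injective ξ) (hξu : ∀ i, ξ i ∈ Set.range u) (hadj : ∀ i, G.Adj (x i) (ξ i))
    (hlink : ∀ i j, i ≠ j → LinkedBy G (Set.range u)ᶜ (x i) (x j) ℓ) : k * (ℓ + 2) ≤ n := by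
  have hd : Disjoint (Set.range u)ᶜ (Set.range u) := disjoint_compl_left
  choose p hp1 hp2 hp3 using fun i => hu.exists_window_of_mem (hξu i) 0
  have pinj : Function.Injective p := fun i j e => hξ (by rw [← hp3 i, ← hp3 j, e])
  have gap : ∀ i j, p i < p j → ((ℓ + 2 : ℕ) : ℤ) ≤ p j - p i ∧
      ((ℓ + 2 : ℕ) : ℤ) ≤ n - (p j - p i) := by
    intro i j hij
    have hne : i ≠ j := fun e => by rw [e] at hij; exact lt_irrefl _ hij
    have h1 := hp1 i
    have h2 := hp2 j
    have hai := hadj i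
    have haj := hadj j
    rw [← hp3] at hai haj
    have g1 := hu.chord_gap hlong (Set.subset_univ _) (Set.subset_univ _) hd (hlink i j hne) hij
      (by omega) hai haj
    have g2 := hu.chord_gap' hlong (Set.subset_univ _) (Set.subset_univ _) hd (hlink i j hne) hij
      (by omega) hai haj
    push_cast
    exact ⟨g1, g2⟩
  have main := sum_le_of_gaps n (fun _ => ℓ + 2) (Finset.univ.image p) ?_ ?_
  · rw [Finset.sum_const, Finset.card_image_of_injective _ pinj, Finset.card_univ,
      Fintype.card_fin, smul_eq_mul] at main
    exact main
  · intro _ _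
    have h01 : p ⟨0, by omega⟩ ≠ p ⟨1, by omega⟩ := fun e => by
      have := pinj e; simp at this
    rcases lt_or_gt_of_ne h01 with h | h
    · have := gap _ _ h; omega
    · have := gap _ _ h; omega
  · intro i hi j hj hij
    obtain ⟨i, -, rfl⟩ := Finset.mem_image.1 hi
    obtain ⟨j, -, rfl⟩ := Finset.mem_image.1 hj
    have := gap i j hij
    omega

theorem mem_of_reachable {W : Type*} {H : SimpleGraph W} {R : Set W}
    (hR : ∀ x ∈ R, ∀ y, H.Adj x y → y ∈ R) {a b : W} (h : H.Reachable a b) (ha : a ∈ R) :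
    b ∈ R := by
  obtain ⟨p⟩ := h
  induction p with
  | nil => exact ha
  | cons h _ ih => exact ih (hR _ ha _ h)

theorem linkage_of_isKConnected {l : ℕ} (hG : IsKConnected G l) {A B : Set V}
    (hA : l ≤ A.ncard) (hB : l ≤ B.ncard) : Linkage G A B l := by
  classical
  apply menger
  rintro S ⟨R, hRS, hAR, hR, hBR⟩
  by_contra hS
  push Not at hS
  have hex : ∀ A : Set V, l ≤ A.ncard → ∃ a ∈ A, a ∉ S := by
    intro A hA
    by_contra hcon
    push Not at hcon
    have : A.ncard ≤ (S : Set V).ncard := Set.ncard_le_ncard hcon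
    rw [Set.ncard_coe_finset] at this
    omega
  obtain ⟨a, ha, haS⟩ := hex A hA
  obtain ⟨b, hb, hbS⟩ := hex B hB
  have hconn := (hG.2 S hS).preconnected ⟨a, by simpa using haS⟩ ⟨b, by simpa using hbS⟩
  have := mem_of_reachable (R := {x : ((S : Set V)ᶜ : Set V) | (x : V) ∈ R}) (by
    intro x hx y hxy
    refine (hR x hx y hxy).resolve_right ?_
    exact y.2) hconn ((hAR ha).resolve_right haS)
  exact Set.disjoint_left.1 hBR hb this

theorem CycMap.ncard_range {n : ℕ} {u : ℤ → V} (hu : CycMap G n u) : (Set.range u).ncard = n := by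
  classical
  rw [← hu.coe_image 0, Set.ncard_coe_finset, hu.card_image]

theorem exists_tail_linked {w a : V} (q : G.Walk w a) (hq : q.IsPath) (hne : w ≠ a) :
    ∃ (x : V) (T : Set V), G.Adj x w ∧ T ⊆ {v | v ∈ q.support} ∧ w ∉ T ∧ LinkedBy G T x a 0 := by
  cases q with
  | nil => exact absurd rfl hne
  | cons h q =>
    rw [Walk.cons_isPath_iff] at hq
    refine ⟨_, {v | v ∈ q.support}, h.symm, ?_, hq.2, q, hq.1, fun _ h => h, Nat.zero_le _⟩
    intro v hv
    change v ∈ (Walk.cons h q).support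
    rw [Walk.support_cons]
    exact List.mem_cons_of_mem _ hv

/-- Disjoint routes from a set off a cycle to the cycle. -/
theorem exists_routes {n : ℕ} {u : ℤ → V} (hu : CycMap G n u) {l : ℕ} (hG : IsKConnected G l)
    (hl : l ≤ n) {A : Set V} (hA : A ⊆ (Set.range u)ᶜ) (hlA : l ≤ A.ncard) :
    ∃ (a x ξ : Fin l → V) (T : Fin l → Set V), Function.Injective a ∧ Function.Injective ξ ∧
      (∀ i, a i ∈ A ∧ ξ i ∈ Set.range u ∧ G.Adj (x i) (ξ i) ∧ T i ⊆ (Set.range u)ᶜ ∧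
        T i ∩ A ⊆ {a i} ∧ LinkedBy G (T i) (x i) (a i) 0) ∧
      ∀ i j, i ≠ j → Disjoint (T i) (T j) := by
  obtain ⟨a, ξ, p, h1, h2, h3, h4⟩ := linkage_of_isKConnected hG hlA
    (B := Set.range u) (by rw [hu.ncard_range]; exact hl)
  obtain ⟨ainj, ξinj⟩ := Linkage.exists_start h2
  have key : ∀ i, ∃ (x : V) (T : Set V), G.Adj x (ξ i) ∧ T ⊆ {v | v ∈ (p i).support} ∧ ξ i ∉ T ∧
      LinkedBy G T x (a i) 0 := by
    intro i
    have hne : ξ i ≠ a i := fun e => hA (h3 i).1 (e ▸ (h3 i).2)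
    obtain ⟨x, T, k1, k2, k3, k4⟩ := exists_tail_linked (p i).reverse (h1 i).reverse hne
    exact ⟨x, T, k1, fun v hv => by simpa using k2 hv, k3, k4⟩
  choose x T k1 k2 k3 k4 using key
  refine ⟨a, x, ξ, T, ainj, ξinj, fun i => ⟨(h3 i).1, (h3 i).2, k1 i, ?_, ?_, k4 i⟩, ?_⟩
  · intro v hv hvu
    exact k3 i ((h4 i v (k2 i hv)).2 hvu ▸ hv)
  · rintro v ⟨hv, hvA⟩
    exact (h4 i v (k2 i hv)).1 hvA
  · intro i j hij
    rw [Set.disjoint_left]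
    intro v hv hv'
    exact h2 i j hij v (k2 i hv) (k2 j hv')

/-- If a set off a longest cycle is pairwise linked within itself by paths of length `ℓ`, then
connectivity forces the cycle to be long. -/
theorem mul_le_of_linked_set {n : ℕ} {u : ℤ → V} (hu : CycMap G n u)
    (hlong : CyclesBounded G Set.univ n) {l ℓ : ℕ} (hG : IsKConnected G l) (hl2 : 2 ≤ l)
    (hl : l ≤ n) {A : Set V} (hA : A ⊆ (Set.range u)ᶜ) (hlA : l ≤ A.ncard)
    (hlink : ∀ a ∈ A, ∀ b ∈ A, a ≠ b → LinkedBy G A a b ℓ) : l * (ℓ + 2) ≤ n := by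
  obtain ⟨a, x, ξ, T, ainj, ξinj, h, hd⟩ := exists_routes hu hG hl hA hlA
  refine card_mul_le_of_feet hu hlong hl2 x ξ ξinj (fun i => (h i).2.1) (fun i => (h i).2.2.1) ?_
  intro i j hij
  obtain ⟨hai, -, -, hTi, hTAi, hi⟩ := h i
  obtain ⟨haj, -, -, hTj, hTAj, hj⟩ := h j
  have h1 := hi.append (hlink _ hai _ haj (ainj.ne hij)) hTAi
  have h2 := h1.append hj.symm (by
    rintro v ⟨hv | hv, hv'⟩
    · exact absurd hv' (Set.disjoint_left.1 (hd i j hij) hv)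
    · exact hTAj ⟨hv', hv⟩)
  exact h2.mono (Set.union_subset (Set.union_subset hTi hA) hTj) (by omega)

end

section


variable {V : Type*} [Fintype V] {G : SimpleGraph V}

namespace CycMap

variable {h : ℕ} {u : ℤ → V}

open Classical in
theorem card_nbrs (hu : CycMap G h u) (x : V) (s : ℤ) :
    (nbrs G (Set.range u) x).card =
      ((Finset.Ico s (s + h)).filter fun c => G.Adj x (u c)).card := by
  rw [← Finset.card_image_of_injOn (f := u)]
  · congr 1
    ext y
    simp only [mem_nbrs, Finset.mem_image, Finset.mem_filter, Finset.mem_Ico]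
    constructor
    · rintro ⟨hy, hxy⟩
      obtain ⟨k, h1, h2, rfl⟩ := hu.exists_window_of_mem hy s
      exact ⟨k, ⟨⟨h1, h2⟩, hxy⟩, rfl⟩
    · rintro ⟨k, ⟨-, hk⟩, rfl⟩
      exact ⟨⟨k, rfl⟩, hk⟩
  · intro i hi j hj e
    simp only [Finset.coe_filter, Finset.mem_Ico] at hi hj
    obtain ⟨hi, -⟩ := hi
    obtain ⟨hj, -⟩ := hj
    rcases le_total i j with h | h
    · exact hu.inj i j h (by omega) e
    · exact (hu.inj j i h (by omega) e.symm).symm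

theorem disjoint_arcs (hu : CycMap G h u) {a b c d : ℤ} (hbc : b < c) (hda : d < a + h) :
    Disjoint (u '' Set.Icc a b) (u '' Set.Icc c d) := by
  rw [Set.disjoint_left]
  rintro _ ⟨i, hi, rfl⟩ ⟨j, hj, e⟩
  rw [Set.mem_Icc] at hi hj
  have := hu.inj i j (by omega) (by omega) e.symm
  omega

theorem arcs_subset (u : ℤ → V) (s t : Set ℤ) : u '' s ∪ u '' t ⊆ Set.range u :=
  Set.union_subset (Set.image_subset_range _ _) (Set.image_subset_range _ _)

theorem arc_linked (hu : CycMap G h u) {i j : ℤ} (hij : i ≤ j) (hj : j < i + h) {k : ℕ}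
    (hk : (k : ℤ) ≤ j - i) : LinkedBy G (Set.range u) (u i) (u j) k :=
  (hu.arc hij hj).mono (Set.image_subset_range _ _) (by omega)

theorem arc_linked' (hu : CycMap G h u) {i j : ℤ} (hij : i < j) (hj : j ≤ i + h) {k : ℕ}
    (hk : (k : ℤ) ≤ h - (j - i)) : LinkedBy G (Set.range u) (u i) (u j) k := by
  have := hu.arc_linked (i := j) (j := i + h) hj (by omega) (k := k) (by omega)
  rw [hu.periodic] at this
  exact this.symm

open Classical in
/-- Two vertices of a cycle whose successors at distances `i` and `j` have large degree sum on the
cycle are joined by a path on the vertex set of the cycle missing few vertices. -/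
theorem corner (hu : CycMap G h u) {i j α : ℤ} (hi : 0 < i) (hiα : i < α) (hj : 1 ≤ j)
    (hαj : α + j < h)
    (hdeg : h + 1 ≤ (nbrs G (Set.range u) (u i)).card + (nbrs G (Set.range u) (u (α + j))).card) :
    LinkedBy G (Set.range u) (u 0) (u α) (h + 1 - i - j).toNat := by
  by_contra hcon
  have u0 : u 0 = u h := by have := hu.periodic 0; rw [zero_add] at this; exact this.symm
  have c1 : ∀ c : ℤ, 1 ≤ c → c ≤ i → ¬ G.Adj (u (α + j)) (u c) := by
    intro c h1 h2 hadj
    apply hcon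
    rw [u0]
    have a1 := (hu.arc (i := α + j) (j := h) (by omega) (by omega)).symm
    have a2 := hu.arc (i := c) (j := α) (by omega) (by omega)
    exact (a1.join hadj a2 (hu.disjoint_arcs (by omega) (by omega)).symm).mono
      (arcs_subset _ _ _) (by omega)
  have c2 : ∀ c : ℤ, α < c → c ≤ α + j → ¬ G.Adj (u i) (u c) := by
    intro c h1 h2 hadj
    apply hcon
    rw [u0]
    have a1 := (hu.arc (i := i) (j := α) (by omega) (by omega)).symm
    have a2 := hu.arc (i := c) (j := h) (by omega) (by omega)
    exact (a1.join hadj a2 (hu.disjoint_arcs (by omega) (by omega))).symm.mono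
      (arcs_subset _ _ _) (by omega)
  have c3 : ∀ c : ℤ, i + 2 ≤ c → c ≤ α → G.Adj (u i) (u c) → ¬ G.Adj (u (α + j)) (u (c - 1)) := by
    intro c h1 h2 hadj hadj'
    apply hcon
    rw [u0]
    have a1 := (hu.arc (i := α + j) (j := h) (by omega) (by omega)).symm
    have a2 := (hu.arc (i := i) (j := c - 1) (by omega) (by omega)).symm
    have a3 := hu.arc (i := c) (j := α) (by omega) (by omega)
    refine ((a1.join hadj' a2 (hu.disjoint_arcs (by omega) (by omega)).symm).join hadj a3
      ?_).mono (Set.union_subset (arcs_subset _ _ _) (Set.image_subset_range _ _)) (by omega)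
    rw [Set.disjoint_union_left]
    exact ⟨(hu.disjoint_arcs (by omega) (by omega)).symm, hu.disjoint_arcs (by omega) (by omega)⟩
  have c4 : ∀ c : ℤ, α + j + 2 ≤ c → c ≤ h → G.Adj (u (α + j)) (u c) →
      ¬ G.Adj (u i) (u (c - 1)) := by
    intro c h1 h2 hadj hadj'
    apply hcon
    rw [u0]
    have a1 := (hu.arc (i := c) (j := h) (by omega) (by omega)).symm
    have a2 := hu.arc (i := α + j) (j := c - 1) (by omega) (by omega)
    have a3 := hu.arc (i := i) (j := α) (by omega) (by omega)
    refine ((a1.join hadj.symm a2 (hu.disjoint_arcs (by omega) (by omega)).symm).join hadj'.symm a3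
      ?_).mono (Set.union_subset (arcs_subset _ _ _) (Set.image_subset_range _ _)) (by omega)
    rw [Set.disjoint_union_left]
    exact ⟨(hu.disjoint_arcs (by omega) (by omega)).symm,
      (hu.disjoint_arcs (by omega) (by omega)).symm⟩
  have hui : u (i + h) = u i := hu.periodic i
  rw [hu.card_nbrs _ (i + 1), hu.card_nbrs _ (i + 1)] at hdeg
  set A := (Finset.Ico (i + 1) (i + 1 + h)).filter fun c => G.Adj (u i) (u c) with hA
  set B := (Finset.Ico (i + 1) (i + 1 + h)).filter fun c => G.Adj (u (α + j)) (u c) with hB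
  let φ : ℤ → ℤ := fun c => if c ≤ α then c else c + 1
  let ψ : ℤ → ℤ := fun c => if c < α + j then c + 1 else c
  have hφ : Function.Injective φ := by
    intro a b e; simp only [φ] at e; split_ifs at e <;> omega
  have hψ : Set.InjOn ψ B := by
    intro a ha b hb e
    simp only [hB, Finset.coe_filter] at ha hb
    have h1 : a ≠ α + j := by rintro rfl; exact G.irrefl ha.2
    have h2 : b ≠ α + j := by rintro rfl; exact G.irrefl hb.2
    simp only [ψ] at e; split_ifs at e <;> omega
  have hAm : ∀ c ∈ A, i + 1 ≤ c ∧ c < i + h ∧ ¬ (α < c ∧ c ≤ α + j) ∧ G.Adj (u i) (u c) := by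
    intro c hc
    simp only [hA, Finset.mem_filter, Finset.mem_Ico] at hc
    refine ⟨hc.1.1, ?_, fun h => c2 c h.1 h.2 hc.2, hc.2⟩
    rcases eq_or_ne c (i + h) with rfl | hne
    · rw [hui] at hc; exact absurd hc.2 G.irrefl
    · omega
  have hBm : ∀ c ∈ B, i + 1 ≤ c ∧ c ≤ h ∧ c ≠ α + j ∧ G.Adj (u (α + j)) (u c) := by
    intro c hc
    simp only [hB, Finset.mem_filter, Finset.mem_Ico] at hc
    refine ⟨hc.1.1, ?_, ?_, hc.2⟩
    · by_contra hch
      refine c1 (c - h) (by omega) (by omega) ?_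
      have := hu.periodic (c - h)
      rw [sub_add_cancel] at this
      rw [← this]; exact hc.2
    · rintro rfl; exact G.irrefl hc.2
  have hdisj : Disjoint (A.image φ) (B.image ψ) := by
    rw [Finset.disjoint_left]
    intro v hv hv'
    obtain ⟨c, hc, rfl⟩ := Finset.mem_image.1 hv
    obtain ⟨d, hd, e⟩ := Finset.mem_image.1 hv'
    obtain ⟨A1, A2, A3, A4⟩ := hAm c hc
    obtain ⟨B1, B2, B3, B4⟩ := hBm d hd
    simp only [φ, ψ] at e
    split_ifs at e with e1 e2 e2
    · exact c3 c (by omega) e2 A4 (by rwa [← e, add_sub_cancel_right])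
    · omega
    · omega
    · exact c4 d (by omega) B2 B4 (by rwa [e, add_sub_cancel_right])
  have hsub : A.image φ ∪ B.image ψ ⊆ Finset.Ico (i + 1) (i + 1 + h) := by
    intro v hv
    rw [Finset.mem_Ico]
    rcases Finset.mem_union.1 hv with hv | hv
    · obtain ⟨c, hc, rfl⟩ := Finset.mem_image.1 hv
      obtain ⟨A1, A2, A3, A4⟩ := hAm c hc
      simp only [φ]; split_ifs <;> omega
    · obtain ⟨c, hc, rfl⟩ := Finset.mem_image.1 hv
      obtain ⟨A1, A2, A3, A4⟩ := hBm c hc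
      simp only [ψ]; split_ifs <;> omega
  have := Finset.card_le_card hsub
  rw [Finset.card_union_of_disjoint hdisj, Finset.card_image_of_injective _ hφ,
    Finset.card_image_of_injOn hψ, Int.card_Ico] at this
  omega

variable {W : Set V}

open Classical in
theorem deg_succ_add_le (hu : CycMap G h u) (hW : CyclesBounded G W h) (huW : Set.range u ⊆ W)
    {w : V} (hwW : w ∈ W) (hwu : w ∉ Set.range u) {i : ℤ} (hwi : G.Adj w (u i)) :
    (nbrs G (Set.range u) (u (i + 1))).card + (nbrs G (Set.range u) w).card ≤ h := by
  have hn3 := hu.three_le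
  rw [hu.card_nbrs _ (i + 1), hu.card_nbrs _ i]
  have hTW : ({w} : Set V) ⊆ W := by simpa using hwW
  have hTu : Disjoint ({w} : Set V) (Set.range u) := by simpa using hwu
  have hsw := LinkedBy.single (G := G) (Set.mem_singleton w)
  set A := (Finset.Ico (i + 1) (i + 1 + h)).filter fun c => G.Adj (u (i + 1)) (u c) with hA
  set B := (Finset.Ico i (i + h)).filter fun c => G.Adj w (u c) with hB
  have hdisj : Disjoint A (B.image fun c => c + 1) := by
    rw [Finset.disjoint_left]
    intro v hv hv'
    obtain ⟨c, hc, rfl⟩ := Finset.mem_image.1 hv'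
    simp only [hA, hB, Finset.mem_filter, Finset.mem_Ico] at hv hc
    obtain ⟨⟨c1, c2⟩, c3⟩ := hc
    rcases c1.eq_or_lt with rfl | c1
    · exact G.irrefl hv.2
    have g1 := hu.chord_gap hW huW hTW hTu hsw c1 c2 hwi c3
    have g2 := hu.chord_gap' hW huW hTW hTu hsw c1 c2 hwi c3
    have a1 := (hu.arc (i := c + 1) (j := i + h) (by omega) (by omega)).symm
    rw [hu.periodic] at a1
    have a2 := hu.arc (i := i + 1) (j := c) (by omega) (by omega)
    have a3 := (hsw.join hwi a1 (hTu.mono_right (Set.image_subset_range _ _))).join hv.2.symm a2 (by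
      rw [Set.disjoint_union_left]
      exact ⟨hTu.mono_right (Set.image_subset_range _ _),
        (hu.disjoint_arcs (by omega) (by omega)).symm⟩)
    have := hW.linked a3 (Set.union_subset (Set.union_subset hTW
      ((Set.image_subset_range _ _).trans huW)) ((Set.image_subset_range _ _).trans huW))
      (by omega) c3.symm
    omega
  have hsub : A ∪ (B.image fun c => c + 1) ⊆ Finset.Ico (i + 1) (i + 1 + h) := by
    intro v hv
    rcases Finset.mem_union.1 hv with hv | hv
    · exact Finset.filter_subset _ _ hv
    · obtain ⟨c, hc, rfl⟩ := Finset.mem_image.1 hv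
      simp only [hB, Finset.mem_filter, Finset.mem_Ico] at hc ⊢
      omega
  have := Finset.card_le_card hsub
  rw [Finset.card_union_of_disjoint hdisj, Finset.card_image_of_injective _ (add_left_injective 1),
    Int.card_Ico] at this
  omega

end CycMap

end

section


variable {V : Type*} [Fintype V] {G : SimpleGraph V}

/-- A system of disjoint paths `z x 0, …, z x (e x)` in `K`, one starting at each `x ∈ H`. -/
structure IsTails (G : SimpleGraph V) (K : Set V) (H : Finset V) (e : V → ℕ) (z : V → ℕ → V) :
    Prop where
  zero : ∀ x ∈ H, z x 0 = x
  mem : ∀ x ∈ H, ∀ k ≤ e x, z x k ∈ K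
  adj : ∀ x ∈ H, ∀ k < e x, G.Adj (z x k) (z x (k + 1))
  inj : ∀ x ∈ H, ∀ y ∈ H, ∀ k ≤ e x, ∀ l ≤ e y, z x k = z y l → x = y ∧ k = l

open Classical in
/-- The weight of a tail of length `k` at `x`: proper tails count extra, more so at `A`. -/
noncomputable def tailWeight (A : Set V) (x : V) (k : ℕ) : ℕ :=
  if k = 0 then 0 else k + 1 + if x ∈ A then 1 else 0

/-- The tail system has maximum total weight. -/
structure IsMaxTails (G : SimpleGraph V) (K : Set V) (H : Finset V) (A : Set V) (e : V → ℕ)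
    (z : V → ℕ → V) : Prop extends IsTails G K H e z where
  le_weight : ∀ e' z', IsTails G K H e' z' →
    ∑ x ∈ H, tailWeight A x (e' x) ≤ ∑ x ∈ H, tailWeight A x (e x)

open Classical in
theorem sum_update_add {H : Finset V} {x : V} (hx : x ∈ H) (f : V → ℕ → ℕ) (e : V → ℕ) (k : ℕ) :
    ∑ y ∈ H, f y (Function.update e x k y) + f x (e x) = ∑ y ∈ H, f y (e y) + f x k := by
  rw [← Finset.add_sum_erase H _ hx, ← Finset.add_sum_erase H (fun y => f y (e y)) hx,
    Function.update_self]
  have : ∑ y ∈ H.erase x, f y (Function.update e x k y) = ∑ y ∈ H.erase x, f y (e y) :=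
    Finset.sum_congr rfl fun y hy => by
      rw [Function.update_of_ne (Finset.ne_of_mem_erase hy)]
  omega

namespace IsTails

variable {K : Set V} {H : Finset V} {e : V → ℕ} {z : V → ℕ → V}

theorem trunc (hE : IsTails G K H e z) {e' : V → ℕ} (he : ∀ x, e' x ≤ e x) :
    IsTails G K H e' z where
  zero := hE.zero
  mem x hx k hk := hE.mem x hx k (hk.trans (he x))
  adj x hx k hk := hE.adj x hx k (hk.trans_le (he x))
  inj x hx y hy k hk l hl := hE.inj x hx y hy k (hk.trans (he x)) l (hl.trans (he y))

open Classical in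
theorem update (hE : IsTails G K H e z) {x : V} {k₀ : ℕ} {g : ℕ → V} (h0 : g 0 = x)
    (hK : ∀ k ≤ k₀, g k ∈ K) (hadj : ∀ k < k₀, G.Adj (g k) (g (k + 1)))
    (hinj : ∀ k ≤ k₀, ∀ l ≤ k₀, g k = g l → k = l)
    (hd : ∀ y ∈ H, y ≠ x → ∀ l ≤ e y, ∀ k ≤ k₀, g k ≠ z y l) :
    IsTails G K H (Function.update e x k₀) (Function.update z x g) where
  zero y hy := by
    rcases eq_or_ne y x with rfl | h
    · simpa using h0
    · simpa [h] using hE.zero y hy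
  mem y hy k hk := by
    rcases eq_or_ne y x with rfl | h
    · simp at hk ⊢; exact hK k hk
    · simp [h] at hk ⊢; exact hE.mem y hy k hk
  adj y hy k hk := by
    rcases eq_or_ne y x with rfl | h
    · simp at hk ⊢; exact hadj k hk
    · simp [h] at hk ⊢; exact hE.adj y hy k hk
  inj y hy y' hy' k hk l hl heq := by
    by_cases h : y = x <;> by_cases h' : y' = x
    · subst h; subst h'
      simp at hk hl heq; exact ⟨rfl, hinj k hk l hl heq⟩
    · subst h
      simp [h'] at hk hl heq; exact absurd heq (hd y' hy' h' l hl k hk)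
    · subst h'
      simp [h] at hk hl heq; exact absurd heq.symm (hd y hy h k hk l hl)
    · simp [h, h'] at hk hl heq; exact hE.inj y hy y' hy' k hk l hl heq

theorem notMem (hE : IsTails G K H e z) {x : V} (hx : x ∈ H) {k : ℕ} (hk : k ≤ e x)
    (hk1 : 1 ≤ k) : z x k ∉ H := by
  intro h
  have := (hE.inj x hx _ h k hk 0 (Nat.zero_le _) (hE.zero _ h).symm).2
  omega

theorem seg (hE : IsTails G K H e z) {x : V} (hx : x ∈ H) {i j : ℕ} (hij : i ≤ j)
    (hj : j ≤ e x) : LinkedBy G (z x '' Set.Icc i j) (z x i) (z x j) (j - i) := by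
  obtain ⟨k, rfl⟩ := Nat.exists_eq_add_of_le hij
  induction k with
  | zero => simpa using LinkedBy.single (G := G) (Set.mem_singleton (z x i))
  | succ k ih =>
    have h1 := ih (by omega) (by omega)
    have := h1.join (hE.adj x hx (i + k) (by omega))
      (LinkedBy.single (G := G) (Set.mem_singleton (z x (i + k + 1)))) (by
        rw [Set.disjoint_singleton_right]
        rintro ⟨l, hl, e⟩
        rw [Set.mem_Icc] at hl
        have := (hE.inj x hx x hx l (by omega) (i + k + 1) (by omega) e).2
        omega)
    refine this.mono ?_ (by omega)
    rintro y (⟨l, hl, rfl⟩ | hy)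
    · exact ⟨l, ⟨hl.1, by have := hl.2; omega⟩, rfl⟩
    · rw [Set.mem_singleton_iff.1 hy]
      exact ⟨_, ⟨by omega, le_rfl⟩, rfl⟩

theorem seg_subset (hE : IsTails G K H e z) {x : V} (hx : x ∈ H) {i j : ℕ} (hj : j ≤ e x) :
    z x '' Set.Icc i j ⊆ K := by
  rintro _ ⟨k, hk, rfl⟩
  exact hE.mem x hx k (hk.2.trans hj)

open Classical in
theorem split (hE : IsTails G K H e z) {x y : V} (hx : x ∈ H) (hy : y ∈ H) (hex : e x = 0)
    {k : ℕ} (hk1 : 1 ≤ k) (hk : k ≤ e y) (hxy : G.Adj x (z y k)) :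
    ∃ z', IsTails G K H (Function.update (Function.update e y (k - 1)) x (e y - (k - 1))) z' := by
  have hne : y ≠ x := by rintro rfl; omega
  have h1 : IsTails G K H (Function.update e y (k - 1)) z := hE.trunc fun v => by
    rcases eq_or_ne v y with rfl | h
    · simp; omega
    · simp [h]
  refine ⟨_, h1.update (g := fun j => if j = 0 then x else z y (k - 1 + j)) (by simp) ?_ ?_ ?_ ?_⟩
  · intro j hj
    split_ifs
    · have := hE.mem x hx 0 (Nat.zero_le _)
      rwa [hE.zero x hx] at this
    · exact hE.mem y hy _ (by omega)
  · intro j hj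
    rw [if_neg (by omega : ¬ j + 1 = 0)]
    split_ifs with h0
    · subst h0
      rwa [show k - 1 + (0 + 1) = k by omega]
    · exact hE.adj y hy _ (by omega)
  · intro j hj l hl heq
    have hz : ∀ j, j ≤ e y - (k - 1) → j ≠ 0 → x ≠ z y (k - 1 + j) := by
      intro j hj h0 e0
      exact hE.notMem hy (by omega) (by omega) (e0 ▸ hx)
    split_ifs at heq with h1 h2 h2
    · omega
    · exact absurd heq (hz l hl h2)
    · exact absurd heq.symm (hz j hj h1)
    · have := (hE.inj y hy y hy _ (by omega) _ (by omega) heq).2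
      omega
  · intro v hv hvx l hl j hj
    split_ifs with h0
    · intro heq
      rw [← hE.zero x hx] at heq
      have hl' : l ≤ e v := by
        rcases eq_or_ne v y with rfl | h
        · simp at hl; omega
        · simpa [h] using hl
      exact hvx (hE.inj x hx v hv 0 (by omega) l hl' heq).1.symm
    · intro heq
      rcases eq_or_ne v y with rfl | h
      · simp at hl
        have := (hE.inj v hv v hv _ (by omega) l (by omega) heq).2
        omega
      · simp [h] at hl
        exact h (hE.inj y hy v hv _ (by omega) l hl heq).1.symm

end IsTails

namespace IsMaxTails

variable {K : Set V} {H : Finset V} {A : Set V} {e : V → ℕ} {z : V → ℕ → V}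

open Classical in
theorem exists_eq_of_adj (hE : IsMaxTails G K H A e z) {x : V} (hx : x ∈ H) {v : V} (hv : v ∈ K)
    (hxv : G.Adj (z x (e x)) v) : ∃ y ∈ H, ∃ k ≤ e y, v = z y k := by
  by_contra hcon
  push Not at hcon
  have h1 := hE.toIsTails.update (x := x) (k₀ := e x + 1)
    (g := fun k => if k ≤ e x then z x k else v) (by simpa using hE.zero x hx) (by
      intro k hk; split_ifs with h
      · exact hE.mem x hx k h
      · exact hv) (by
      intro k hk
      rw [if_pos (by omega : k ≤ e x)]
      split_ifs with h
      · exact hE.adj x hx k h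
      · rwa [show k = e x by omega]) (by
      intro k hk l hl heq
      split_ifs at heq with a b b
      · exact (hE.inj x hx x hx k a l b heq).2
      · exact absurd heq.symm (hcon x hx k a)
      · exact absurd heq (hcon x hx l b)
      · omega) (by
      intro y hy hyx l hl k hk
      split_ifs with a
      · exact fun heq => hyx (hE.inj x hx y hy k a l hl heq).1.symm
      · exact hcon y hy l hl)
  have h2 := hE.le_weight _ _ h1
  have h3 := sum_update_add hx (tailWeight A) e (e x + 1)
  have h4 : tailWeight A x (e x) < tailWeight A x (e x + 1) := by
    simp only [tailWeight]
    rw [if_neg (by omega : ¬ e x + 1 = 0)]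
    split_ifs <;> omega
  omega

open Classical in
theorem adj_depth (hE : IsMaxTails G K H A e z) {x y : V} (hx : x ∈ H) (hy : y ∈ H)
    (hex : e x = 0) {k : ℕ} (hk1 : 1 ≤ k) (hk : k ≤ e y) (hxy : G.Adj x (z y k)) :
    k = 1 ∧ (x ∈ A → y ∈ A) := by
  obtain ⟨z', hz'⟩ := hE.toIsTails.split hx hy hex hk1 hk hxy
  have hne : x ≠ y := by rintro rfl; omega
  have h2 := hE.le_weight _ _ hz'
  have h3 := sum_update_add hx (tailWeight A) (Function.update e y (k - 1)) (e y - (k - 1))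
  have h4 := sum_update_add hy (tailWeight A) e (k - 1)
  rw [Function.update_of_ne hne] at h3
  simp only [tailWeight] at h3 h4
  rw [hex, if_neg (by omega : ¬ e y - (k - 1) = 0)] at h3
  rw [if_neg (by omega : ¬ e y = 0)] at h4
  constructor
  · by_contra hk2
    rw [if_neg (by omega : ¬ k - 1 = 0)] at h4
    simp only [tailWeight] at h2
    simp only [if_true] at h3
    omega
  · intro hxA
    by_contra hyA
    simp only [tailWeight] at h2
    simp only [if_true, hxA, hyA, if_false] at h3 h4
    split_ifs at h4 <;> omega

variable {h : ℕ} {u : ℤ → V}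

/-- The tail of `y` leads from `y` to any neighbour of the end of the tail at `x`. -/
theorem exists_reach (hE : IsMaxTails G K H A e z) {x y : V} (hx : x ∈ H) (hy : y ∈ H)
    (hex : 1 ≤ e x) {d : ℕ} (hd : d ≤ e y) (hadj : G.Adj (z x (e x)) (z y d)) :
    ∃ (a : V) (T : Set V), G.Adj a y ∧ LinkedBy G T a (z x (e x)) d ∧
      ∀ v ∈ T, v = z x (e x) ∨ ∃ k, 1 ≤ k ∧ k ≤ e y ∧ v = z y k := by
  rcases eq_or_ne x y with rfl | hxy
  · have hde : d ≠ e x := by rintro rfl; exact G.irrefl hadj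
    refine ⟨z x 1, _, ?_, (hE.seg hx hex le_rfl).mono le_rfl (by omega), ?_⟩
    · have := (hE.adj x hx 0 hex).symm
      rwa [hE.zero x hx] at this
    · rintro _ ⟨k, hk, rfl⟩
      exact Or.inr ⟨k, hk.1, hk.2, rfl⟩
  · rcases Nat.eq_zero_or_pos d with rfl | hd1
    · rw [hE.zero y hy] at hadj
      exact ⟨_, _, hadj, LinkedBy.single (Set.mem_singleton _), fun v hv => Or.inl hv⟩
    · have h1 := (hE.seg hy hd1 hd).join hadj.symm
        (LinkedBy.single (G := G) (Set.mem_singleton (z x (e x)))) (by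
          rw [Set.disjoint_singleton_right]
          rintro ⟨k, hk, heq⟩
          exact hxy (hE.inj y hy x hx k (hk.2.trans hd) _ le_rfl heq).1.symm)
      refine ⟨z y 1, _, ?_, h1.mono le_rfl (by omega), ?_⟩
      · have := (hE.adj y hy 0 (by omega)).symm
        rwa [hE.zero y hy] at this
      · rintro _ (⟨k, hk, rfl⟩ | hv)
        · exact Or.inr ⟨k, hk.1, hk.2.trans hd, rfl⟩
        · exact Or.inl hv

open Classical in
/-- An end of a proper tail either has at most `h / 2` neighbours in `K`, or all its neighbours in
`K` lie on its own tail. -/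
theorem two_mul_card_le_or (hE : IsMaxTails G K H A e z) (hu : CycMap G h u)
    (hH : (H : Set V) = Set.range u) (hK : CyclesBounded G K h)
    {x : V} (hx : x ∈ H) (hex : 1 ≤ e x) :
    2 * (nbrs G K (z x (e x))).card ≤ h ∨
      ∀ v ∈ nbrs G K (z x (e x)), ∃ k < e x, v = z x k := by
  set a := z x (e x) with ha
  have hmem : ∀ i, u i ∈ H := fun i => by
    rw [← Finset.mem_coe, hH]; exact ⟨i, rfl⟩
  have huK : Set.range u ⊆ K := by
    rintro _ ⟨i, rfl⟩
    have := hE.mem _ (hmem i) 0 (Nat.zero_le _)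
    rwa [hE.zero _ (hmem i)] at this
  let D : V → Finset ℕ := fun y => (Finset.range (e y + 1)).filter fun d => G.Adj a (z y d)
  let X : Finset ℤ := (Finset.Ico (0 : ℤ) h).filter fun i => (D (u i)).Nonempty
  have hDle : ∀ y, (D y).Nonempty → ∃ d ∈ D y, (D y).card ≤ d + 1 := by
    intro y hne
    refine ⟨(D y).max' hne, (D y).max'_mem hne, ?_⟩
    have : D y ⊆ Finset.range ((D y).max' hne + 1) := by
      intro d hd
      have := (D y).le_max' d hd
      rw [Finset.mem_range]; omega
    simpa using Finset.card_le_card this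
  have gap : ∀ i ∈ X, ∀ j ∈ X, i < j →
      ((D (u i)).card : ℤ) + (D (u j)).card ≤ j - i ∧
        ((D (u i)).card : ℤ) + (D (u j)).card ≤ h - (j - i) := by
    intro i hi j hj hij
    obtain ⟨hi, hDi⟩ := Finset.mem_filter.1 hi
    obtain ⟨hj, hDj⟩ := Finset.mem_filter.1 hj
    rw [Finset.mem_Ico] at hi hj
    have hne : u i ≠ u j := hu.ne hij (by omega)
    obtain ⟨d, hd, hdc⟩ := hDle _ hDi
    obtain ⟨d', hd', hdc'⟩ := hDle _ hDj
    simp only [D, Finset.mem_filter, Finset.mem_range] at hd hd'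
    obtain ⟨b, T, hb, hT, hTm⟩ := hE.exists_reach hx (hmem i) hex (by omega) hd.2
    obtain ⟨b', T', hb', hT', hTm'⟩ := hE.exists_reach hx (hmem j) hex (by omega) hd'.2
    have hl := hT.append hT'.symm (by
      rintro v ⟨hv, hv'⟩
      rcases hTm v hv with h1 | ⟨k, k1, k2, h1⟩
      · exact h1
      · rcases hTm' v hv' with h2 | ⟨l, l1, l2, h2⟩
        · exact h2
        · exact absurd (hE.inj _ (hmem i) _ (hmem j) k k2 l l2 (h1 ▸ h2)).1 hne)
    have hTK : ∀ y ∈ H, ∀ T : Set V, (∀ v ∈ T, v = z x (e x) ∨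
        ∃ k, 1 ≤ k ∧ k ≤ e y ∧ v = z y k) → T ⊆ K ∧ Disjoint T (Set.range u) := by
      intro y hy T hT
      refine ⟨fun v hv => ?_, ?_⟩
      · rcases hT v hv with rfl | ⟨k, k1, k2, rfl⟩
        · exact hE.mem x hx _ le_rfl
        · exact hE.mem y hy _ k2
      · rw [← hH, Set.disjoint_left]
        intro v hv
        rcases hT v hv with rfl | ⟨k, k1, k2, rfl⟩
        · exact hE.notMem hx le_rfl hex
        · exact hE.notMem hy k2 k1
    have t1 := hTK _ (hmem i) T hTm
    have t2 := hTK _ (hmem j) T' hTm'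
    have g1 := hu.chord_gap hK huK (Set.union_subset t1.1 t2.1)
      (Set.disjoint_union_left.2 ⟨t1.2, t2.2⟩) hl hij (by omega) hb hb'
    have g2 := hu.chord_gap' hK huK (Set.union_subset t1.1 t2.1)
      (Set.disjoint_union_left.2 ⟨t1.2, t2.2⟩) hl hij (by omega) hb hb'
    push_cast at g1 g2
    omega
  have hcover : ∀ v ∈ nbrs G K a, ∃ i ∈ X, ∃ d ∈ D (u i), z (u i) d = v := by
    intro v hv
    rw [mem_nbrs] at hv
    obtain ⟨y, hy, k, hk, rfl⟩ := hE.exists_eq_of_adj hx hv.1 hv.2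
    have hyu : y ∈ Set.range u := by rw [← hH]; exact hy
    obtain ⟨i, i1, i2, rfl⟩ := hu.exists_window_of_mem hyu 0
    have hkD : k ∈ D (u i) := by
      simp only [D, Finset.mem_filter, Finset.mem_range]; exact ⟨by omega, hv.2⟩
    refine ⟨i, ?_, k, hkD, rfl⟩
    simp only [X, Finset.mem_filter, Finset.mem_Ico]
    exact ⟨⟨i1, by omega⟩, k, hkD⟩
  by_cases htwo : ∃ i ∈ X, ∃ j ∈ X, i ≠ j
  · left
    have hex : ∀ i ∈ X, ∃ j ∈ X, i ≠ j := by
      intro i hi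
      obtain ⟨a, ha, b, hb, hab⟩ := htwo
      rcases eq_or_ne i a with rfl | h
      · exact ⟨b, hb, hab⟩
      · exact ⟨a, ha, h⟩
    have main := sum_le_of_gaps h (fun i => 2 * (D (u i)).card) X (by
      intro i hi
      obtain ⟨j, hj, hne⟩ := hex i hi
      rcases lt_or_gt_of_ne hne with h | h
      · have := gap i hi j hj h; omega
      · have := gap j hj i hi h; omega) (by
      intro i hi j hj hij
      have := gap i hi j hj hij
      push_cast; omega)
    rw [← Finset.mul_sum] at main
    have : (nbrs G K a).card ≤ ∑ i ∈ X, (D (u i)).card := by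
      calc (nbrs G K a).card ≤ (X.biUnion fun i => (D (u i)).image (z (u i))).card := by
            apply Finset.card_le_card
            intro v hv
            obtain ⟨i, hi, d, hd, rfl⟩ := hcover v hv
            rw [Finset.mem_biUnion]
            exact ⟨i, hi, Finset.mem_image_of_mem _ hd⟩
        _ ≤ ∑ i ∈ X, ((D (u i)).image (z (u i))).card := Finset.card_biUnion_le
        _ ≤ _ := Finset.sum_le_sum fun i _ => Finset.card_image_le
    omega
  · right
    push Not at htwo
    have hxu : x ∈ Set.range u := by rw [← hH]; exact hx
    obtain ⟨i, i1, i2, hi⟩ := hu.exists_window_of_mem hxu 0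
    have hiX : i ∈ X := by
      simp only [X, Finset.mem_filter, Finset.mem_Ico]
      refine ⟨⟨i1, by omega⟩, e x - 1, ?_⟩
      simp only [D, Finset.mem_filter, Finset.mem_range]
      have := hE.adj x hx (e x - 1) (by omega)
      rw [show e x - 1 + 1 = e x by omega] at this
      rw [hi]
      exact ⟨by omega, this.symm⟩
    intro v hv
    obtain ⟨j, hj, d, hd, rfl⟩ := hcover v hv
    rw [← htwo i hiX j hj, hi] at hd ⊢
    simp only [D, Finset.mem_filter, Finset.mem_range] at hd
    refine ⟨d, ?_, rfl⟩
    rcases eq_or_ne d (e x) with rfl | h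
    · exact absurd hd.2 G.irrefl
    · omega

end IsMaxTails

end

section


variable {V : Type*} [Fintype V] {G : SimpleGraph V}

open Classical in
/-- The secondary weight of a tail `g 0, …, g k`: largest if its end has at most `h / 2` neighbours
in `K`, otherwise the distance on the tail from its end to the farthest neighbour. -/
noncomputable def tailScore (G : SimpleGraph V) (K : Set V) (h k : ℕ) (g : ℕ → V) : ℕ :=
  if k = 0 then 0 else if 2 * (nbrs G K (g k)).card ≤ h then Fintype.card V + 1
    else k - sInf {i | i < k ∧ G.Adj (g k) (g i)}

/-- A tail system of maximum weight, and among these of maximum score. -/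
structure IsOptTails (G : SimpleGraph V) (K : Set V) (H : Finset V) (A : Set V) (h : ℕ)
    (e : V → ℕ) (z : V → ℕ → V) : Prop extends IsMaxTails G K H A e z where
  le_score : ∀ e' z', IsMaxTails G K H A e' z' →
    ∑ x ∈ H, tailScore G K h (e' x) (z' x) ≤ ∑ x ∈ H, tailScore G K h (e x) (z x)

theorem IsTails.lt_card {K : Set V} {H : Finset V} {e : V → ℕ} {z : V → ℕ → V}
    (hE : IsTails G K H e z) {x : V} (hx : x ∈ H) : e x < Fintype.card V := by
  have h := Fintype.card_le_of_injective (fun k : Fin (e x + 1) => z x k) (by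
    intro k l hkl
    exact Fin.ext (hE.inj x hx x hx k (by omega) l (by omega) hkl).2)
  simpa using h

theorem exists_isOptTails (K : Set V) (H : Finset V) (A : Set V) (h : ℕ)
    (hHK : (H : Set V) ⊆ K) : ∃ e z, IsOptTails G K H A h e z := by
  classical
  set N := Fintype.card V + 1 with hN
  set M := H.card * N + 1 with hM
  let Φ : (V → ℕ) → (V → ℕ → V) → ℕ := fun e z =>
    M * ∑ x ∈ H, tailWeight A x (e x) + ∑ x ∈ H, tailScore G K h (e x) (z x)
  have hscore : ∀ e z, IsTails G K H e z → ∑ x ∈ H, tailScore G K h (e x) (z x) ≤ H.card * N := by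
    intro e z hE
    rw [← smul_eq_mul]
    refine Finset.sum_le_card_nsmul _ _ _ fun x hx => ?_
    have := hE.lt_card hx
    unfold tailScore
    split_ifs <;> omega
  have hweight : ∀ e z, IsTails G K H e z → ∑ x ∈ H, tailWeight A x (e x) ≤ H.card * N := by
    intro e z hE
    rw [← smul_eq_mul]
    refine Finset.sum_le_card_nsmul _ _ _ fun x hx => ?_
    have := hE.lt_card hx
    unfold tailWeight
    split_ifs <;> omega
  let S : Set ℕ := {n | ∃ e z, IsTails G K H e z ∧ Φ e z = n}
  have hne : S.Nonempty := by
    refine ⟨_, fun _ => 0, fun x _ => x, ⟨fun _ _ => rfl, fun x hx _ _ => hHK hx, ?_, ?_⟩, rfl⟩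
    · intro x hx k hk; omega
    · intro x hx y hy k hk l hl heq
      exact ⟨heq, by omega⟩
  have hbdd : BddAbove S := by
    refine ⟨M * (H.card * N) + H.card * N, ?_⟩
    rintro _ ⟨e, z, hE, rfl⟩
    exact add_le_add (Nat.mul_le_mul_left _ (hweight e z hE)) (hscore e z hE)
  obtain ⟨e, z, hE, hmax⟩ := Nat.sSup_mem hne hbdd
  have hle : ∀ e' z', IsTails G K H e' z' → Φ e' z' ≤ Φ e z := by
    intro e' z' hE'
    rw [hmax]
    exact le_csSup hbdd ⟨e', z', hE', rfl⟩
  have hw : ∀ e' z', IsTails G K H e' z' →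
      ∑ x ∈ H, tailWeight A x (e' x) ≤ ∑ x ∈ H, tailWeight A x (e x) := by
    intro e' z' hE'
    by_contra hcon
    have h1 := hle e' z' hE'
    have h2 := hscore e z hE
    have h3 : M * (∑ x ∈ H, tailWeight A x (e x) + 1) ≤ M * ∑ x ∈ H, tailWeight A x (e' x) :=
      Nat.mul_le_mul_left _ (by omega)
    simp only [Φ] at h1
    rw [mul_add] at h3
    omega
  refine ⟨e, z, ⟨⟨hE, hw⟩, ?_⟩⟩
  intro e' z' hE'
  have h1 := hle e' z' hE'.toIsTails
  have h2 := hw e' z' hE'.toIsTails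
  have h3 := hE'.le_weight e z hE
  have h4 := le_antisymm h2 h3
  simp only [Φ] at h1
  rw [h4] at h1
  omega

theorem cycMap_of_seq {n : ℕ} (hn : 3 ≤ n) {g : ℕ → V}
    (hadj : ∀ k, k + 1 < n → G.Adj (g k) (g (k + 1)))
    (hclose : G.Adj (g (n - 1)) (g 0)) (hinj : ∀ k < n, ∀ l < n, g k = g l → k = l) :
    CycMap G n fun i => g (i % n).toNat where
  three_le := hn
  periodic i := by simp
  adj i := by
    have h1 := Int.emod_nonneg i (b := n) (by omega)
    have h2 := Int.emod_lt_of_pos i (b := n) (by omega)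
    have h3 : (i + 1) % n = (i % n + 1) % n := by simp
    rw [h3]
    by_cases h : i % n + 1 = n
    · rw [h, Int.emod_self]
      have : (i % n).toNat = n - 1 := by omega
      rwa [this]
    · rw [Int.emod_eq_of_lt (a := i % n + 1) (by omega) (by omega)]
      have : (i % n + 1).toNat = (i % n).toNat + 1 := by omega
      rw [this]
      exact hadj _ (by omega)
  inj i j hij hj heq := by
    have h1 := Int.emod_nonneg i (b := n) (by omega)
    have h2 := Int.emod_lt_of_pos i (b := n) (by omega)
    have h1' := Int.emod_nonneg j (b := n) (by omega)
    have h2' := Int.emod_lt_of_pos j (b := n) (by omega)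
    have := hinj _ (by omega) _ (by omega) heq
    have hm : i % n = j % n := by omega
    have h5 : (n : ℤ) ∣ j - i := Int.ModEq.dvd hm
    have h6 := Int.eq_zero_of_dvd_of_nonneg_of_lt (by omega) (by omega : j - i < n) h5
    omega

namespace IsOptTails

variable {K : Set V} {H : Finset V} {A : Set V} {h : ℕ} {e : V → ℕ} {z : V → ℕ → V} {u : ℤ → V}

/-- Rerouting the final part of a tail preserves optimality in a strong form. -/
theorem reroute (hE : IsOptTails G K H A h e z) (hu : CycMap G h u)
    (hH : (H : Set V) = Set.range u) (hK : CyclesBounded G K h) {x : V} (hx : x ∈ H) {f : ℕ}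
    (hf : f < e x) (hfine : h < 2 * (nbrs G K (z x (e x))).card)
    (hfirst : sInf {i | i < e x ∧ G.Adj (z x (e x)) (z x i)} = f) {v : V}
    (hv : LinkedBy G (z x '' Set.Icc f (e x)) (z x f) v (e x - f)) :
    h < 2 * (nbrs G K v).card ∧ ∀ y ∈ nbrs G K v, y ∈ z x '' Set.Icc f (e x) := by
  classical
  obtain ⟨p, hp, hs, hl⟩ := hv
  have hlen : p.length = e x - f := by
    apply le_antisymm _ hl
    have h1 : p.support.toFinset ⊆ (Finset.Icc f (e x)).image (z x) := by
      intro y hy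
      obtain ⟨k, hk, rfl⟩ := hs y (List.mem_toFinset.1 hy)
      exact Finset.mem_image_of_mem _ (Finset.mem_Icc.2 hk)
    have h2 := (Finset.card_le_card h1).trans Finset.card_image_le
    rw [List.toFinset_card_of_nodup hp.support_nodup, Walk.length_support] at h2
    simp at h2
    omega
  set g : ℕ → V := fun k => if k < f then z x k else p.getVert (k - f) with hg
  have hget : ∀ j, ∃ k, f ≤ k ∧ k ≤ e x ∧ p.getVert j = z x k := by
    intro j
    obtain ⟨k, hk, heq⟩ := hs _ (p.getVert_mem_support j)
    exact ⟨k, hk.1, hk.2, heq.symm⟩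
  have hgz : ∀ k, ∃ l ≤ e x, g k = z x l ∧ (f ≤ k → f ≤ l) ∧ (k < f → l = k) := by
    intro k
    simp only [hg]
    split_ifs with hk
    · exact ⟨k, by omega, rfl, by omega, fun _ => rfl⟩
    · obtain ⟨l, h1, h2, h3⟩ := hget (k - f)
      exact ⟨l, h2, h3, fun _ => h1, by omega⟩
  have hge : g (e x) = v := by
    simp only [hg]
    rw [if_neg (by omega), ← hlen, Walk.getVert_length]
  have hginj : ∀ k ≤ e x, ∀ l ≤ e x, g k = g l → k = l := by
    intro k hk l hl heq
    obtain ⟨k', h1, h2, h3, h4⟩ := hgz k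
    obtain ⟨l', h1', h2', h3', h4'⟩ := hgz l
    have := (hE.inj x hx x hx k' h1 l' h1' (by rw [← h2, ← h2', heq])).2
    rcases lt_or_ge k f with hkf | hkf <;> rcases lt_or_ge l f with hlf | hlf
    · rw [h4 hkf, h4' hlf] at this; exact this
    · have := h4 hkf; have := h3' hlf; omega
    · have := h3 hkf; have := h4' hlf; omega
    · simp only [hg] at heq
      rw [if_neg (by omega), if_neg (by omega)] at heq
      have := hp.getVert_injOn (by simp; omega) (by simp; omega) heq
      omega
  have hT := hE.toIsTails.update (x := x) (k₀ := e x) (g := g) (by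
      simp only [hg]
      split_ifs with h0
      · exact hE.zero x hx
      · have : f = 0 := by omega
        subst this
        rw [Nat.zero_sub, Walk.getVert_zero]
        exact hE.zero x hx) (by
      intro k hk
      obtain ⟨l, h1, h2, -⟩ := hgz k
      rw [h2]; exact hE.mem x hx l h1) (by
      intro k hk
      rcases lt_trichotomy (k + 1) f with h1 | h1 | h1
      · simp only [hg]
        rw [if_pos (by omega), if_pos h1]
        exact hE.adj x hx k hk
      · simp only [hg]
        rw [if_pos (by omega), if_neg (by omega), h1, Nat.sub_self, Walk.getVert_zero, ← h1]
        exact hE.adj x hx k hk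
      · simp only [hg]
        rw [if_neg (by omega), if_neg (by omega), show k + 1 - f = k - f + 1 by omega]
        exact p.adj_getVert_succ (by omega)) hginj (by
      intro y hy hyx l hl k hk heq
      obtain ⟨l', h1, h2, -⟩ := hgz k
      exact hyx (hE.inj y hy x hx l hl l' h1 (by rw [← heq, h2])).1)
  rw [Function.update_eq_self] at hT
  have hM : IsMaxTails G K H A e (Function.update z x g) := ⟨hT, hE.le_weight⟩
  have hsc : tailScore G K h (e x) g ≤ tailScore G K h (e x) (z x) := by
    have h1 := hE.le_score _ _ hM
    rw [← Finset.add_sum_erase H _ hx, ← Finset.add_sum_erase H _ hx, Function.update_self] at h1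
    have : ∑ y ∈ H.erase x, tailScore G K h (e y) (Function.update z x g y) =
        ∑ y ∈ H.erase x, tailScore G K h (e y) (z y) :=
      Finset.sum_congr rfl fun y hy => by
        rw [Function.update_of_ne (Finset.ne_of_mem_erase hy)]
    omega
  have hcard := hE.lt_card hx
  have hr : tailScore G K h (e x) (z x) = e x - f := by
    unfold tailScore
    rw [if_neg (by omega), if_neg (by omega), hfirst]
  rw [hr] at hsc
  unfold tailScore at hsc
  rw [if_neg (by omega), hge] at hsc
  have hne : h < 2 * (nbrs G K v).card := by
    by_contra hcon
    rw [if_pos (by omega)] at hsc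
    omega
  refine ⟨hne, ?_⟩
  rw [if_neg (by omega)] at hsc
  have hown := hM.two_mul_card_le_or hu hH hK hx (by omega)
  rw [Function.update_self, hge] at hown
  rcases hown with hown | hown
  · omega
  intro y hy
  obtain ⟨k, hk, rfl⟩ := hown y hy
  have hle : sInf {i | i < e x ∧ G.Adj v (g i)} ≤ k := Nat.sInf_le ⟨hk, (mem_nbrs.1 hy).2⟩
  obtain ⟨l, h1, h2, h3, -⟩ := hgz k
  exact ⟨l, ⟨h3 (by omega), h1⟩, h2.symm⟩

/-- If the end of the tail at `x` has more than `h / 2` neighbours in `K`, then the final part of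
the tail spans a cycle closed under adjacency in `K`, except possibly at its first vertex. -/
theorem exists_closed_cycle (hE : IsOptTails G K H A h e z) (hu : CycMap G h u)
    (hH : (H : Set V) = Set.range u) (hK : CyclesBounded G K h) {x : V} (hx : x ∈ H)
    (hex : 1 ≤ e x) (hfine : h < 2 * (nbrs G K (z x (e x))).card) :
    ∃ f < e x, ∃ w : ℤ → V, CycMap G (e x - f + 1) w ∧ w 0 = z x f ∧
      Set.range w = z x '' Set.Icc f (e x) ∧
      ∀ v ∈ Set.range w, v ≠ w 0 → h < 2 * (nbrs G K v).card ∧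
        (∀ y ∈ nbrs G K v, y ∈ Set.range w) ∧
        LinkedBy G (z x '' Set.Icc 0 (e x)) x v (e x) := by
  classical
  set S := {i | i < e x ∧ G.Adj (z x (e x)) (z x i)} with hS
  have hSne : S.Nonempty := ⟨e x - 1, by omega, by
    have := hE.adj x hx (e x - 1) (by omega)
    rw [show e x - 1 + 1 = e x by omega] at this
    exact this.symm⟩
  obtain ⟨hfx, hfadj⟩ := Nat.sInf_mem hSne
  set f := sInf S with hf
  have hh3 := hu.three_le
  have hself : LinkedBy G (z x '' Set.Icc f (e x)) (z x f) (z x (e x)) (e x - f) :=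
    hE.seg hx hfx.le le_rfl
  have hnb := (hE.reroute hu hH hK hx hfx hfine rfl hself).2
  have hc3 : 3 ≤ e x - f + 1 := by
    have h1 : nbrs G K (z x (e x)) ⊆ (Finset.Ico f (e x)).image (z x) := by
      intro y hy
      obtain ⟨k, hk, rfl⟩ := hnb y hy
      have hke : k ≠ e x := by
        rintro rfl; exact G.irrefl (mem_nbrs.1 hy).2
      have := hk.2
      exact Finset.mem_image_of_mem _ (Finset.mem_Ico.2 ⟨hk.1, by omega⟩)
    have h2 := (Finset.card_le_card h1).trans Finset.card_image_le
    simp at h2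
    omega
  set c := e x - f + 1 with hc
  have hw := cycMap_of_seq (G := G) (g := fun k => z x (f + k)) hc3 (by
    intro k hk
    exact hE.adj x hx (f + k) (by omega)) (by
    have : f + (c - 1) = e x := by omega
    rwa [this]) (by
    intro k hk l hl heq
    have := (hE.inj x hx x hx _ (by omega) _ (by omega) heq).2
    omega)
  set w : ℤ → V := fun i => z x (f + (i % c).toNat) with hwdef
  have hwi : ∀ i : ℤ, 0 ≤ i → i < c → w i = z x (f + i.toNat) := by
    intro i h0 h1
    simp only [hwdef]
    rw [Int.emod_eq_of_lt h0 h1]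
  have hw0 : w 0 = z x f := by
    have := hwi 0 le_rfl (by omega)
    simpa using this
  have hrange : Set.range w = z x '' Set.Icc f (e x) := by
    ext y
    constructor
    · rintro ⟨i, rfl⟩
      have h1 := Int.emod_nonneg i (b := c) (by omega)
      have h2 := Int.emod_lt_of_pos i (b := c) (by omega)
      exact ⟨_, ⟨by omega, by omega⟩, rfl⟩
    · rintro ⟨k, hk, rfl⟩
      have := hk.1
      have := hk.2
      refine ⟨(k - f : ℕ), ?_⟩
      rw [hwi _ (by omega) (by omega)]
      congr 1
      omega
  have hcz : c ≤ h := by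
    obtain ⟨v, p, hp, hpl, hps⟩ := hw.exists_isCycle
    refine hpl.trans (hK v p hp ?_)
    intro y hy
    have := hps y hy
    rw [hrange] at this
    obtain ⟨k, hk, rfl⟩ := this
    exact hE.mem x hx k hk.2
  have hRK : Set.range w ⊆ K := by
    rw [hrange]; exact hE.seg_subset hx le_rfl
  have hP : ∀ i : ℤ, LinkedBy G (Set.range w) (w 0) (w i) (c - 1) →
      h < 2 * (nbrs G K (w i)).card ∧ (∀ y ∈ nbrs G K (w i), y ∈ Set.range w) ∧
        h < 2 * (nbrs G (Set.range w) (w i)).card := by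
    intro i hi
    rw [hrange, hw0] at hi
    obtain ⟨h1, h2⟩ := hE.reroute hu hH hK hx hfx hfine rfl hi
    rw [← hrange] at h2
    refine ⟨h1, h2, ?_⟩
    have : nbrs G K (w i) ⊆ nbrs G (Set.range w) (w i) := fun y hy =>
      mem_nbrs.2 ⟨h2 y hy, (mem_nbrs.1 hy).2⟩
    have := Finset.card_le_card this
    omega
  have h1 : LinkedBy G (Set.range w) (w 0) (w 1) (c - 1) :=
    hw.arc_linked' (by omega) (by omega) (by omega)
  have hall : ∀ j : ℕ, j < c - 1 → LinkedBy G (Set.range w) (w 0) (w (c - 1 - j : ℕ)) (c - 1) := by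
    intro j hj
    induction j with
    | zero => exact hw.arc_linked (by omega) (by omega) (by omega)
    | succ j ih =>
      by_cases hj1 : c - 1 - (j + 1) = 1
      · rw [hj1]; exact h1
      have ih := ih (by omega)
      have d1 := (hP _ h1).2.2
      have d2 := (hP _ ih).2.2
      have heq : ((c - 1 - j : ℕ) : ℤ) = ((c - 1 - (j + 1) : ℕ) : ℤ) + 1 := by omega
      rw [heq] at d2
      exact (hw.corner (i := 1) (j := 1) (α := ((c - 1 - (j + 1) : ℕ) : ℤ)) (by omega) (by omega)
        (by omega) (by omega) (by omega)).mono le_rfl (by omega)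
  refine ⟨f, hfx, w, hw, hw0, hrange, ?_⟩
  intro v hv hv0
  obtain ⟨i, i1, i2, rfl⟩ := hw.exists_window_of_mem hv 0
  have hi0 : i ≠ 0 := by rintro rfl; exact hv0 rfl
  have hl := hall (c - 1 - i.toNat) (by omega)
  have heq : ((c - 1 - (c - 1 - i.toNat) : ℕ) : ℤ) = i := by omega
  rw [heq] at hl
  refine ⟨(hP i hl).1, (hP i hl).2.1, ?_⟩
  rw [hrange, hw0] at hl
  have hs := hE.seg hx (Nat.zero_le f) hfx.le
  rw [hE.zero x hx] at hs
  refine (hs.append hl ?_).mono ?_ (by omega)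
  · rintro _ ⟨⟨k, hk, rfl⟩, l, hl, heq⟩
    have := (hE.inj x hx x hx l hl.2 k (hk.2.trans hfx.le) heq).2
    have := hk.2
    have := hl.1
    rw [Set.mem_singleton_iff]
    congr 1
    omega
  · rintro y (⟨k, hk, rfl⟩ | ⟨k, hk, rfl⟩)
    · exact ⟨k, ⟨hk.1, hk.2.trans hfx.le⟩, rfl⟩
    · exact ⟨k, ⟨Nat.zero_le _, hk.2⟩, rfl⟩

end IsOptTails

end

section


variable {V : Type*} [Fintype V] {G : SimpleGraph V}

/-- A cycle any two vertices of which, save possibly for one exceptional vertex, have degree sum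
larger than its length has long paths between all pairs of vertices. -/
theorem CycMap.linked_of_deg {c : ℕ} {w : ℤ → V} (hw : CycMap G c w)
    (hdeg : ∀ v ∈ Set.range w, v ≠ w 0 → c < 2 * (nbrs G (Set.range w) v).card) {a b : V}
    (ha : a ∈ Set.range w) (hb : b ∈ Set.range w) (hab : a ≠ b) :
    LinkedBy G (Set.range w) a b (c - 2) := by
  obtain ⟨i, i1, i2, rfl⟩ := hw.exists_window_of_mem ha 0
  obtain ⟨j, j1, j2, rfl⟩ := hw.exists_window_of_mem hb i
  have h3 := hw.three_le
  have hne : i ≠ j := by rintro rfl; exact hab rfl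
  by_cases h1 : j - i ≤ 2
  · exact hw.arc_linked' (by omega) (by omega) (by omega)
  by_cases h2 : c - 2 ≤ j - i
  · exact hw.arc_linked (by omega) (by omega) (by omega)
  have key : ∀ u : ℤ → V, CycMap G c u → Set.range u = Set.range w → ∀ α : ℤ, 2 < α → α + 2 < c →
      u 1 ≠ w 0 → u (α + 1) ≠ w 0 → LinkedBy G (Set.range w) (u 0) (u α) (c - 2) := by
    intro u hu hr α hα hα' n1 n2
    have d1 := hdeg (u 1) (hr ▸ ⟨1, rfl⟩) n1
    have d2 := hdeg (u (α + 1)) (hr ▸ ⟨α + 1, rfl⟩) n2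
    rw [← hr] at d1 d2
    have := hu.corner (i := 1) (j := 1) (α := α) (by omega) (by omega) (by omega) (by omega)
      (by omega)
    rw [hr] at this
    exact this.mono le_rfl (by omega)
  have hs := hw.shift i
  have hn := (hw.neg).shift (-i)
  by_cases hcase : w (i + 1) ≠ w 0 ∧ w (j + 1) ≠ w 0
  · have := key _ hs (CycMap.shift_range w i) (j - i) (by omega) (by omega)
      (by rw [add_comm]; exact hcase.1) (by
        rw [show j - i + 1 + i = j + 1 by ring]; exact hcase.2)
    simpa using this
  · have hn1 : w (i - 1) ≠ w 0 ∧ w (j - 1) ≠ w 0 := by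
      constructor
      · intro heq
        apply hcase
        rw [← heq]
        exact ⟨(hw.ne (by omega) (by omega)).symm, (hw.ne (by omega) (by omega)).symm⟩
      · intro heq
        apply hcase
        rw [← heq]
        exact ⟨hw.ne (by omega) (by omega), (hw.ne (by omega) (by omega)).symm⟩
    have e1 : w (i - (j - i) + (j - i)) = w i := by congr 1; ring
    have e2 := hw.periodic j
    have e3 := hw.periodic (j - 1)
    have := key _ hn ((CycMap.shift_range _ _).trans (CycMap.neg_range w)) (c - (j - i)) (by omega)
      (by omega) (by
        rw [show -(1 + -i) = i - 1 by ring]; exact hn1.1) (by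
        rw [show -((c : ℤ) - (j - i) + 1 + -i) = j - 1 - c by ring]
        have := hw.periodic (j - 1 - c)
        rw [sub_add_cancel] at this
        rw [← this]; exact hn1.2)
    have e4 := hw.periodic (j - c)
    rw [sub_add_cancel] at e4
    rw [show -((c : ℤ) - (j - i) + -i) = j - c by ring, ← e4] at this
    simpa using this

theorem CycMap.wellLinked {c : ℕ} {w : ℤ → V} (hw : CycMap G c w) {K : Set V}
    (hwK : Set.range w ⊆ K) {F : Finset V} (hF : (F : Set V) ⊆ Set.range w) :
    WellLinked G K F := by
  classical
  intro v hv k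
  obtain ⟨i, i1, i2, rfl⟩ := hw.exists_window_of_mem (hF hv) 0
  have hsub : F.filter (fun v' => v' ≠ w i ∧ ¬ LinkedBy G K (w i) v' (k + 1)) ⊆
      (Finset.Icc (1 : ℤ) k).image fun d => w (i + d) := by
    intro v' hv'
    rw [Finset.mem_filter] at hv'
    obtain ⟨j, j1, j2, rfl⟩ := hw.exists_window_of_mem (hF hv'.1) i
    refine Finset.mem_image.2 ⟨j - i, ?_, by simp⟩
    rw [Finset.mem_Icc]
    constructor
    · by_contra hcon
      exact hv'.2.1 (by congr 1; omega)
    · by_contra hcon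
      exact hv'.2.2 ((hw.arc_linked j1 j2 (by push_cast; omega)).mono hwK le_rfl)
  exact ((Finset.card_le_card hsub).trans Finset.card_image_le).trans (by simp)

/-- Properties of the closed part of a tail `g 0, …, g k` whose end has many neighbours. -/
structure IsCluster (G : SimpleGraph V) (K : Set V) (h : ℕ) (g : ℕ → V) (k : ℕ) (R : Finset V) :
    Prop where
  mem_tail : ∀ v ∈ R, ∃ j, 1 ≤ j ∧ j ≤ k ∧ v = g j
  end_mem : g k ∈ R
  card_lt : R.card + 1 ≤ h
  lt_card : h < 2 * R.card
  card_nbrs_le : ∀ v ∈ R, (nbrs G K v).card ≤ R.card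
  linked : ∀ v ∈ R, LinkedBy G (g '' Set.Icc 0 k) (g 0) v R.card
  wellLinked : WellLinked G K R
  exists_set : ∃ Z ⊆ K, Z.ncard = R.card + 1 ∧ ∀ a ∈ Z, ∀ b ∈ Z, a ≠ b →
    LinkedBy G Z a b (R.card - 1)

namespace IsOptTails

variable {K : Set V} {H : Finset V} {A : Set V} {h : ℕ} {e : V → ℕ} {z : V → ℕ → V} {u : ℤ → V}

theorem exists_cluster (hE : IsOptTails G K H A h e z) (hu : CycMap G h u)
    (hH : (H : Set V) = Set.range u) (hK : CyclesBounded G K h) {x : V} (hx : x ∈ H)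
    (hex : 1 ≤ e x) (hfine : h < 2 * (nbrs G K (z x (e x))).card) :
    ∃ R, IsCluster G K h (z x) (e x) R := by
  classical
  obtain ⟨f, hf, w, hw, hw0, hr, hcl⟩ := hE.exists_closed_cycle hu hH hK hx hex hfine
  have hzinj : ∀ k ≤ e x, ∀ l ≤ e x, z x k = z x l → k = l := fun k hk l hl heq =>
    (hE.inj x hx x hx k hk l hl heq).2
  have hRw : Set.range w ⊆ K := by
    rw [hr]; exact hE.seg_subset hx le_rfl
  have hch : e x - f + 1 ≤ h := by
    obtain ⟨v, p, hp, hpl, hps⟩ := hw.exists_isCycle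
    exact hpl.trans (hK v p hp fun y hy => hRw (hps y hy))
  have hcard : ((Finset.Ioc f (e x)).image (z x)).card = e x - f := by
    rw [Finset.card_image_of_injOn, Nat.card_Ioc]
    intro k hk l hl heq
    simp at hk hl
    exact hzinj k hk.2 l hl.2 heq
  have hmem : ∀ v ∈ (Finset.Ioc f (e x)).image (z x), v ∈ Set.range w ∧ v ≠ w 0 := by
    intro v hv
    obtain ⟨k, hk, rfl⟩ := Finset.mem_image.1 hv
    rw [Finset.mem_Ioc] at hk
    refine ⟨hr ▸ ⟨k, ⟨hk.1.le, hk.2⟩, rfl⟩, fun heq => ?_⟩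
    rw [hw0] at heq
    have := hzinj k hk.2 f hf.le heq
    omega
  have hrc : ∀ v ∈ Set.range w, v ≠ w 0 → (nbrs G K v).card ≤ e x - f := by
    intro v hv hv0
    have h1 : nbrs G K v ⊆ ((Finset.Icc f (e x)).image (z x)).erase v := by
      intro y hy
      have h2 := (hcl v hv hv0).2.1 y hy
      rw [hr] at h2
      obtain ⟨k, hk, rfl⟩ := h2
      refine Finset.mem_erase.2 ⟨?_, Finset.mem_image_of_mem _ (Finset.mem_Icc.2 hk)⟩
      rintro heq
      rw [← heq] at hy
      exact G.irrefl (mem_nbrs.1 hy).2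
    have h2 := Finset.card_le_card h1
    rw [hr] at hv
    obtain ⟨k, hk, rfl⟩ := hv
    rw [Finset.card_erase_of_mem (Finset.mem_image_of_mem _ (Finset.mem_Icc.2 hk))] at h2
    have h3 : ((Finset.Icc f (e x)).image (z x)).card ≤ (Finset.Icc f (e x)).card :=
      Finset.card_image_le
    rw [Nat.card_Icc] at h3
    omega
  have hend : z x (e x) ∈ (Finset.Ioc f (e x)).image (z x) :=
    Finset.mem_image_of_mem _ (Finset.mem_Ioc.2 ⟨hf, le_rfl⟩)
  refine ⟨(Finset.Ioc f (e x)).image (z x), ?_, hend, ?_, ?_, ?_, ?_, ?_, ?_⟩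
  · intro v hv
    obtain ⟨k, hk, rfl⟩ := Finset.mem_image.1 hv
    rw [Finset.mem_Ioc] at hk
    exact ⟨k, by omega, hk.2, rfl⟩
  · omega
  · have := hrc _ (hmem _ hend).1 (hmem _ hend).2
    omega
  · intro v hv
    rw [hcard]
    exact hrc v (hmem v hv).1 (hmem v hv).2
  · intro v hv
    rw [hE.zero x hx]
    exact (hcl v (hmem v hv).1 (hmem v hv).2).2.2.mono le_rfl (by omega)
  · exact hw.wellLinked hRw fun v hv => (hmem v hv).1
  · refine ⟨Set.range w, hRw, ?_, ?_⟩
    · rw [hw.ncard_range, hcard]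
    · intro a ha b hb hab
      refine (hw.linked_of_deg ?_ ha hb hab).mono le_rfl (by omega)
      intro v hv hv0
      obtain ⟨h1, h2, -⟩ := hcl v hv hv0
      have h3 : nbrs G K v ⊆ nbrs G (Set.range w) v := fun y hy =>
        mem_nbrs.2 ⟨h2 y hy, (mem_nbrs.1 hy).2⟩
      have := Finset.card_le_card h3
      omega

theorem _root_.LongCycle.IsTails.tails_linked (hE : IsTails G K H e z)
    (hH : (H : Set V) = Set.range u) {x y : V} (hx : x ∈ H) (hy : y ∈ H) (hxy : x ≠ y) {v w : V} {n d k : ℕ}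
    (hv : LinkedBy G (z x '' Set.Icc 0 (e x)) x v n)
    (hw : LinkedBy G (z y '' Set.Icc 0 (e y)) y w k)
    (hd : LinkedBy G (Set.range u) x y d) : LinkedBy G K v w (n + d + k) := by
  have hi : ∀ x ∈ H, z x '' Set.Icc 0 (e x) ∩ Set.range u ⊆ {x} := by
    rintro x hx _ ⟨⟨j, hj, rfl⟩, hu⟩
    rw [← hH] at hu
    have := (hE.inj x hx _ hu j hj.2 0 (Nat.zero_le _) (hE.zero _ hu).symm)
    exact this.1.symm
  have hdis : ∀ w, w ∈ z x '' Set.Icc 0 (e x) → w ∉ z y '' Set.Icc 0 (e y) := by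
    rintro _ ⟨j, hj, rfl⟩ ⟨l, hl, heq⟩
    exact hxy (hE.inj y hy x hx l hl.2 j hj.2 heq).1.symm
  refine ((hv.symm.append hd (hi x hx)).append hw ?_).mono ?_ le_rfl
  · rintro w ⟨hw1 | hw1, hw2⟩
    · exact absurd hw2 (hdis w hw1)
    · exact hi y hy ⟨hw2, hw1⟩
  · refine Set.union_subset (Set.union_subset (hE.seg_subset hx le_rfl) ?_)
      (hE.seg_subset hy le_rfl)
    rw [← hH]
    intro v hv
    have := hE.mem v hv 0 (Nat.zero_le _)
    rwa [hE.zero v hv] at this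

end IsOptTails

end

section


variable {V : Type*} [Fintype V] {G : SimpleGraph V}

theorem CycMap.two_mul_card_nbrs_le {h : ℕ} {u : ℤ → V} (hu : CycMap G h u) {K : Set V}
    (hK : CyclesBounded G K h) (huK : Set.range u ⊆ K) {w : V} (hwK : w ∈ K)
    (hwu : w ∉ Set.range u) : 2 * (nbrs G (Set.range u) w).card ≤ h := by
  classical
  rw [hu.card_nbrs w 0]
  have h3 := hu.three_le
  have hl : LinkedBy G {w} w w 0 := LinkedBy.single rfl
  have main := sum_le_of_gaps h (fun _ => 2)
    ((Finset.Ico (0 : ℤ) (0 + h)).filter fun c => G.Adj w (u c)) (by intros; omega) (by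
      intro i hi j hj hij
      simp only [Finset.mem_filter, Finset.mem_Ico] at hi hj
      have g1 := hu.chord_gap hK huK (by simpa using hwK) (by simpa using hwu) hl hij (by omega)
        hi.2 hj.2
      have g2 := hu.chord_gap' hK huK (by simpa using hwK) (by simpa using hwu) hl hij (by omega)
        hi.2 hj.2
      push_cast at g1 g2 ⊢
      omega)
  rw [Finset.sum_const, smul_eq_mul] at main
  omega

/-- The number of neighbours in `K` of the end of the tail at `x`. -/
noncomputable def endDeg (G : SimpleGraph V) (K : Set V) (e : V → ℕ) (z : V → ℕ → V) (x : V) : ℕ :=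
  (nbrs G K (z x (e x))).card

open Classical in
/-- The vertices of `H` with trivial tail adjacent to the first proper vertex of the tail of `x`. -/
noncomputable def twigs (G : SimpleGraph V) (H : Finset V) (e : V → ℕ) (z : V → ℕ → V) (x : V) :
    Finset V :=
  H.filter fun i => e i = 0 ∧ G.Adj (z x 1) i

open Classical in
/-- The vertices with twigs and a tail whose end has many neighbours in `K`. -/
noncomputable def heavy (G : SimpleGraph V) (K : Set V) (H : Finset V) (h : ℕ) (e : V → ℕ)
    (z : V → ℕ → V) : Finset V :=
  H.filter fun x => 1 ≤ e x ∧ h < 2 * endDeg G K e z x ∧ (twigs G H e z x).Nonempty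

open Classical in
/-- The heavy vertices and their twigs. -/
noncomputable def swept (G : SimpleGraph V) (K : Set V) (H : Finset V) (h : ℕ) (e : V → ℕ)
    (z : V → ℕ → V) : Finset V :=
  heavy G K H h e z ∪ (heavy G K H h e z).biUnion (twigs G H e z)

/-- The amount charged to `x` when counting the neighbours in `K` of the ends of the tails. -/
noncomputable def load (G : SimpleGraph V) (K : Set V) (H : Finset V) (e : V → ℕ) (z : V → ℕ → V)
    (x : V) : ℕ :=
  if e x = 0 then (nbrs G H x).card else endDeg G K e z x + (twigs G H e z x).card

section

variable {K : Set V} {H : Finset V} {h : ℕ} {e : V → ℕ} {z : V → ℕ → V} {u : ℤ → V}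

theorem mem_twigs {x i : V} : i ∈ twigs G H e z x ↔ i ∈ H ∧ e i = 0 ∧ G.Adj (z x 1) i := by
  simp [twigs]

theorem mem_heavy {x : V} : x ∈ heavy G K H h e z ↔
    x ∈ H ∧ 1 ≤ e x ∧ h < 2 * endDeg G K e z x ∧ (twigs G H e z x).Nonempty := by
  simp [heavy]

theorem swept_subset : swept G K H h e z ⊆ H := by
  intro x hx
  simp only [swept, Finset.mem_union, Finset.mem_biUnion] at hx
  rcases hx with hx | ⟨y, -, hx⟩
  · exact (mem_heavy.1 hx).1
  · exact (mem_twigs.1 hx).1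

theorem mem_heavy_of_mem_swept {x : V} (hx : x ∈ swept G K H h e z) (hex : 1 ≤ e x) :
    x ∈ heavy G K H h e z := by
  simp only [swept, Finset.mem_union, Finset.mem_biUnion] at hx
  rcases hx with hx | ⟨y, -, hx⟩
  · exact hx
  · have := (mem_twigs.1 hx).2.1
    omega

theorem mem_swept_of_mem_twigs {x y : V} (hy : y ∈ heavy G K H h e z)
    (hx : x ∈ twigs G H e z y) : x ∈ swept G K H h e z := by
  simp only [swept, Finset.mem_union, Finset.mem_biUnion]
  exact Or.inr ⟨y, hy, hx⟩

theorem IsTails.range_subset (hE : IsTails G K H e z) (hH : (H : Set V) = Set.range u) :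
    Set.range u ⊆ K := by
  rw [← hH]
  intro v hv
  have := hE.mem v hv 0 (Nat.zero_le _)
  rwa [hE.zero v hv] at this

theorem IsTails.two_mul_card_twigs_lt (hE : IsTails G K H e z) (hu : CycMap G h u)
    (hH : (H : Set V) = Set.range u) (hK : CyclesBounded G K h) {x : V} (hx : x ∈ H)
    (hex : 1 ≤ e x) : 2 * ((twigs G H e z x).card + 1) ≤ h := by
  classical
  refine le_trans ?_ (hu.two_mul_card_nbrs_le hK (hE.range_subset hH) (hE.mem x hx 1 hex)
    (by rw [← hH]; exact hE.notMem hx hex le_rfl))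
  have h1 : insert x (twigs G H e z x) ⊆ nbrs G (Set.range u) (z x 1) := by
    intro y hy
    rw [mem_nbrs, ← hH]
    rcases Finset.mem_insert.1 hy with rfl | hy
    · have := (hE.adj y hx 0 hex).symm
      rw [hE.zero y hx] at this
      exact ⟨hx, this⟩
    · exact ⟨(mem_twigs.1 hy).1, (mem_twigs.1 hy).2.2⟩
  have h2 : x ∉ twigs G H e z x := fun hc => by
    have := (mem_twigs.1 hc).2.1
    omega
  have := Finset.card_le_card h1
  rw [Finset.card_insert_of_notMem h2] at this
  omega

open Classical in
theorem IsMaxTails.sum_endDeg_le {A : Set V} (hE : IsMaxTails G K H A e z) :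
    ∑ x ∈ H \ swept G K H h e z, endDeg G K e z x ≤
      ∑ x ∈ H \ swept G K H h e z, load G K H e z x := by
  set Q := H \ swept G K H h e z with hQ
  set P := Q.filter fun y => 1 ≤ e y with hP
  have hpt : ∀ x ∈ Q, endDeg G K e z x ≤
      (if e x = 0 then (nbrs G H x).card else endDeg G K e z x) +
        (P.filter fun y => x ∈ twigs G H e z y).card := by
    intro x hx
    obtain ⟨hxH, hxs⟩ := Finset.mem_sdiff.1 hx
    split_ifs with hex
    · have hsub : nbrs G K (z x (e x)) ⊆ nbrs G H x ∪
          (P.filter fun y => x ∈ twigs G H e z y).image (fun y => z y 1) := by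
        intro v hv
        rw [mem_nbrs] at hv
        obtain ⟨y, hy, k, hk, rfl⟩ := hE.exists_eq_of_adj hxH hv.1 hv.2
        have hadj := hv.2
        rw [hex, hE.zero x hxH] at hadj
        rw [Finset.mem_union]
        rcases Nat.eq_zero_or_pos k with rfl | hk1
        · left
          rw [hE.zero y hy] at hadj ⊢
          exact mem_nbrs.2 ⟨hy, hadj⟩
        · right
          obtain ⟨rfl, -⟩ := hE.adj_depth hxH hy hex hk1 hk hadj
          have hxy : x ∈ twigs G H e z y := mem_twigs.2 ⟨hxH, hex, hadj.symm⟩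
          refine Finset.mem_image.2 ⟨y, Finset.mem_filter.2 ⟨Finset.mem_filter.2
            ⟨Finset.mem_sdiff.2 ⟨hy, fun hys => hxs ?_⟩, hk⟩, hxy⟩, rfl⟩
          exact mem_swept_of_mem_twigs (mem_heavy_of_mem_swept hys hk) hxy
      have h1 := (Finset.card_le_card hsub).trans (Finset.card_union_le _ _)
      have h2 : ((P.filter fun y => x ∈ twigs G H e z y).image (fun y => z y 1)).card ≤ _ :=
        Finset.card_image_le
      unfold endDeg
      omega
    · omega
  have hB : ∑ x ∈ Q, (P.filter fun y => x ∈ twigs G H e z y).card ≤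
      ∑ y ∈ P, (twigs G H e z y).card := by
    have := Finset.sum_card_bipartiteAbove_eq_sum_card_bipartiteBelow (s := Q) (t := P)
      (fun x y => x ∈ twigs G H e z y)
    simp only [Finset.bipartiteAbove, Finset.bipartiteBelow] at this
    rw [this]
    refine Finset.sum_le_sum fun y _ => Finset.card_le_card fun x hx => ?_
    exact (Finset.mem_filter.1 hx).2
  have hload : ∑ x ∈ Q, load G K H e z x =
      ∑ x ∈ Q, (if e x = 0 then (nbrs G H x).card else endDeg G K e z x) +
        ∑ y ∈ P, (twigs G H e z y).card := by
    rw [hP, Finset.sum_filter, ← Finset.sum_add_distrib]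
    refine Finset.sum_congr rfl fun x _ => ?_
    unfold load
    by_cases hex : e x = 0
    · simp [hex]
    · rw [if_neg hex, if_neg hex, if_pos (by omega)]
  rw [hload]
  refine (Finset.sum_le_sum hpt).trans ?_
  rw [Finset.sum_add_distrib]
  omega

open Classical in
/-- The ends of the tails, after replacing those at heavy vertices and their twigs by vertices of
clusters, form a well-linked set of the same size as the cycle. -/
theorem IsOptTails.exists_wellLinked {A : Set V} (hE : IsOptTails G K H A h e z)
    (hu : CycMap G h u) (hH : (H : Set V) = Set.range u) (hK : CyclesBounded G K h)
    {R : V → Finset V} {r : ℕ}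
    (hR : ∀ x ∈ heavy G K H h e z, IsCluster G K h (z x) (e x) (R x))
    (hr : ∀ x ∈ heavy G K H h e z, (R x).card ≤ r) :
    ∃ F : Finset V, (∀ v ∈ F, v ∈ K) ∧ F.card = h ∧ WellLinked G K F ∧
      ∑ v ∈ F, (nbrs G K v).card ≤
        ∑ x ∈ H \ swept G K H h e z, load G K H e z x + r * (swept G K H h e z).card ∧
      (∀ x ∈ H \ swept G K H h e z, z x (e x) ∈ F) ∧
      ((swept G K H h e z).Nonempty → ∃ v ∈ F, (nbrs G K v).card ≤ r) := by
  set J := heavy G K H h e z with hJ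
  set S := swept G K H h e z with hS
  have hJH : ∀ x ∈ J, x ∈ H := fun x hx => (mem_heavy.1 hx).1
  have hJe : ∀ x ∈ J, 1 ≤ e x := fun x hx => (mem_heavy.1 hx).2.1
  have hJS : J ⊆ S := Finset.subset_union_left
  have huK := hE.range_subset hH
  have hRdisj : ∀ x ∈ J, ∀ y ∈ J, x ≠ y → Disjoint (R x) (R y) := by
    intro x hx y hy hxy
    rw [Finset.disjoint_left]
    intro v hv hv'
    obtain ⟨j, j1, j2, rfl⟩ := (hR x hx).mem_tail v hv
    obtain ⟨l, l1, l2, heq⟩ := (hR y hy).mem_tail _ hv'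
    exact hxy (hE.inj x (hJH x hx) y (hJH y hy) j j2 l l2 heq).1
  have hScard : S.card ≤ (J.biUnion R).card := by
    rw [Finset.card_biUnion hRdisj]
    have h1 : S.card ≤ J.card + ∑ x ∈ J, (twigs G H e z x).card :=
      (Finset.card_union_le _ _).trans (Nat.add_le_add_left Finset.card_biUnion_le _)
    refine h1.trans ?_
    rw [Finset.card_eq_sum_ones, ← Finset.sum_add_distrib]
    refine Finset.sum_le_sum fun x hx => ?_
    have := hE.two_mul_card_twigs_lt hu hH hK (hJH x hx) (hJe x hx)
    have := (hR x hx).lt_card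
    omega
  obtain ⟨F', hF'sub, hF'card⟩ := Finset.exists_subset_card_eq hScard
  have hHcard : H.card = h := by
    rw [← hu.ncard_range, ← hH, Set.ncard_coe_finset]
  set E := (H \ S).image (fun x => z x (e x)) with hEdef
  have hEcard : E.card = (H \ S).card := by
    apply Finset.card_image_of_injOn
    intro x hx y hy heq
    exact (hE.inj x (Finset.mem_sdiff.1 hx).1 y (Finset.mem_sdiff.1 hy).1 _ le_rfl _ le_rfl heq).1
  have hmemF' : ∀ v ∈ F', ∃ x ∈ J, v ∈ R x := fun v hv => Finset.mem_biUnion.1 (hF'sub hv)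
  have hdisj : Disjoint E F' := by
    rw [Finset.disjoint_left]
    intro v hv hv'
    obtain ⟨x, hx, rfl⟩ := Finset.mem_image.1 hv
    obtain ⟨y, hy, hvy⟩ := hmemF' _ hv'
    obtain ⟨j, j1, j2, heq⟩ := (hR y hy).mem_tail _ hvy
    obtain ⟨hxH, hxS⟩ := Finset.mem_sdiff.1 hx
    have := (hE.inj x hxH y (hJH y hy) _ le_rfl j j2 heq).1
    exact hxS (this ▸ hJS hy)
  have hcard : (E ∪ F').card = h := by
    rw [Finset.card_union_of_disjoint hdisj, hEcard, hF'card, Finset.card_sdiff_of_subset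
      swept_subset, hHcard]
    have : S.card ≤ H.card := Finset.card_le_card swept_subset
    rw [← hS]
    omega
  have hRt : ∀ x ∈ J, ∀ v ∈ R x, (nbrs G K v).card ≤ r := fun x hx v hv =>
    ((hR x hx).card_nbrs_le v hv).trans (hr x hx)
  have hbig : ∀ x ∈ H, ∀ y ∈ H, x ≠ y → LinkedBy G (Set.range u) x y (h - h / 2) := by
    intro x hx y hy hxy
    rw [← Finset.mem_coe, hH] at hx hy
    obtain ⟨i, i1, i2, rfl⟩ := hu.exists_window_of_mem hx 0
    obtain ⟨j, j1, j2, rfl⟩ := hu.exists_window_of_mem hy i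
    have : i ≠ j := by rintro rfl; exact hxy rfl
    by_cases hd : h - h / 2 ≤ j - i
    · exact hu.arc_linked (by omega) (by omega) (by omega)
    · exact hu.arc_linked' (by omega) (by omega) (by omega)
  have hend : ∀ x ∈ H, LinkedBy G (z x '' Set.Icc 0 (e x)) x (z x (e x)) (e x) := by
    intro x hx
    have := hE.seg hx (Nat.zero_le (e x)) le_rfl
    rwa [hE.zero x hx] at this
  have hclus : ∀ x ∈ J, ∀ v ∈ R x, LinkedBy G (z x '' Set.Icc 0 (e x)) x v (R x).card := by
    intro x hx v hv
    have := (hR x hx).linked v hv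
    rwa [hE.zero x (hJH x hx)] at this
  refine ⟨E ∪ F', ?_, hcard, ?_, ?_, ?_, ?_⟩
  · intro v hv
    rcases Finset.mem_union.1 hv with hv | hv
    · obtain ⟨x, hx, rfl⟩ := Finset.mem_image.1 hv
      exact hE.mem x (Finset.mem_sdiff.1 hx).1 _ le_rfl
    · obtain ⟨x, hx, hv⟩ := hmemF' v hv
      obtain ⟨j, j1, j2, rfl⟩ := (hR x hx).mem_tail v hv
      exact hE.mem x (hJH x hx) j j2
  · intro v hv k
    by_cases hk : h ≤ k + 1
    · have : (E ∪ F').filter (fun v' => v' ≠ v ∧ ¬ LinkedBy G K v v' (k + 1)) ⊆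
          (E ∪ F').erase v := by
        intro v' hv'
        rw [Finset.mem_filter] at hv'
        exact Finset.mem_erase.2 ⟨hv'.2.1, hv'.1⟩
      have := Finset.card_le_card this
      rw [Finset.card_erase_of_mem hv, hcard] at this
      omega
    rcases Finset.mem_union.1 hv with hv | hv
    · obtain ⟨x, hx, rfl⟩ := Finset.mem_image.1 hv
      obtain ⟨hxH, hxS⟩ := Finset.mem_sdiff.1 hx
      have hxu : x ∈ Set.range u := by rw [← hH]; exact hxH
      obtain ⟨i, i1, i2, rfl⟩ := hu.exists_window_of_mem hxu 0
      have hsub : (E ∪ F').filter (fun v' => v' ≠ z (u i) (e (u i)) ∧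
          ¬ LinkedBy G K (z (u i) (e (u i))) v' (k + 1)) ⊆
          (Finset.Icc (1 : ℤ) k).image fun d => z (u (i + d)) (e (u (i + d))) := by
        intro v' hv'
        rw [Finset.mem_filter] at hv'
        obtain ⟨hv', hne, hnl⟩ := hv'
        rcases Finset.mem_union.1 hv' with hv' | hv'
        · obtain ⟨y, hy, rfl⟩ := Finset.mem_image.1 hv'
          obtain ⟨hyH, hyS⟩ := Finset.mem_sdiff.1 hy
          have hyu : y ∈ Set.range u := by rw [← hH]; exact hyH
          obtain ⟨j, j1, j2, rfl⟩ := hu.exists_window_of_mem hyu i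
          have hxy : u i ≠ u j := fun heq => hne (by rw [heq])
          refine Finset.mem_image.2 ⟨j - i, ?_, by simp⟩
          rw [Finset.mem_Icc]
          constructor
          · by_contra hcon
            exact hxy (by congr 1; omega)
          · by_contra hcon
            exact hnl ((hE.toIsTails.tails_linked hH hxH hyH hxy (hend _ hxH) (hend _ hyH)
              (hu.arc_linked (k := k + 1) j1 j2 (by push_cast; omega))).mono le_rfl (by omega))
        · exfalso
          obtain ⟨y, hy, hvy⟩ := hmemF' _ hv'
          have hxy : u i ≠ y := fun heq => hxS (heq ▸ hJS hy)
          have := (hR y hy).lt_card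
          exact hnl ((hE.toIsTails.tails_linked hH hxH (hJH y hy) hxy (hend _ hxH)
            (hclus y hy v' hvy) (hbig _ hxH _ (hJH y hy) hxy)).mono le_rfl (by omega))
      exact ((Finset.card_le_card hsub).trans Finset.card_image_le).trans (by simp)
    · obtain ⟨x, hx, hvx⟩ := hmemF' v hv
      refine (Finset.card_le_card ?_).trans ((hR x hx).wellLinked v hvx k)
      intro v' hv'
      rw [Finset.mem_filter] at hv' ⊢
      obtain ⟨hv', hne, hnl⟩ := hv'
      refine ⟨?_, hne, hnl⟩
      have := (hR x hx).lt_card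
      rcases Finset.mem_union.1 hv' with hv' | hv'
      · exfalso
        obtain ⟨y, hy, rfl⟩ := Finset.mem_image.1 hv'
        obtain ⟨hyH, hyS⟩ := Finset.mem_sdiff.1 hy
        have hxy : x ≠ y := fun heq => hyS (heq ▸ hJS hx)
        exact hnl ((hE.toIsTails.tails_linked hH (hJH x hx) hyH hxy (hclus x hx v hvx)
          (hend y hyH) (hbig _ (hJH x hx) _ hyH hxy)).mono le_rfl (by omega))
      · obtain ⟨y, hy, hvy⟩ := hmemF' v' hv'
        by_cases hxy : x = y
        · rw [hxy]; exact hvy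
        · exfalso
          exact hnl ((hE.toIsTails.tails_linked hH (hJH x hx) (hJH y hy) hxy (hclus x hx v hvx)
            (hclus y hy v' hvy) (hbig _ (hJH x hx) _ (hJH y hy) hxy)).mono le_rfl (by omega))
  · rw [Finset.sum_union hdisj]
    refine add_le_add ?_ ?_
    · rw [hEdef, Finset.sum_image]
      · exact hE.toIsMaxTails.sum_endDeg_le
      · intro x hx y hy heq
        exact (hE.inj x (Finset.mem_sdiff.1 hx).1 y (Finset.mem_sdiff.1 hy).1 _ le_rfl _ le_rfl
          heq).1
    · rw [← hF'card, mul_comm, ← smul_eq_mul]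
      refine Finset.sum_le_card_nsmul _ _ _ fun v hv => ?_
      obtain ⟨x, hx, hvx⟩ := hmemF' v hv
      exact hRt x hx v hvx
  · intro x hx
    exact Finset.mem_union_left _ (Finset.mem_image_of_mem _ hx)
  · intro hne
    have : F'.Nonempty := by
      rw [← Finset.card_pos, hF'card, Finset.card_pos]; exact hne
    obtain ⟨v, hv⟩ := this
    obtain ⟨x, hx, hvx⟩ := hmemF' v hv
    exact ⟨v, Finset.mem_union_right _ hv, hRt x hx v hvx⟩

end

end

section


variable {V : Type*} [Fintype V] {G : SimpleGraph V}

theorem le_card_nbrs_add {δ : ℕ} (hδ : ∀ v, δ ≤ (nbrs G Set.univ v).card) (S : Set V) (v : V) :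
    δ ≤ (nbrs G S v).card + (nbrs G Sᶜ v).card := by
  classical
  refine (hδ v).trans (le_trans (Finset.card_le_card ?_) (Finset.card_union_le _ _))
  intro x hx
  rw [mem_nbrs] at hx
  rw [Finset.mem_union, mem_nbrs, mem_nbrs]
  by_cases hxS : x ∈ S
  · exact Or.inl ⟨hxS, hx.2⟩
  · exact Or.inr ⟨hxS, hx.2⟩

section

variable {n : ℕ} {c : ℤ → V} {δ : ℕ}

theorem WellLinked.mul_add_le (hc : CycMap G n c) (hlong : CyclesBounded G Set.univ n)
    (hδ : ∀ v, δ ≤ (nbrs G Set.univ v).card) {F : Finset V}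
    (hFK : ∀ v ∈ F, v ∈ (Set.range c)ᶜ) (hF : WellLinked G (Set.range c)ᶜ F) {T s : ℕ}
    (hT : ∑ v ∈ F, (nbrs G (Set.range c)ᶜ v).card ≤ T)
    (hs : ∃ v ∈ F, (nbrs G (Set.range c)ᶜ v).card ≤ s) :
    (F.card + 1) * δ ≤ n + T + s := by
  classical
  have h1 := WellLinked.sum_card_add_le hc hlong hFK hF
  obtain ⟨v, hv, hvs⟩ := hs
  have h2 : (nbrs G (Set.range c) v).card ≤ (F.biUnion (nbrs G (Set.range c))).card :=
    Finset.card_le_card (Finset.subset_biUnion_of_mem (nbrs G (Set.range c)) hv)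
  have h3 := le_card_nbrs_add hδ (Set.range c) v
  have h4 : F.card * δ ≤ ∑ v ∈ F, (nbrs G (Set.range c) v).card +
      ∑ v ∈ F, (nbrs G (Set.range c)ᶜ v).card := by
    rw [← Finset.sum_add_distrib, ← smul_eq_mul]
    exact Finset.card_nsmul_le_sum _ _ _ fun v _ => le_card_nbrs_add hδ (Set.range c) v
  rw [add_mul, one_mul]
  omega

/-- A version of `WellLinked.mul_add_le` for sets whose average degree in `K` is less than their
cardinality. -/
theorem WellLinked.mul_le (hc : CycMap G n c) (hlong : CyclesBounded G Set.univ n)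
    (hδ : ∀ v, δ ≤ (nbrs G Set.univ v).card) {F : Finset V}
    (hFK : ∀ v ∈ F, v ∈ (Set.range c)ᶜ) (hF : WellLinked G (Set.range c)ᶜ F) (hne : F.Nonempty)
    (hT : ∑ v ∈ F, (nbrs G (Set.range c)ᶜ v).card ≤ F.card * (F.card - 1)) :
    (F.card + 1) * δ ≤ n + (F.card + 1) * (F.card - 1) := by
  have := hF.mul_add_le hc hlong hδ hFK hT (s := F.card - 1) (by
    by_contra hcon
    push Not at hcon
    have := Finset.sum_lt_sum_of_nonempty hne hcon
    rw [Finset.sum_const, smul_eq_mul] at this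
    omega)
  rw [add_mul F.card 1 (F.card - 1)]
  omega

theorem IsMaxTails.load_le {K : Set V} {H : Finset V} {h : ℕ} {e : V → ℕ} {z : V → ℕ → V}
    {u : ℤ → V} {A : Set V} (hE : IsMaxTails G K H A e z) (hu : CycMap G h u)
    (hH : (H : Set V) = Set.range u) (hK : CyclesBounded G K h) {R : Finset V} {r : ℕ} {x : V}
    (hx : x ∈ H) (hxs : x ∉ swept G K H h e z) (hex : 1 ≤ e x)
    (hR : h < 2 * endDeg G K e z x → IsCluster G K h (z x) (e x) R ∧ R.card ≤ r) :
    load G K H e z x ≤ r ∨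
      (2 * endDeg G K e z x ≤ h ∧ 2 * (load G K H e z x + 1) ≤ 2 * h ∧
        2 * ((twigs G H e z x).card + 1) ≤ h) := by
  classical
  have ht := hE.two_mul_card_twigs_lt hu hH hK hx hex
  unfold load
  rw [if_neg (by omega)]
  by_cases hf : h < 2 * endDeg G K e z x
  · left
    have h0 : (twigs G H e z x).card = 0 := by
      rw [Finset.card_eq_zero]
      by_contra hne
      exact hxs (Finset.mem_union_left _ (mem_heavy.2
        ⟨hx, hex, hf, Finset.nonempty_iff_ne_empty.2 hne⟩))
    obtain ⟨h1, h2⟩ := hR hf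
    have := h1.card_nbrs_le _ h1.end_mem
    unfold endDeg
    omega
  · right
    omega

theorem mul_le_of_small_cycle (hc : CycMap G n c) (hlong : CyclesBounded G Set.univ n)
    (hδ : ∀ v, δ ≤ (nbrs G Set.univ v).card) {h : ℕ} {u : ℤ → V} (hu : CycMap G h u)
    (huK : Set.range u ⊆ (Set.range c)ᶜ) (hK : CyclesBounded G (Set.range c)ᶜ h) :
    (h + 1) * δ ≤ n + (h + 1) * (h - 1) := by
  classical
  set K := (Set.range c)ᶜ with hKdef
  set H : Finset V := (Set.range u).toFinset with hHdef
  have hH : (H : Set V) = Set.range u := by simp [hHdef]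
  obtain ⟨e, z, hE⟩ := exists_isOptTails (G := G) K H ∅ h (by rw [hH]; exact huK)
  have hex := fun x (hx : x ∈ H) h1 h2 => hE.exists_cluster hu hH hK (x := x) hx h1 h2
  choose! R hR using hex
  have h3 := hu.three_le
  obtain ⟨F, hFK, hFc, hF, hsum, -, -⟩ := hE.exists_wellLinked hu hH hK (R := R) (r := h - 1)
    (fun x hx => by
      rw [mem_heavy] at hx
      exact hR x hx.1 hx.2.1 hx.2.2.1)
    (fun x hx => by
      rw [mem_heavy] at hx
      have := (hR x hx.1 hx.2.1 hx.2.2.1).card_lt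
      omega)
  rw [← hFc]
  have hHcard : H.card = h := by
    rw [← hu.ncard_range, ← hH, Set.ncard_coe_finset]
  refine hF.mul_le hc hlong hδ hFK (by rw [← Finset.card_pos]; omega) (hsum.trans ?_)
  have hload : ∀ x ∈ H \ swept G K H h e z, load G K H e z x ≤ h - 1 := by
    intro x hx
    obtain ⟨hxH, hxs⟩ := Finset.mem_sdiff.1 hx
    by_cases hex : e x = 0
    · unfold load
      rw [if_pos hex]
      have : nbrs G H x ⊆ H.erase x := by
        intro y hy
        rw [mem_nbrs] at hy
        exact Finset.mem_erase.2 ⟨hy.2.ne', hy.1⟩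
      have := Finset.card_le_card this
      rwa [Finset.card_erase_of_mem hxH, hHcard] at this
    · have := hE.load_le hu hH hK (R := R x) (r := h - 1) hxH hxs (by omega) (fun hf => by
        have := hR x hxH (by omega) hf
        have := this.card_lt
        exact ⟨hR x hxH (by omega) hf, by omega⟩)
      omega
  have h1 : ∑ x ∈ H \ swept G K H h e z, load G K H e z x ≤ _ :=
    Finset.sum_le_card_nsmul _ _ _ hload
  rw [smul_eq_mul] at h1
  have h2 := Finset.card_sdiff_add_card_eq_card (swept_subset (G := G) (K := K) (H := H) (h := h)
    (e := e) (z := z))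
  rw [hHcard] at h2
  rw [hFc]
  calc _ ≤ (H \ swept G K H h e z).card * (h - 1) + (h - 1) * (swept G K H h e z).card := by omega
    _ = ((H \ swept G K H h e z).card + (swept G K H h e z).card) * (h - 1) := by ring
    _ = h * (h - 1) := by rw [h2]

theorem two_mul_le_of_no_edges (hc : CycMap G n c) (hlong : CyclesBounded G Set.univ n)
    (hδ : ∀ v, δ ≤ (nbrs G Set.univ v).card) {a : V} (ha : a ∉ Set.range c)
    (hK : ∀ a ∈ (Set.range c)ᶜ, ∀ b ∈ (Set.range c)ᶜ, ¬ G.Adj a b) : 2 * δ ≤ n := by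
  classical
  have hF : WellLinked G (Set.range c)ᶜ {a} := by
    intro v hv k
    rw [Finset.mem_singleton] at hv
    subst hv
    rw [Finset.filter_singleton, if_neg (by simp)]
    simp
  have := hF.mul_le hc hlong hδ (by simpa using ha) ⟨a, by simp⟩ (by
    simp only [Finset.sum_singleton, Finset.card_singleton]
    simp only [Nat.sub_self, mul_zero, Nat.le_zero, Finset.card_eq_zero]
    rw [Finset.eq_empty_iff_forall_notMem]
    intro x hx
    rw [mem_nbrs] at hx
    exact hK a ha x hx.1 hx.2)
  simpa using this

theorem three_mul_le_of_acyclic (hc : CycMap G n c) (hlong : CyclesBounded G Set.univ n)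
    (hδ : ∀ v, δ ≤ (nbrs G Set.univ v).card) (hK : CyclesBounded G (Set.range c)ᶜ 2) {a b : V}
    (ha : a ∉ Set.range c) (hb : b ∉ Set.range c) (hab : G.Adj a b) : 3 * δ ≤ n + 3 := by
  classical
  set K := (Set.range c)ᶜ with hKdef
  let S : Set ℕ := {k | ∃ a b, LinkedBy G K a b k}
  have h1S : 1 ∈ S := ⟨a, b, Walk.cons hab Walk.nil, by simpa using hab.ne, by
    simp [hKdef]; tauto, by simp⟩
  have hbdd : BddAbove S := by
    refine ⟨Fintype.card V, ?_⟩
    rintro k ⟨a, b, p, hp, -, hl⟩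
    exact hl.trans hp.length_lt.le
  obtain ⟨a, b, hmax⟩ := Nat.sSup_mem ⟨1, h1S⟩ hbdd
  set ℓ := sSup S with hℓ
  have hℓ1 : 1 ≤ ℓ := le_csSup hbdd h1S
  have key : ∀ a b, LinkedBy G K a b ℓ → (nbrs G K a).card ≤ 1 := by
    rintro a b ⟨p, hp, hs, hl⟩
    have : nbrs G K a ⊆ {p.getVert 1} := by
      intro x hx
      rw [mem_nbrs] at hx
      rw [Finset.mem_singleton]
      by_cases hxp : x ∈ p.support
      · by_contra hne
        have hp' := hp.takeUntil hxp
        have hlen : 2 ≤ (p.takeUntil x hxp).length := by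
          have hg := Walk.getVert_length_takeUntil hxp
          by_contra hcon
          have h0 : (p.takeUntil x hxp).length ≠ 1 := fun h1 => by
            rw [h1] at hg; exact hne hg.symm
          have h0 : (p.takeUntil x hxp).length = 0 := by omega
          rw [h0, Walk.getVert_zero] at hg
          exact hx.2.ne hg
        have := hK.linked (S := K)
          ⟨_, hp', fun y hy => hs y (p.support_takeUntil_subset_support hxp hy), le_rfl⟩
          le_rfl hlen hx.2.symm
        omega
      · have h2 : LinkedBy G {v | v ∈ p.support} a b ℓ := ⟨p, hp, fun _ h => h, hl⟩
        have h3 := (h2.cons hx.2.symm hxp).mono (T := K) (m := ℓ + 1) (by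
          intro y hy
          rcases hy with rfl | hy
          · exact hx.1
          · exact hs y hy) le_rfl
        have : ℓ + 1 ≤ ℓ := le_csSup hbdd ⟨_, _, h3⟩
        omega
    simpa using Finset.card_le_card this
  have hab : a ≠ b := by
    obtain ⟨p, hp, hs, hl⟩ := hmax
    rintro rfl
    have := Walk.length_eq_zero_iff.2 (Walk.isPath_iff_nil.1 hp)
    omega
  have hF : WellLinked G K {a, b} := by
    intro v hv k
    rcases Nat.eq_zero_or_pos k with rfl | hk
    · rw [Nat.le_zero, Finset.card_eq_zero, Finset.filter_eq_empty_iff]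
      rintro v' hv' ⟨h1, h2⟩
      apply h2
      simp only [Finset.mem_insert, Finset.mem_singleton] at hv hv'
      rcases hv with rfl | rfl <;> rcases hv' with rfl | rfl
      · exact absurd rfl h1
      · exact hmax.mono le_rfl (by omega)
      · exact hmax.symm.mono le_rfl (by omega)
      · exact absurd rfl h1
    · have h1 : ({a, b} : Finset V).filter (fun v' => v' ≠ v ∧ ¬ LinkedBy G K v v' (k + 1)) ⊆
          ({a, b} : Finset V).erase v := fun v' hv' => by
        rw [Finset.mem_filter] at hv'
        exact Finset.mem_erase.2 ⟨hv'.2.1, hv'.1⟩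
      have h2 := Finset.card_le_card h1
      rw [Finset.card_erase_of_mem hv, Finset.card_pair hab] at h2
      omega
  have := hF.mul_le hc hlong hδ (by
    simp only [Finset.mem_insert, Finset.mem_singleton]
    rintro v (rfl | rfl)
    · exact hmax.left_mem
    · exact hmax.right_mem) ⟨a, by simp⟩ (by
    rw [Finset.sum_pair hab, Finset.card_pair hab]
    rw [← hKdef]
    have := key a b hmax
    have := key b a hmax.symm
    omega)
  rw [Finset.card_pair hab] at this
  omega

end

end

section


variable {V : Type*} [Fintype V] {G : SimpleGraph V}

section

variable {h : ℕ} {u : ℤ → V}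

/-- A version of `CycMap.corner` for arbitrary positions on the cycle. -/
theorem CycMap.linked_of_next (hu : CycMap G h u) {k l i j : ℤ} (hne : u k ≠ u l) (hi : 1 ≤ i)
    (hj : 1 ≤ j)
    (hdeg : h + 1 ≤ (nbrs G (Set.range u) (u (k + i))).card +
      (nbrs G (Set.range u) (u (l + j))).card) {p : ℕ} (hp : i + j + p ≤ h + 1) :
    LinkedBy G (Set.range u) (u k) (u l) p := by
  have h3 := hu.three_le
  obtain ⟨t, α, hα0, hαh, hlk⟩ : ∃ t α : ℤ, 0 ≤ α ∧ α < h ∧ l = k + α + t * h :=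
    ⟨(l - k) / h, (l - k) % h, Int.emod_nonneg _ (by omega), Int.emod_lt_of_pos _ (by omega), by
      have := Int.emod_add_mul_ediv (l - k) h
      rw [mul_comm] at this
      omega⟩
  subst hlk
  rw [show k + α + t * h + j = k + α + j + t * h by ring, hu.periodic_mul] at hdeg
  rw [hu.periodic_mul] at hne ⊢
  have hα : 0 < α := by
    rcases hα0.eq_or_lt with h | h
    · exact absurd (by rw [← h, add_zero]) hne
    · exact h
  by_cases h1 : α ≤ i
  · exact hu.arc_linked' (by omega) (by omega) (by omega)
  by_cases h2 : h ≤ α + j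
  · exact hu.arc_linked (by omega) (by omega) (by omega)
  have hs := hu.shift k
  have := hs.corner (i := i) (j := j) (α := α) (by omega) (by omega) hj (by omega) (by
    rw [CycMap.shift_range, add_comm i, show α + j + k = k + α + j by ring]
    exact hdeg)
  rw [CycMap.shift_range, zero_add, add_comm α] at this
  exact this.mono le_rfl (by omega)

open Classical in
theorem CycMap.exists_avoiding_set (hu : CycMap G h u) {A : Set V} {m g : ℕ} (hmg : h = m + g)
    (hA : ∀ x ∈ A, m ≤ (nbrs G (Set.range u) x).card + 1) (hm : h + 6 ≤ 2 * m) {α : ℤ}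
    (hα : 0 < α) (hαh : α < h) (hfail : ¬ LinkedBy G (Set.range u) (u 0) (u α) (m - 2))
    (hAne : ∃ i, u i ∈ A) :
    ∃ T : Finset V, T.card = g + 1 ∧
      (∀ x ∈ T, x ∈ Set.range u ∧ x ∉ A ∧ ∃ k r : ℤ, u k = x ∧ 1 ≤ r ∧ r ≤ g + 1 ∧ u (k + r) ∈ A) ∧
      ∀ x ∈ T, ∀ y ∈ T, x ≠ y → LinkedBy G (Set.range u) x y (m - 2) := by
  have hα1 : α + 3 ≤ m := by
    by_contra hcon
    exact hfail (hu.arc_linked (by omega) (by omega) (by omega))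
  have hα2 : h - α + 3 ≤ m := by
    by_contra hcon
    exact hfail (hu.arc_linked' (by omega) (by omega) (by omega))
  have next : ∀ s : ℤ, ∃ i : ℕ, 1 ≤ i ∧ u (s + i) ∈ A ∧ ∀ j : ℤ, 1 ≤ j → j < i → u (s + j) ∉ A := by
    intro s
    have hex : ∃ i : ℕ, 1 ≤ i ∧ u (s + i) ∈ A := by
      obtain ⟨i, hi⟩ := hAne
      obtain ⟨k, k1, k2, hk⟩ := hu.exists_window (s + 1) i
      refine ⟨(k - s).toNat, by omega, ?_⟩
      rw [show s + ((k - s).toNat : ℤ) = k by omega, hk]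
      exact hi
    refine ⟨Nat.find hex, (Nat.find_spec hex).1, (Nat.find_spec hex).2, ?_⟩
    intro j hj1 hj2 hj3
    exact Nat.find_min hex (m := j.toNat) (by omega) ⟨by omega, by
      rwa [show (j.toNat : ℤ) = j by omega]⟩
  obtain ⟨i0, i1, iA, imin⟩ := next 0
  obtain ⟨j0, j1, jA, jmin⟩ := next α
  have hdeg : ∀ x ∈ A, ∀ y ∈ A, h + 1 ≤ (nbrs G (Set.range u) x).card +
      (nbrs G (Set.range u) y).card := by
    intro x hx y hy
    have := hA x hx
    have := hA y hy
    omega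
  have hsum : g + 4 ≤ i0 + j0 := by
    by_contra hcon
    exact hfail (hu.linked_of_next (hu.ne hα (by omega)) (i := i0) (j := j0) (by omega) (by omega)
      (hdeg _ iA _ jA) (by omega))
  obtain ⟨a, b, hab, ha, hb, hcase⟩ : ∃ a b : ℕ, a + b = g + 1 ∧ a + 1 ≤ i0 ∧ b + 1 ≤ j0 ∧
      (a = 0 ∨ b = 0 ∨ (i0 ≤ g + 1 ∧ j0 ≤ g + 1)) := by
    by_cases h1 : g + 2 ≤ i0
    · exact ⟨g + 1, 0, by omega, by omega, by omega, by omega⟩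
    by_cases h2 : g + 2 ≤ j0
    · exact ⟨0, g + 1, by omega, by omega, by omega, by omega⟩
    exact ⟨i0 - 1, g + 2 - i0, by omega, by omega, by omega, by omega⟩
  let X₁ : Finset ℤ := Finset.Ico (i0 - a) i0
  let X₂ : Finset ℤ := Finset.Ico (α + j0 - b) (α + j0)
  have hinj : Set.InjOn u ((X₁ ∪ X₂ : Finset ℤ) : Set ℤ) := by
    intro i hi j hj heq
    simp only [X₁, X₂, Finset.coe_union, Finset.coe_Ico, Set.mem_union, Set.mem_Ico] at hi hj
    rcases le_total i j with hij | hij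
    · exact hu.inj i j hij (by omega) heq
    · exact (hu.inj j i hij (by omega) heq.symm).symm
  have hdisj : Disjoint X₁ X₂ := by
    rw [Finset.disjoint_left]
    intro i hi hj
    simp only [X₁, X₂, Finset.mem_Ico] at hi hj
    omega
  refine ⟨(X₁ ∪ X₂).image u, ?_, ?_, ?_⟩
  · rw [Finset.card_image_of_injOn hinj, Finset.card_union_of_disjoint hdisj, Int.card_Ico,
      Int.card_Ico]
    omega
  · intro x hx
    obtain ⟨k, hk, rfl⟩ := Finset.mem_image.1 hx
    refine ⟨⟨k, rfl⟩, ?_⟩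
    rw [Finset.mem_union, Finset.mem_Ico, Finset.mem_Ico] at hk
    rcases hk with hk | hk
    · refine ⟨?_, k, i0 - k, rfl, by omega, by omega, ?_⟩
      · have := imin k (by omega) (by omega)
        rwa [zero_add] at this
      · rw [show k + (i0 - k) = 0 + (i0 : ℤ) by ring]; exact iA
    · refine ⟨?_, k, α + j0 - k, rfl, by omega, by omega, ?_⟩
      · have := jmin (k - α) (by omega) (by omega)
        rwa [add_sub_cancel] at this
      · rw [show k + (α + j0 - k) = α + (j0 : ℤ) by ring]; exact jA
  · have close : ∀ k l : ℤ, k < l → l ≤ k + g → LinkedBy G (Set.range u) (u k) (u l) (m - 2) :=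
      fun k l h1 h2 => hu.arc_linked' h1 (by omega) (by omega)
    have cross : ∀ k ∈ X₁, ∀ l ∈ X₂, u k ≠ u l → LinkedBy G (Set.range u) (u k) (u l) (m - 2) := by
      intro k hk l hl hne
      rw [Finset.mem_Ico] at hk hl
      refine hu.linked_of_next hne (i := i0 - k) (j := α + j0 - l) (by omega) (by omega)
        (hdeg _ ?_ _ ?_) (by omega)
      · rw [show k + (i0 - k) = 0 + (i0 : ℤ) by ring]; exact iA
      · rw [show l + (α + j0 - l) = α + (j0 : ℤ) by ring]; exact jA
    have same : ∀ k l s : ℤ, ∀ t : ℕ, t ≤ g + 1 → k ∈ Finset.Ico (s - t) s →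
        l ∈ Finset.Ico (s - t) s → u k ≠ u l →
        LinkedBy G (Set.range u) (u k) (u l) (m - 2) := by
      intro k l s t ht hk hl hne
      rw [Finset.mem_Ico] at hk hl
      rcases lt_trichotomy k l with h | h | h
      · exact close k l h (by omega)
      · exact absurd (by rw [h]) hne
      · exact (close l k h (by omega)).symm
    intro x hx y hy hxy
    obtain ⟨k, hk, rfl⟩ := Finset.mem_image.1 hx
    obtain ⟨l, hl, rfl⟩ := Finset.mem_image.1 hy
    rw [Finset.mem_union] at hk hl
    rcases hk with hk | hk <;> rcases hl with hl | hl
    · exact same k l _ a (by omega) hk hl hxy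
    · exact cross k hk l hl hxy
    · exact (cross l hl k hk hxy.symm).symm
    · exact same k l _ b (by omega) hk hl hxy

/-- If the first proper vertex of the tail of `x` has many neighbours on the cycle, then the end of
the tail has long paths to all vertices of the cycle. -/
theorem IsTails.end_linked {K : Set V} {H : Finset V} {e : V → ℕ} {z : V → ℕ → V}
    (hE : IsTails G K H e z) (hu : CycMap G h u) (hH : (H : Set V) = Set.range u)
    (hK : CyclesBounded G K h) {x : V} (hx : x ∈ H) (hex : 1 ≤ e x) {m : ℕ} (hm : h + 6 ≤ 2 * m)
    (htw : 2 * m ≤ 2 * (twigs G H e z x).card + h + 2) {q : V} (hq : q ∈ H) :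
    LinkedBy G (Set.range u ∪ z x '' Set.Icc 1 (e x)) (z x (e x)) q (m - 2) := by
  classical
  by_contra hcon
  have hqu : q ∈ Set.range u := by rw [← hH]; exact hq
  obtain ⟨k, k1, k2, rfl⟩ := hu.exists_window_of_mem hqu 0
  set w := z x 1 with hw
  have hwu : w ∉ Set.range u := by
    rw [← hH]; exact hE.notMem hx hex le_rfl
  have hdis : Disjoint (z x '' Set.Icc 1 (e x)) (Set.range u) := by
    rw [Set.disjoint_left]
    rintro _ ⟨j, hj, rfl⟩ hju
    rw [← hH] at hju
    exact hE.notMem hx hj.2 hj.1 hju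
  have hfar : ∀ d : ℤ, 1 ≤ d → d < h → G.Adj w (u (k + d)) → h + 4 ≤ m + d ∧ d + 4 ≤ m := by
    intro d d1 d2 hadj
    have hseg := (hE.seg hx hex le_rfl).symm
    constructor
    · by_contra hc
      have h1 := hu.arc_linked' (i := k) (j := k + d) (by omega) (by omega) (k := m - 3) (by omega)
      exact hcon ((hseg.join hadj h1.symm hdis).mono (Set.union_comm _ _).le (by omega))
    · by_contra hc
      have h1 := hu.arc_linked (i := k) (j := k + d) (by omega) (by omega) (k := m - 3) (by omega)
      exact hcon ((hseg.join hadj h1.symm hdis).mono (Set.union_comm _ _).le (by omega))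
  set X := (Finset.Ico (1 : ℤ) h).filter fun d => u (k + d) ∈ twigs G H e z x with hX
  have hXm : ∀ d ∈ X, h + 4 ≤ m + d ∧ d + 4 ≤ m := by
    intro d hd
    rw [hX, Finset.mem_filter, Finset.mem_Ico] at hd
    exact hfar d hd.1.1 hd.1.2 (mem_twigs.1 hd.2).2.2
  have hwK : ({w} : Set V) ⊆ K := by simpa using hE.mem x hx 1 hex
  have hgap : ∀ d ∈ X, d + 1 ∉ X := by
    intro d hd hd'
    rw [hX, Finset.mem_filter, Finset.mem_Ico] at hd hd'
    have := hu.chord_gap hK (hE.range_subset hH) hwK (by simpa using hwu)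
      (LinkedBy.single (G := G) (Set.mem_singleton w)) (i := k + d) (k := k + (d + 1)) (by omega)
      (by have := hu.three_le; omega) (mem_twigs.1 hd.2).2.2 (mem_twigs.1 hd'.2).2.2
    push_cast at this
    omega
  have h1 : 2 * X.card ≤ ((m : ℤ) - 2 - (h + 4 - m)).toNat := by
    have hsub : X ∪ X.image (fun d => d + 1) ⊆ Finset.Ico ((h : ℤ) + 4 - m) (m - 2) := by
      intro d hd
      rw [Finset.mem_Ico]
      rcases Finset.mem_union.1 hd with hd | hd
      · have := hXm d hd; omega
      · obtain ⟨d', hd', rfl⟩ := Finset.mem_image.1 hd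
        have := hXm d' hd'; omega
    have hd : Disjoint X (X.image fun d => d + 1) := by
      rw [Finset.disjoint_left]
      intro d hd hd2
      obtain ⟨d', hd', rfl⟩ := Finset.mem_image.1 hd2
      exact hgap d' hd' hd
    have := Finset.card_le_card hsub
    rw [Finset.card_union_of_disjoint hd, Finset.card_image_of_injective _ (add_left_injective 1),
      Int.card_Ico] at this
    omega
  have h2 : (twigs G H e z x).card ≤ X.card + 1 := by
    have hsub : twigs G H e z x ⊆ insert (u k) (X.image fun d => u (k + d)) := by
      intro y hy
      have hyu : y ∈ Set.range u := by rw [← hH]; exact (mem_twigs.1 hy).1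
      obtain ⟨j, j1, j2, rfl⟩ := hu.exists_window_of_mem hyu k
      rcases j1.eq_or_lt with rfl | hlt
      · exact Finset.mem_insert_self _ _
      · refine Finset.mem_insert_of_mem (Finset.mem_image.2 ⟨j - k, ?_, by simp⟩)
        rw [hX, Finset.mem_filter, Finset.mem_Ico, add_sub_cancel]
        exact ⟨⟨by omega, by omega⟩, hy⟩
    have := Finset.card_le_card hsub
    have := Finset.card_insert_le (u k) (X.image fun d => u (k + d))
    have : (X.image fun d => u (k + d)).card ≤ X.card := Finset.card_image_le
    omega
  omega

end

end

section


variable {V : Type*} [Fintype V] {G : SimpleGraph V}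

open Classical in
theorem exists_injOn_of_hall {B : Finset V} {t : V → Finset V}
    (h : ∀ S ⊆ B, S.card ≤ (S.biUnion t).card) :
    ∃ f : V → V, Set.InjOn f B ∧ ∀ b ∈ B, f b ∈ t b := by
  obtain ⟨f, hf, hft⟩ := (Finset.all_card_le_biUnion_card_iff_exists_injective
    (fun b : B => t b)).1 (fun S => by
      have := h (S.map (Function.Embedding.subtype _)) (by
        intro x hx
        obtain ⟨y, -, rfl⟩ := Finset.mem_map.1 hx
        exact y.2)
      rw [Finset.card_map] at this
      refine this.trans (Finset.card_le_card ?_)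
      intro x hx
      obtain ⟨y, hy, hxy⟩ := Finset.mem_biUnion.1 hx
      obtain ⟨y, hy', rfl⟩ := Finset.mem_map.1 hy
      exact Finset.mem_biUnion.2 ⟨y, hy', hxy⟩)
  refine ⟨fun b => if hb : b ∈ B then f ⟨b, hb⟩ else b, ?_, ?_⟩
  · intro a ha b hb hab
    rw [Finset.mem_coe] at ha hb
    simp only [dif_pos ha, dif_pos hb] at hab
    exact congrArg Subtype.val (hf hab)
  · intro b hb
    simp only [dif_pos hb]
    exact hft ⟨b, hb⟩

open Classical in
/-- The tail starts adjacent to `b`. -/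
noncomputable def hosts (G : SimpleGraph V) (H : Finset V) (e : V → ℕ) (z : V → ℕ → V) (b : V) :
    Finset V :=
  H.filter fun y => 1 ≤ e y ∧ G.Adj b (z y 1)

theorem mem_hosts {H : Finset V} {e : V → ℕ} {z : V → ℕ → V} {b y : V} :
    y ∈ hosts G H e z b ↔ y ∈ H ∧ 1 ≤ e y ∧ G.Adj b (z y 1) := by
  simp [hosts]

theorem IsMaxTails.le_card_add_hosts {K : Set V} {H : Finset V} {A : Set V} {e : V → ℕ}
    {z : V → ℕ → V} (hE : IsMaxTails G K H A e z) {δ : ℕ}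
    (hδ : ∀ v, δ ≤ (nbrs G Set.univ v).card) {b : V} (hb : b ∈ H) (heb : e b = 0) :
    δ ≤ (nbrs G Kᶜ b).card + (nbrs G H b).card + (hosts G H e z b).card := by
  classical
  have h1 := le_card_nbrs_add hδ K b
  have h2 : nbrs G K b ⊆ nbrs G H b ∪ (hosts G H e z b).image fun y => z y 1 := by
    intro v hv
    rw [mem_nbrs] at hv
    obtain ⟨y, hy, k, hk, rfl⟩ := hE.exists_eq_of_adj hb hv.1 (by
      rw [heb, hE.zero b hb]; exact hv.2)
    rcases Nat.eq_zero_or_pos k with rfl | hk1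
    · refine Finset.mem_union_left _ (mem_nbrs.2 ⟨?_, hv.2⟩)
      rw [hE.zero y hy]; exact hy
    · obtain ⟨rfl, -⟩ := hE.adj_depth hb hy heb hk1 hk hv.2
      exact Finset.mem_union_right _ (Finset.mem_image.2 ⟨y, mem_hosts.2 ⟨hy, hk, hv.2⟩, rfl⟩)
  have h3 := (Finset.card_le_card h2).trans (Finset.card_union_le _ _)
  have h4 : ((hosts G H e z b).image fun y => z y 1).card ≤ (hosts G H e z b).card :=
    Finset.card_image_le
  omega

section

variable {n h m g l δ : ℕ} {c u : ℤ → V} {H : Finset V} {A : Set V} {e : V → ℕ}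
  {z : V → ℕ → V} {B T : Finset V}

open Classical in
/-- Each vertex of `B` can be assigned a private way out, towards the cycle `c` or along a tail. -/
theorem IsMaxTails.exists_exits (hE : IsMaxTails G (Set.range c)ᶜ H A e z)
    (hδ : ∀ v, δ ≤ (nbrs G Set.univ v).card) (hδm : δ + 2 = l + m) (hHm : H.card = m + g)
    (hA : ∀ x ∈ H, x ∉ A → (nbrs G H x).card + 2 ≤ m) (hBH : B ⊆ H) (hBl : B.card = l)
    (hTA : ∀ x ∈ T, x ∉ A)
    (hhard : ∀ b ∈ B, e b = 0 → b ∈ A → (B \ T).card + (g + 1) ≤ l) :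
    ∃ φ : V → V, Set.InjOn φ B ∧ ∀ b ∈ B, (1 ≤ e b → φ b = b) ∧
      (e b = 0 → (φ b ∈ Set.range c ∧ G.Adj b (φ b)) ∨
        (φ b ∈ H ∧ 1 ≤ e (φ b) ∧ G.Adj b (z (φ b) 1))) := by
  have hHc : ∀ x ∈ H, x ∉ Set.range c := fun x hx => by
    have := hE.mem x hx 0 (Nat.zero_le _)
    rwa [hE.zero x hx] at this
  let O : V → Finset V := fun b =>
    if e b = 0 then nbrs G (Set.range c) b ∪ hosts G H e z b else {b}
  have hO : ∀ b ∈ B, e b = 0 → δ ≤ (O b).card + (nbrs G H b).card := by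
    intro b hb heb
    have h1 := hE.le_card_add_hosts hδ (hBH hb) heb
    rw [compl_compl] at h1
    have h2 : (O b).card = (nbrs G (Set.range c) b).card + (hosts G H e z b).card := by
      simp only [O, if_pos heb]
      refine Finset.card_union_of_disjoint (Finset.disjoint_left.2 fun x hx hx' => ?_)
      exact hHc x (mem_hosts.1 hx').1 (mem_nbrs.1 hx).1
    omega
  obtain ⟨φ, hφ, hφO⟩ := exists_injOn_of_hall (B := B) (t := O) (by
    intro S hS
    have hSl : S.card ≤ l := hBl ▸ Finset.card_le_card hS
    by_cases heasy : ∃ b ∈ S, e b = 0 ∧ b ∉ A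
    · obtain ⟨b, hb, heb, hbA⟩ := heasy
      have h1 := hO b (hS hb) heb
      have h2 := hA b (hBH (hS hb)) hbA
      have h3 := Finset.card_le_card (Finset.subset_biUnion_of_mem O hb)
      omega
    push Not at heasy
    have hself : ∀ x ∈ S, e x ≠ 0 → x ∈ S.biUnion O := by
      intro x hx hex
      exact Finset.mem_biUnion.2 ⟨x, hx, by simp [O, hex]⟩
    by_cases hhd : ∃ b ∈ S, e b = 0
    · obtain ⟨b, hb, heb⟩ := hhd
      have hbA := heasy b hb heb
      have h1 := hO b (hS hb) heb
      have h2 := hhard b (hS hb) heb hbA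
      have h3 : (nbrs G H b).card + 1 ≤ H.card := by
        have : nbrs G H b ⊆ H.erase b := by
          intro x hx
          rw [mem_nbrs] at hx
          exact Finset.mem_erase.2 ⟨hx.2.ne', hx.1⟩
        have := Finset.card_le_card this
        rw [Finset.card_erase_of_mem (hBH (hS hb))] at this
        have := Finset.card_pos.2 ⟨b, hBH (hS hb)⟩
        omega
      have hST : ∀ x ∈ S ∩ T, e x ≠ 0 := by
        intro x hx hex
        exact hTA x (Finset.mem_inter.1 hx).2 (heasy x (Finset.mem_inter.1 hx).1 hex)
      have hd : Disjoint (O b) (S ∩ T) := by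
        rw [Finset.disjoint_left]
        intro x hx hxST
        have hxS := (Finset.mem_inter.1 hxST).1
        simp only [O, if_pos heb, Finset.mem_union] at hx
        rcases hx with hx | hx
        · exact hHc x (hBH (hS hxS)) (mem_nbrs.1 hx).1
        · obtain ⟨hxH, hex, hadj⟩ := mem_hosts.1 hx
          exact hTA x (Finset.mem_inter.1 hxST).2
            ((hE.adj_depth (hBH (hS hb)) hxH heb le_rfl hex hadj).2 hbA)
      have h4 : (O b ∪ S ∩ T).card ≤ (S.biUnion O).card := Finset.card_le_card
        (Finset.union_subset (Finset.subset_biUnion_of_mem O hb) fun x hx =>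
          hself x (Finset.mem_inter.1 hx).1 (hST x hx))
      rw [Finset.card_union_of_disjoint hd] at h4
      have h5 := Finset.card_inter_add_card_sdiff S T
      have h6 := Finset.card_le_card (Finset.sdiff_subset_sdiff hS (subset_refl T))
      omega
    · push Not at hhd
      exact Finset.card_le_card fun x hx => hself x hx (hhd x hx))
  refine ⟨φ, hφ, fun b hb => ⟨fun heb => ?_, fun heb => ?_⟩⟩
  · have := hφO b hb
    simpa only [O, if_neg (by omega : ¬ e b = 0), Finset.mem_singleton] using this
  · have := hφO b hb
    simp only [O, if_pos heb, Finset.mem_union, mem_nbrs, mem_hosts] at this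
    exact this

open Classical in
theorem IsMaxTails.mul_le_of_linked (hE : IsMaxTails G (Set.range c)ᶜ H A e z)
    (hc : CycMap G n c) (hlong : CyclesBounded G Set.univ n)
    (hH : (H : Set V) = Set.range u) (huK : Set.range u ⊆ (Set.range c)ᶜ)
    (hδ : ∀ v, δ ≤ (nbrs G Set.univ v).card) (hδm : δ + 2 = l + m) (hl : 2 ≤ l) (hm : 2 ≤ m)
    (hHm : H.card = m + g)
    (hA : ∀ x ∈ H, x ∉ A → (nbrs G H x).card + 2 ≤ m) (hBH : B ⊆ H) (hBl : B.card = l)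
    (hTA : ∀ x ∈ T, x ∉ A)
    (hhard : ∀ b ∈ B, e b = 0 → b ∈ A → (B \ T).card + (g + 1) ≤ l)
    (hends : ∀ x ∈ H, 1 ≤ e x → endDeg G (Set.range c)ᶜ e z x + 2 ≤ m)
    (N : Finset V) (hN : ∀ x ∈ B, x ∈ N → 1 ≤ e x ∧ ∀ q ∈ H, q ≠ x →
      LinkedBy G (Set.range u ∪ z x '' Set.Icc 1 (e x)) (z x (e x)) q (m - 2))
    (hlink : ∀ x ∈ B, x ∉ N → ∀ y ∈ B, y ∉ N → x ≠ y → LinkedBy G (Set.range u) x y (m - 2)) :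
    l * m ≤ n := by
  obtain ⟨φ, hφ, hφB⟩ := hE.exists_exits hδ hδm hHm hA hBH hBl hTA hhard
  have hHc : ∀ x ∈ H, x ∉ Set.range c := fun x hx => by
    have := hE.mem x hx 0 (Nat.zero_le _)
    rwa [hE.zero x hx] at this
  have hφ' : ∀ b ∈ B, φ b ∉ Set.range c → φ b ∈ H ∧ 1 ≤ e (φ b) := by
    intro b hb hbc
    rcases Nat.eq_zero_or_pos (e b) with h0 | h1
    · rcases (hφB b hb).2 h0 with h | h
      · exact absurd h.1 hbc
      · exact ⟨h.1, h.2.1⟩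
    · rw [(hφB b hb).1 h1]; exact ⟨hBH hb, h1⟩
  let x : V → V := fun b => if φ b ∈ Set.range c then b else z (φ b) (e (φ b))
  let tl : V → Set V := fun b => if φ b ∈ Set.range c then ∅ else z (φ b) '' Set.Icc 1 (e (φ b))
  obtain ⟨ψ, hψ, hψB⟩ := exists_injOn_of_hall (B := B)
    (t := fun b => if φ b ∈ Set.range c then {φ b} else nbrs G (Set.range c) (x b)) (by
    intro S hS
    have hSl : S.card ≤ l := hBl ▸ Finset.card_le_card hS
    by_cases hb : ∃ b ∈ S, φ b ∉ Set.range c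
    · obtain ⟨b, hb, hbc⟩ := hb
      have h3 := Finset.card_le_card (Finset.subset_biUnion_of_mem
        (fun b => if φ b ∈ Set.range c then {φ b} else nbrs G (Set.range c) (x b)) hb)
      simp only [x, if_neg hbc] at h3
      have h4 := hends _ (hφ' b (hS hb) hbc).1 (hφ' b (hS hb) hbc).2
      have h5 := le_card_nbrs_add hδ (Set.range c) (z (φ b) (e (φ b)))
      unfold endDeg at h4
      simp only [x]
      omega
    · push Not at hb
      rw [← Finset.card_image_of_injOn (hφ.mono hS)]
      refine Finset.card_le_card fun y hy => ?_
      obtain ⟨b, hbS, rfl⟩ := Finset.mem_image.1 hy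
      exact Finset.mem_biUnion.2 ⟨b, hbS, by simp only [if_pos (hb b hbS), Finset.mem_singleton]⟩)
  have hψc : ∀ b ∈ B, ψ b ∈ Set.range c ∧ G.Adj (x b) (ψ b) := by
    intro b hb
    have := hψB b hb
    by_cases hbc : φ b ∈ Set.range c
    · simp only [if_pos hbc, Finset.mem_singleton] at this
      simp only [x, if_pos hbc]
      rw [this]
      refine ⟨hbc, ?_⟩
      rcases Nat.eq_zero_or_pos (e b) with h0 | h1
      · rcases (hφB b hb).2 h0 with h | h
        · exact h.2
        · exact absurd hbc (hHc _ h.1)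
      · rw [(hφB b hb).1 h1] at hbc
        exact absurd hbc (hHc _ (hBH hb))
    · simp only [if_neg hbc, mem_nbrs] at this
      exact this
  have htlu : ∀ b ∈ B, Disjoint (tl b) (Set.range u) := by
    intro b hb
    rw [Set.disjoint_left]
    intro v hv hvu
    simp only [tl] at hv
    split_ifs at hv with hbc
    · exact hv
    · obtain ⟨k, hk, rfl⟩ := hv
      rw [← hH] at hvu
      exact hE.notMem (hφ' b hb hbc).1 hk.2 hk.1 hvu
  have htlK : ∀ b ∈ B, tl b ⊆ (Set.range c)ᶜ := by
    intro b hb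
    simp only [tl]
    split_ifs with hbc
    · exact Set.empty_subset _
    · exact hE.seg_subset (hφ' b hb hbc).1 le_rfl
  have htltl : ∀ a ∈ B, ∀ b ∈ B, a ≠ b → Disjoint (tl a) (tl b) := by
    intro a ha b hb hab
    rw [Set.disjoint_left]
    intro v hva hvb
    simp only [tl] at hva hvb
    split_ifs at hva hvb with hac hbc
    · exact hva
    · exact hva
    · exact hvb
    · obtain ⟨k, hk, rfl⟩ := hva
      obtain ⟨j, hj, hjk⟩ := hvb
      exact hab (hφ ha hb (hE.inj _ (hφ' b hb ‹_›).1 _ (hφ' a ha ‹_›).1 j hj.2 k hk.2 hjk).1.symm)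
  have hroute : ∀ b ∈ B, LinkedBy G (insert b (tl b)) b (x b) 0 := by
    intro b hb
    have hbu : b ∈ Set.range u := by rw [← hH]; exact hBH hb
    by_cases hbc : φ b ∈ Set.range c
    · simp only [x, if_pos hbc]
      exact LinkedBy.single (Set.mem_insert _ _)
    · have hy := hφ' b hb hbc
      have h1 := hE.seg hy.1 hy.2 le_rfl
      have h2 : tl b = z (φ b) '' Set.Icc 1 (e (φ b)) := by simp only [tl, if_neg hbc]
      have h3 : b ∉ tl b := fun h => Set.disjoint_left.1 (htlu b hb) h hbu
      have h4 : G.Adj b (z (φ b) 1) := by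
        rcases Nat.eq_zero_or_pos (e b) with h0 | h1
        · rcases (hφB b hb).2 h0 with h | h
          · exact absurd h.1 hbc
          · exact h.2.2
        · rw [(hφB b hb).1 h1]
          have := hE.adj b (hBH hb) 0 h1
          rwa [hE.zero b (hBH hb)] at this
      simp only [x, if_neg hbc]
      rw [h2] at h3 ⊢
      exact (h1.cons h4 h3).mono le_rfl (Nat.zero_le _)
  have hxN : ∀ b ∈ B, b ∈ N → x b = z b (e b) ∧ tl b = z b '' Set.Icc 1 (e b) := by
    intro b hb hbN
    have h1 := (hφB b hb).1 (hN b hb hbN).1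
    have h2 : b ∉ Set.range c := hHc b (hBH hb)
    simp only [x, tl, h1, if_neg h2, and_self]
  have hNlink : ∀ a ∈ B, a ∈ N → ∀ b ∈ B, a ≠ b →
      LinkedBy G (Set.range c)ᶜ (x a) (x b) (m - 2) := by
    intro a ha haN b hb hab
    have h1 := (hN a ha haN).2 b (hBH hb) hab.symm
    rw [← (hxN a ha haN).1, ← (hxN a ha haN).2] at h1
    have h2 := h1.append (hroute b hb) (by
      rintro v ⟨hv, hv' | hv'⟩
      · exact hv'
      · rcases hv with hv | hv
        · exact absurd hv (Set.disjoint_left.1 (htlu b hb) hv')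
        · exact absurd hv' (Set.disjoint_left.1 (htltl a ha b hb hab) hv))
    have hbK : b ∈ (Set.range c)ᶜ := hHc b (hBH hb)
    exact h2.mono (Set.union_subset (Set.union_subset huK (htlK a ha))
      (Set.insert_subset hbK (htlK b hb))) (by omega)
  have hall : ∀ a ∈ B, ∀ b ∈ B, a ≠ b → LinkedBy G (Set.range c)ᶜ (x a) (x b) (m - 2) := by
    intro a ha b hb hab
    by_cases haN : a ∈ N
    · exact hNlink a ha haN b hb hab
    by_cases hbN : b ∈ N
    · exact (hNlink b hb hbN a ha hab.symm).symm
    have hau : a ∈ Set.range u := by rw [← hH]; exact hBH ha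
    have h1 := (hroute a ha).symm.append (hlink a ha haN b hb hbN hab) (by
      rintro v ⟨hv | hv, hv'⟩
      · exact hv
      · exact absurd hv' (Set.disjoint_left.1 (htlu a ha) hv))
    have h2 := h1.append (hroute b hb) (by
      rintro v ⟨hv, hv' | hv'⟩
      · exact hv'
      · rcases hv with (rfl | hv) | hv
        · exact absurd hau (Set.disjoint_left.1 (htlu b hb) hv')
        · exact absurd hv' (Set.disjoint_left.1 (htltl a ha b hb hab) hv)
        · exact absurd hv (Set.disjoint_left.1 (htlu b hb) hv'))
    have haK : a ∈ (Set.range c)ᶜ := hHc a (hBH ha)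
    have hbK : b ∈ (Set.range c)ᶜ := hHc b (hBH hb)
    exact h2.mono (Set.union_subset (Set.union_subset (Set.insert_subset haK (htlK a ha)) huK)
      (Set.insert_subset hbK (htlK b hb))) (by omega)
  let f := (B.equivFinOfCardEq hBl).symm
  have := card_mul_le_of_feet hc hlong hl (fun i => x (f i)) (fun i => ψ (f i))
    (fun i j hij => f.injective (Subtype.ext (hψ (f i).2 (f j).2 hij)))
    (fun i => (hψc _ (f i).2).1) (fun i => (hψc _ (f i).2).2) (ℓ := m - 2)
    (fun i j hij => hall _ (f i).2 _ (f j).2 fun hh => hij (f.injective (Subtype.ext hh)))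
  rwa [Nat.sub_add_cancel hm] at this

end

end

section


variable {V : Type*} [Fintype V] {G : SimpleGraph V}

section

variable {n h m g l δ r : ℕ} {c u : ℤ → V} {H : Finset V} {K A : Set V} {e : V → ℕ}
  {z : V → ℕ → V}

theorem CycMap.sum_eq (hu : CycMap G h u) (hH : (H : Set V) = Set.range u) (f : V → ℕ) :
    ∑ x ∈ H, f x = ∑ k ∈ Finset.Ico (0 : ℤ) h, f (u k) := by
  classical
  have hinj : Set.InjOn u (Finset.Ico (0 : ℤ) h : Finset ℤ) := by
    intro i hi j hj heq
    rw [Finset.mem_coe, Finset.mem_Ico] at hi hj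
    rcases le_total i j with hij | hij
    · exact hu.inj i j hij (by omega) heq
    · exact (hu.inj j i hij (by omega) heq.symm).symm
  rw [← Finset.sum_image hinj]
  congr 1
  ext x
  rw [← Finset.mem_coe, hH, Finset.mem_image]
  constructor
  · intro hx
    obtain ⟨k, k1, k2, rfl⟩ := hu.exists_window_of_mem hx 0
    exact ⟨k, Finset.mem_Ico.2 ⟨k1, by omega⟩, rfl⟩
  · rintro ⟨k, -, rfl⟩
    exact ⟨k, rfl⟩

open Classical in
/-- The excess of the load of `x` over `r`, for `x` not swept. -/
noncomputable def excess (G : SimpleGraph V) (K : Set V) (H : Finset V) (h : ℕ) (e : V → ℕ)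
    (z : V → ℕ → V) (r : ℕ) (x : V) : ℕ :=
  if x ∈ swept G K H h e z then 0 else load G K H e z x - r

/-- The excess of `u k` or `u (k + 1)`, depending on which of the tails there are trivial. -/
noncomputable def excessAt (G : SimpleGraph V) (K : Set V) (H : Finset V) (h : ℕ) (e : V → ℕ)
    (z : V → ℕ → V) (r : ℕ) (u : ℤ → V) (k : ℤ) : ℕ :=
  (if e (u k) = 0 then 0 else excess G K H h e z r (u k)) +
    (if e (u (k + 1)) = 0 then excess G K H h e z r (u (k + 1)) else 0)

open Classical in
theorem CycMap.sum_load_le (hu : CycMap G h u) (hH : (H : Set V) = Set.range u)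
    (hHc : H.card = h) :
    ∑ x ∈ H \ swept G K H h e z, load G K H e z x + r * (swept G K H h e z).card ≤
      r * h + ∑ k ∈ Finset.Ico (0 : ℤ) h, excessAt G K H h e z r u k := by
  have h1 : ∑ k ∈ Finset.Ico (0 : ℤ) h, excessAt G K H h e z r u k =
      ∑ x ∈ H, excess G K H h e z r x := by
    have e1 := hu.sum_eq hH fun x => if e x = 0 then 0 else excess G K H h e z r x
    have e2 := (hu.shift 1).sum_eq (by rw [CycMap.shift_range, hH])
      fun x => if e x = 0 then excess G K H h e z r x else 0
    simp only [excessAt]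
    rw [Finset.sum_add_distrib, ← e1, ← e2, ← Finset.sum_add_distrib]
    refine Finset.sum_congr rfl fun x _ => ?_
    split_ifs <;> omega
  have h2 : ∑ x ∈ H \ swept G K H h e z, load G K H e z x ≤
      ∑ x ∈ H \ swept G K H h e z, (r + excess G K H h e z r x) := by
    refine Finset.sum_le_sum fun x hx => ?_
    rw [excess, if_neg (Finset.mem_sdiff.1 hx).2]
    omega
  have h3 : ∑ x ∈ H \ swept G K H h e z, excess G K H h e z r x ≤
      ∑ x ∈ H, excess G K H h e z r x :=
    Finset.sum_le_sum_of_subset Finset.sdiff_subset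
  rw [Finset.sum_add_distrib, Finset.sum_const, smul_eq_mul] at h2
  have h4 := Finset.card_sdiff_add_card_eq_card (swept_subset (G := G) (K := K) (H := H) (h := h)
    (e := e) (z := z))
  rw [hHc] at h4
  have h5 : (H \ swept G K H h e z).card * r + r * (swept G K H h e z).card = r * h := by
    rw [mul_comm, ← mul_add, h4]
  omega

/-- Properties of vertices with proper tails and positive excess. -/
theorem IsMaxTails.excess_tail (hE : IsMaxTails G K H A e z) (hu : CycMap G h u)
    (hH : (H : Set V) = Set.range u) (hK : CyclesBounded G K h) {R : V → Finset V} {x : V}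
    (hx : x ∈ H) (hex : 1 ≤ e x)
    (hR : h < 2 * endDeg G K e z x → IsCluster G K h (z x) (e x) (R x) ∧ (R x).card ≤ r)
    (hpos : 0 < excess G K H h e z r x) :
    excess G K H h e z r x = endDeg G K e z x + (twigs G H e z x).card - r ∧
      2 * endDeg G K e z x ≤ h ∧ endDeg G K e z x + (twigs G H e z x).card + 1 ≤ h := by
  have hload : load G K H e z x = endDeg G K e z x + (twigs G H e z x).card := by
    rw [load, if_neg (by omega)]
  have hxs : x ∉ swept G K H h e z := by
    intro hc; rw [excess, if_pos hc] at hpos; omega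
  rw [excess, if_neg hxs] at hpos ⊢
  rcases hE.load_le hu hH hK hx hxs hex hR with h1 | h1 <;> omega

theorem excess_le_of_eq_zero {x : V} (hex : e x = 0) :
    excess G K H h e z r x ≤ (nbrs G H x).card - r := by
  rw [excess, load, if_pos hex]
  split_ifs <;> omega

theorem IsMaxTails.excessAt_le (hE : IsMaxTails G K H A e z) (hu : CycMap G h u)
    (hH : (H : Set V) = Set.range u) (hHc : H.card = h) (hK : CyclesBounded G K h)
    {R : V → Finset V}
    (hR : ∀ x ∈ H, 1 ≤ e x → h < 2 * endDeg G K e z x →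
      IsCluster G K h (z x) (e x) (R x) ∧ (R x).card ≤ r)
    (hends : ∀ x ∈ H, 1 ≤ e x → endDeg G K e z x ≤ r) (k : ℤ) :
    excessAt G K H h e z r u k ≤ h - 1 - r := by
  classical
  have hk : u k ∈ H := by rw [← Finset.mem_coe, hH]; exact ⟨k, rfl⟩
  have hk1 : u (k + 1) ∈ H := by rw [← Finset.mem_coe, hH]; exact ⟨k + 1, rfl⟩
  have hT : e (u (k + 1)) = 0 → excess G K H h e z r (u (k + 1)) ≤ h - 1 - r := by
    intro h0
    have h1 := excess_le_of_eq_zero (G := G) (K := K) (H := H) (h := h) (z := z) (r := r) h0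
    have : nbrs G H (u (k + 1)) ⊆ H.erase (u (k + 1)) := by
      intro x hx
      rw [mem_nbrs] at hx
      exact Finset.mem_erase.2 ⟨hx.2.ne', hx.1⟩
    have := Finset.card_le_card this
    rw [Finset.card_erase_of_mem hk1] at this
    omega
  rw [excessAt]
  split_ifs with h0 h1 h1
  · rw [zero_add]; exact hT h1
  · omega
  · rcases Nat.eq_zero_or_pos (excess G K H h e z r (u k)) with hp | hp
    · rw [hp, zero_add]; exact hT h1
    have h2 := hE.excess_tail hu hH hK hk (by omega) (hR _ hk (by omega)) hp
    have h3 := excess_le_of_eq_zero (G := G) (K := K) (H := H) (h := h) (z := z) (r := r) h1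
    have hadj : G.Adj (z (u k) 1) (u k) := by
      have := (hE.adj _ hk 0 (by omega)).symm
      rwa [hE.zero _ hk] at this
    have h4 := hu.deg_succ_add_le hK (hE.toIsTails.range_subset hH) (hE.mem _ hk 1 (by omega))
      (by rw [← hH]; exact hE.toIsTails.notMem hk (by omega) le_rfl) hadj
    have h5 : insert (u k) (twigs G H e z (u k)) ⊆ nbrs G (Set.range u) (z (u k) 1) := by
      intro y hy
      rw [mem_nbrs, ← hH]
      rcases Finset.mem_insert.1 hy with rfl | hy
      · exact ⟨hk, hadj⟩
      · exact ⟨(mem_twigs.1 hy).1, (mem_twigs.1 hy).2.2⟩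
    have h6 : u k ∉ twigs G H e z (u k) := fun hc => h0 (mem_twigs.1 hc).2.1
    have h7 := Finset.card_le_card h5
    rw [Finset.card_insert_of_notMem h6] at h7
    rw [← hH] at h4 h7
    have h8 := hends _ hk (by omega)
    omega
  · rw [add_zero]
    rcases Nat.eq_zero_or_pos (excess G K H h e z r (u k)) with hp | hp
    · omega
    have h2 := hE.excess_tail hu hH hK hk (by omega) (hR _ hk (by omega)) hp
    omega

open Classical in
/-- The case in which the excess is confined to few places on the cycle. -/
theorem IsOptTails.mul_le_of_few_excess (hE : IsOptTails G (Set.range c)ᶜ H A h e z)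
    (hc : CycMap G n c) (hlong : CyclesBounded G Set.univ n)
    (hδ : ∀ v, δ ≤ (nbrs G Set.univ v).card) (hδm : δ + 2 = l + m) (hm : 2 ≤ m) (hhm : h = m + g)
    (hu : CycMap G h u) (hH : (H : Set V) = Set.range u) (hHc : H.card = h)
    (hK : CyclesBounded G (Set.range c)ᶜ h) {R : V → Finset V}
    (hR : ∀ x ∈ H, 1 ≤ e x → h < 2 * endDeg G (Set.range c)ᶜ e z x →
      IsCluster G (Set.range c)ᶜ h (z x) (e x) (R x) ∧ (R x).card ≤ m - 2)
    (hends : ∀ x ∈ H, 1 ≤ e x → endDeg G (Set.range c)ᶜ e z x ≤ m - 2)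
    (hlow : ∃ x ∈ H, (nbrs G H x).card ≤ m - 2)
    (hfew : ((Finset.Ico (0 : ℤ) h).filter fun k =>
      0 < excessAt G (Set.range c)ᶜ H h e z (m - 2) u k).card ≤ l) : l * m ≤ n := by
  set K := (Set.range c)ᶜ with hKdef
  have hR' : ∀ x ∈ heavy G K H h e z, IsCluster G K h (z x) (e x) (R x) ∧ (R x).card ≤ m - 2 :=
    fun x hx => hR x (mem_heavy.1 hx).1 (mem_heavy.1 hx).2.1 (mem_heavy.1 hx).2.2.1
  obtain ⟨F, hFK, hFc, hF, hsum, hFQ, hFs⟩ := hE.exists_wellLinked hu hH hK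
    (fun x hx => (hR' x hx).1) (fun x hx => (hR' x hx).2)
  have h1 := hu.sum_load_le (K := K) (e := e) (z := z) (r := m - 2) hH hHc
  have h2 : ∑ k ∈ Finset.Ico (0 : ℤ) h, excessAt G K H h e z (m - 2) u k ≤ l * (g + 1) := by
    rw [← Finset.sum_filter_of_ne (p := fun k => 0 < excessAt G K H h e z (m - 2) u k)
      fun k _ hk => Nat.pos_of_ne_zero hk]
    refine (Finset.sum_le_card_nsmul _ _ (g + 1) fun k _ => ?_).trans ?_
    · have := hE.excessAt_le hu hH hHc hK hR hends k
      omega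
    · rw [smul_eq_mul]
      exact Nat.mul_le_mul_right _ hfew
  have h3 : ∃ v ∈ F, (nbrs G K v).card ≤ m - 2 := by
    rcases (swept G K H h e z).eq_empty_or_nonempty with hs | hs
    · rw [hs, Finset.sdiff_empty] at hFQ
      by_cases hex : ∃ x ∈ H, 1 ≤ e x
      · obtain ⟨x, hx, hex⟩ := hex
        exact ⟨_, hFQ x hx, hends x hx hex⟩
      · push Not at hex
        obtain ⟨x, hx, hxd⟩ := hlow
        refine ⟨_, hFQ x hx, (Finset.card_le_card ?_).trans hxd⟩
        intro v hv
        rw [mem_nbrs] at hv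
        obtain ⟨y, hy, k, hk, rfl⟩ := hE.exists_eq_of_adj hx hv.1 hv.2
        have h0 := hex y hy
        have h0x := hex x hx
        rw [show e x = 0 by omega, show k = 0 by omega, hE.zero x hx, hE.zero y hy] at hv
        rw [show k = 0 by omega, hE.zero y hy]
        exact mem_nbrs.2 ⟨hy, hv.2⟩
    · exact hFs hs
  have h4 := hF.mul_add_le hc hlong hδ hFK (T := (m - 2) * h + l * (g + 1)) (s := m - 2)
    (by rw [← hKdef]; omega) h3
  rw [hFc] at h4
  obtain ⟨q, rfl⟩ := Nat.exists_eq_add_of_le hm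
  obtain rfl : δ = l + q := by omega
  rw [Nat.add_sub_cancel_left] at h4
  subst hhm
  nlinarith

open Classical in
/-- The case in which there is excess at many places on the cycle. -/
theorem IsMaxTails.mul_le_of_much_excess
    (hE : IsMaxTails G (Set.range c)ᶜ H {x | m ≤ (nbrs G (Set.range u) x).card + 1} e z)
    (hc : CycMap G n c) (hlong : CyclesBounded G Set.univ n)
    (hδ : ∀ v, δ ≤ (nbrs G Set.univ v).card) (hδm : δ + 2 = l + m) (hl : 2 ≤ l) (hhm : h = m + g)
    (hm : h + 6 ≤ 2 * m)
    (hu : CycMap G h u) (hH : (H : Set V) = Set.range u) (hHc : H.card = h)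
    (hK : CyclesBounded G (Set.range c)ᶜ h) {R : V → Finset V}
    (hR : ∀ x ∈ H, 1 ≤ e x → h < 2 * endDeg G (Set.range c)ᶜ e z x →
      IsCluster G (Set.range c)ᶜ h (z x) (e x) (R x) ∧ (R x).card ≤ m - 2)
    (hends : ∀ x ∈ H, 1 ≤ e x → endDeg G (Set.range c)ᶜ e z x ≤ m - 2) {α : ℤ}
    (hα : 0 < α) (hαh : α < h) (hfail : ¬ LinkedBy G (Set.range u) (u 0) (u α) (m - 2))
    (hmany : l < ((Finset.Ico (0 : ℤ) h).filter fun k =>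
      0 < excessAt G (Set.range c)ᶜ H h e z (m - 2) u k).card) : l * m ≤ n := by
  set K := (Set.range c)ᶜ with hKdef
  set A : Set V := {x | m ≤ (nbrs G (Set.range u) x).card + 1} with hAdef
  have huK : Set.range u ⊆ K := hE.toIsTails.range_subset hH
  have huH : ∀ k, u k ∈ H := fun k => by rw [← Finset.mem_coe, hH]; exact ⟨k, rfl⟩
  have hA : ∀ x ∈ H, x ∉ A → (nbrs G H x).card + 2 ≤ m := by
    intro x hx hxA
    rw [hAdef, Set.mem_ofPred_eq] at hxA
    rw [hH]
    omega
  have hends' : ∀ x ∈ H, 1 ≤ e x → endDeg G K e z x + 2 ≤ m := by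
    intro x hx hex
    have := hends x hx hex
    omega
  set U : Finset V := H.filter fun x => 1 ≤ e x ∧ 0 < excess G K H h e z (m - 2) x with hU
  have hUlink : ∀ x ∈ U, 1 ≤ e x ∧ ∀ q ∈ H, q ≠ x →
      LinkedBy G (Set.range u ∪ z x '' Set.Icc 1 (e x)) (z x (e x)) q (m - 2) := by
    intro x hx
    obtain ⟨hxH, hex, hpos⟩ := Finset.mem_filter.1 hx
    refine ⟨hex, fun q hq _ => ?_⟩
    have h1 := hE.excess_tail hu hH hK hxH hex (hR x hxH hex) hpos
    exact hE.toIsTails.end_linked hu hH hK hxH hex hm (by omega) hq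
  have hHm : H.card = m + g := by omega
  by_cases hUl : l ≤ U.card
  · obtain ⟨B, hBU, hBl⟩ := Finset.exists_subset_card_eq hUl
    refine hE.mul_le_of_linked (T := ∅) (B := B) hc hlong hH huK hδ hδm hl (by omega) hHm hA
      (fun x hx => (Finset.mem_filter.1 (hBU hx)).1) hBl (by simp) ?_ hends' U
      (fun x hx _ => hUlink x (hBU hx)) ?_
    · intro b hb h0
      have := (hUlink b (hBU hb)).1
      omega
    · intro x hx hxU
      exact absurd (hBU hx) hxU
  set M := ((Finset.Ico (0 : ℤ) h).filter fun k => 0 < excessAt G K H h e z (m - 2) u k) with hM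
  have hMinj : Set.InjOn u (M : Set ℤ) := by
    intro i hi j hj heq
    rw [hM, Finset.mem_coe, Finset.mem_filter, Finset.mem_Ico] at hi hj
    rcases le_total i j with hij | hij
    · exact hu.inj i j hij (by omega) heq
    · exact (hu.inj j i hij (by omega) heq.symm).symm
  have hMcard : (M.image u).card = M.card := Finset.card_image_of_injOn hMinj
  have hnext : ∀ k ∈ M, u k ∉ U → u (k + 1) ∈ A := by
    intro k hk hkU
    have hpos := (Finset.mem_filter.1 hk).2
    rw [excessAt] at hpos
    have h0 : (if e (u k) = 0 then 0 else excess G K H h e z (m - 2) (u k)) = 0 := by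
      split_ifs with h0
      · rfl
      · by_contra hne
        exact hkU (Finset.mem_filter.2 ⟨huH k, by omega, by omega⟩)
    rw [h0, zero_add] at hpos
    split_ifs at hpos with h1
    · have := excess_le_of_eq_zero (G := G) (K := K) (H := H) (h := h) (z := z) (r := m - 2) h1
      rw [hAdef, Set.mem_ofPred_eq, ← hH]
      omega
    · omega
  have hAne : ∃ i, u i ∈ A := by
    obtain ⟨x, hx, hxU⟩ := Finset.exists_mem_notMem_of_card_lt_card
      (s := U) (t := M.image u) (by omega)
    obtain ⟨k, hk, rfl⟩ := Finset.mem_image.1 hx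
    exact ⟨k + 1, hnext k hk hxU⟩
  obtain ⟨T, hTc, hT, hTlink⟩ := hu.exists_avoiding_set hhm (A := A) (fun x hx => hx) hm hα hαh
    hfail hAne
  have hTH : T ⊆ H := fun x hx => by rw [← Finset.mem_coe, hH]; exact (hT x hx).1
  have hTA : ∀ x ∈ T, x ∉ A := fun x hx => (hT x hx).2.1
  by_cases hlg : l ≤ g + 1
  · obtain ⟨B, hBT, hBl⟩ := Finset.exists_subset_card_eq (s := T) (n := l) (by omega)
    refine hE.mul_le_of_linked (T := T) (B := B) hc hlong hH huK hδ hδm hl (by omega) hHm hA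
      (hBT.trans hTH) hBl hTA ?_ hends' ∅ (by simp) ?_
    · intro b hb _ hbA
      exact absurd hbA (hTA b (hBT hb))
    · intro x hx _ y hy _ hxy
      exact hTlink x (hBT hx) y (hBT hy) hxy
  obtain ⟨S, hS, hSc⟩ := Finset.exists_subset_card_eq (s := M.image u \ T) (n := l - (g + 1)) (by
    have := Finset.le_card_sdiff T (M.image u)
    omega)
  have hST : Disjoint T S := Finset.disjoint_left.2 fun x hx hxS =>
    (Finset.mem_sdiff.1 (hS hxS)).2 hx
  have hdeg : ∀ x ∈ A, ∀ y ∈ A, h + 1 ≤ (nbrs G (Set.range u) x).card +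
      (nbrs G (Set.range u) y).card := by
    intro x hx y hy
    rw [hAdef, Set.mem_ofPred_eq] at hx hy
    omega
  have hSnext : ∀ x ∈ S, x ∉ U → ∃ k, u k = x ∧ u (k + 1) ∈ A := by
    intro x hx hxU
    obtain ⟨k, hk, rfl⟩ := Finset.mem_image.1 (Finset.mem_sdiff.1 (hS hx)).1
    exact ⟨k, rfl, hnext k hk hxU⟩
  have hSlink : ∀ x ∈ S, x ∉ U → ∀ y ∈ T ∪ S, y ∉ S ∩ U → x ≠ y →
      LinkedBy G (Set.range u) x y (m - 2) := by
    intro x hx hxU y hy hyU hxy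
    obtain ⟨k, rfl, hkA⟩ := hSnext x hx hxU
    rcases Finset.mem_union.1 hy with hy | hy
    · obtain ⟨-, -, j, r, rfl, r1, r2, hjA⟩ := hT y hy
      exact hu.linked_of_next hxy le_rfl r1 (hdeg _ hkA _ hjA) (by omega)
    · obtain ⟨j, rfl, hjA⟩ := hSnext y hy fun hc => hyU (Finset.mem_inter.2 ⟨hy, hc⟩)
      exact hu.linked_of_next hxy le_rfl le_rfl (hdeg _ hkA _ hjA) (by omega)
  refine hE.mul_le_of_linked (T := T) (B := T ∪ S) hc hlong hH huK hδ hδm hl (by omega) hHm hA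
    (Finset.union_subset hTH fun x hx => ?_) ?_ hTA ?_ hends' (S ∩ U)
    (fun x _ hx => hUlink x (Finset.mem_inter.1 hx).2) ?_
  · obtain ⟨k, -, rfl⟩ := Finset.mem_image.1 (Finset.mem_sdiff.1 (hS hx)).1
    exact huH k
  · rw [Finset.card_union_of_disjoint hST]
    omega
  · intro _ _ _ _
    rw [Finset.union_sdiff_cancel_left hST]
    omega
  · intro x hx hxU y hy hyU hxy
    rcases Finset.mem_union.1 hx with hxT | hxS
    · rcases Finset.mem_union.1 hy with hyT | hyS
      · exact hTlink x hxT y hyT hxy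
      · exact (hSlink y hyS (fun hc => hyU (Finset.mem_inter.2 ⟨hyS, hc⟩)) x hx hxU
          hxy.symm).symm
    · exact hSlink x hxS (fun hc => hxU (Finset.mem_inter.2 ⟨hxS, hc⟩)) y hy hyU hxy

open Classical in
theorem mul_le_of_not_linked (hc : CycMap G n c) (hlong : CyclesBounded G Set.univ n)
    (hδ : ∀ v, δ ≤ (nbrs G Set.univ v).card) (hδm : δ + 2 = l + m) (hl : 2 ≤ l) (hlm : l ≤ m)
    (hG : IsKConnected G l) (hln : l ≤ n) (hhm : h = m + g)
    (hu : CycMap G h u) (huK : Set.range u ⊆ (Set.range c)ᶜ)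
    (hK : CyclesBounded G (Set.range c)ᶜ h) {α : ℤ} (hα : 0 < α) (hαh : α < h)
    (hfail : ¬ LinkedBy G (Set.range u) (u 0) (u α) (m - 2)) : l * m ≤ n := by
  have hm : h + 6 ≤ 2 * m := by
    have hα1 : α + 3 ≤ m := by
      by_contra hcon
      exact hfail (hu.arc_linked (by omega) (by omega) (by omega))
    have hα2 : h - α + 3 ≤ m := by
      by_contra hcon
      exact hfail (hu.arc_linked' (by omega) (by omega) (by omega))
    omega
  set K := (Set.range c)ᶜ with hKdef
  set A : Set V := {x | m ≤ (nbrs G (Set.range u) x).card + 1} with hAdef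
  set H : Finset V := Finset.univ.filter fun x => x ∈ Set.range u with hHdef
  have hH : (H : Set V) = Set.range u := by
    ext x; simp [hHdef]
  have hHc : H.card = h := by
    rw [← Set.ncard_coe_finset, hH, hu.ncard_range]
  obtain ⟨e, z, hE⟩ := exists_isOptTails (G := G) K H A h (by rw [hH]; exact huK)
  have hcl : ∀ x, ∃ R, x ∈ H → 1 ≤ e x → h < 2 * endDeg G K e z x →
      IsCluster G K h (z x) (e x) R := by
    intro x
    by_cases hx : x ∈ H ∧ 1 ≤ e x ∧ h < 2 * endDeg G K e z x
    · obtain ⟨R, hR⟩ := hE.exists_cluster hu hH hK hx.1 hx.2.1 hx.2.2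
      exact ⟨R, fun _ _ _ => hR⟩
    · exact ⟨∅, fun h1 h2 h3 => absurd ⟨h1, h2, h3⟩ hx⟩
  choose R hR using hcl
  by_cases hbig : ∃ x ∈ H, 1 ≤ e x ∧ h < 2 * endDeg G K e z x ∧ m ≤ (R x).card + 1
  · obtain ⟨x, hx, hex, hw, hRm⟩ := hbig
    obtain ⟨Z, hZK, hZc, hZ⟩ := (hR x hx hex hw).exists_set
    have := mul_le_of_linked_set hc hlong hG hl hln hZK (by omega) (ℓ := m - 2)
      fun a ha b hb hab => (hZ a ha b hb hab).mono le_rfl (by omega)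
    rwa [Nat.sub_add_cancel (by omega)] at this
  push Not at hbig
  have hR' : ∀ x ∈ H, 1 ≤ e x → h < 2 * endDeg G K e z x →
      IsCluster G K h (z x) (e x) (R x) ∧ (R x).card ≤ m - 2 := by
    intro x hx hex hw
    have := hbig x hx hex hw
    exact ⟨hR x hx hex hw, by omega⟩
  have hends : ∀ x ∈ H, 1 ≤ e x → endDeg G K e z x ≤ m - 2 := by
    intro x hx hex
    by_cases hw : h < 2 * endDeg G K e z x
    · obtain ⟨h1, h2⟩ := hR' x hx hex hw
      exact (h1.card_nbrs_le _ h1.end_mem).trans h2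
    · omega
  have hlow : ∃ x ∈ H, (nbrs G H x).card ≤ m - 2 := by
    by_contra hcon
    push Not at hcon
    have hk : ∀ k, m ≤ (nbrs G (Set.range u) (u k)).card + 1 := by
      intro k
      have := hcon (u k) (by rw [← Finset.mem_coe, hH]; exact ⟨k, rfl⟩)
      rw [hH] at this
      omega
    have h1 := hk (0 + 1)
    have h2 := hk (α + 1)
    exact hfail (hu.linked_of_next (hu.ne hα (by omega)) le_rfl le_rfl (by omega) (by omega))
  rcases le_or_gt ((Finset.Ico (0 : ℤ) h).filter fun k =>
      0 < excessAt G K H h e z (m - 2) u k).card l with hf | hf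
  · exact hE.mul_le_of_few_excess hc hlong hδ hδm (by omega) hhm hu hH hHc hK hR' hends hlow hf
  · exact hE.toIsMaxTails.mul_le_of_much_excess hc hlong hδ hδm hl hhm hm hu hH hHc hK hR' hends
      hα hαh hfail hf

theorem mul_le_of_large_cycle (hc : CycMap G n c) (hlong : CyclesBounded G Set.univ n)
    (hδ : ∀ v, δ ≤ (nbrs G Set.univ v).card) (hδm : δ + 2 = l + m) (hl : 2 ≤ l) (hlm : l ≤ m)
    (hG : IsKConnected G l) (hu : CycMap G h u) (huK : Set.range u ⊆ (Set.range c)ᶜ)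
    (hK : CyclesBounded G (Set.range c)ᶜ h) (hmh : m ≤ h) : l * m ≤ n := by
  have hhn : h ≤ n := by
    obtain ⟨v, p, hp, hl, -⟩ := hu.exists_isCycle
    exact hl.trans (hlong v p hp fun _ _ => Set.mem_univ _)
  obtain ⟨g, rfl⟩ := Nat.exists_eq_add_of_le hmh
  by_cases hall : ∀ a ∈ Set.range u, ∀ b ∈ Set.range u, a ≠ b →
      LinkedBy G (Set.range u) a b (m - 2)
  · have := mul_le_of_linked_set hc hlong hG hl (by omega) huK (by rw [hu.ncard_range]; omega) hall
    rwa [Nat.sub_add_cancel (by omega)] at this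
  push Not at hall
  obtain ⟨_, ⟨s, rfl⟩, b, hb, hne, hfail⟩ := hall
  obtain ⟨t, t1, t2, rfl⟩ := hu.exists_window_of_mem hb s
  have hst : s ≠ t := fun h => hne (by rw [h])
  have hs := hu.shift s
  refine mul_le_of_not_linked hc hlong hδ hδm hl hlm hG (by omega) rfl hs
    (by rw [CycMap.shift_range]; exact huK) hK (α := t - s) (by omega) (by omega) ?_
  rw [CycMap.shift_range, zero_add, sub_add_cancel]
  exact hfail

end

end

section


variable {V : Type*} [Fintype V] {G : SimpleGraph V}

theorem _root_.IsKConnected.mono {k l : ℕ} (hG : IsKConnected G l) (hkl : k ≤ l) :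
    IsKConnected G k :=
  ⟨by have := hG.1; omega, fun S hS => hG.2 S (by omega)⟩

theorem _root_.IsKConnected.le_minDegree [DecidableRel G.Adj] {l : ℕ} (hG : IsKConnected G l) :
    l ≤ G.minDegree := by
  classical
  have hcard := hG.1
  have : Nonempty V := Fintype.card_pos_iff.1 (by omega)
  obtain ⟨v, hv⟩ := G.exists_minimal_degree_vertex
  by_contra hcon
  have hdeg : (G.neighborFinset v).card < l := by
    rw [G.card_neighborFinset_eq_degree]; omega
  obtain ⟨w, hw⟩ : ∃ w, w ∉ insert v (G.neighborFinset v) := by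
    by_contra hall
    push Not at hall
    have h1 : Finset.univ ⊆ insert v (G.neighborFinset v) := fun x _ => hall x
    have h2 := (Finset.card_le_card h1).trans (Finset.card_insert_le _ _)
    rw [Finset.card_univ] at h2
    omega
  rw [Finset.mem_insert, not_or] at hw
  have hconn := (hG.2 _ hdeg).preconnected ⟨v, by simp⟩ ⟨w, by simpa using hw.2⟩
  have := mem_of_reachable
    (R := {x : (((G.neighborFinset v : Finset V) : Set V)ᶜ : Set V) | (x : V) = v}) (by
      rintro ⟨x, hx⟩ hxv ⟨y, hy⟩ hxy
      have hvy : G.Adj v y := by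
        rw [← show x = v from hxv]; exact hxy
      exact absurd hvy (by simpa using hy)) hconn rfl
  exact hw.1 this

theorem minDegree_le_card_nbrs [DecidableRel G.Adj] (v : V) :
    G.minDegree ≤ (nbrs G Set.univ v).card := by
  classical
  refine (G.minDegree_le_degree v).trans (le_of_eq ?_)
  rw [← G.card_neighborFinset_eq_degree]
  congr 1
  ext x
  simp

/-- What it means for `K` to have circumference `h`. -/
theorem cbar_induce_spec (K : Set V) :
    CyclesBounded G K (cbar (G.induce K)) ∧
      ((cbar (G.induce K) = 0 ∧ K = ∅) ∨
        (cbar (G.induce K) = 1 ∧ K.Nonempty ∧ ∀ a ∈ K, ∀ b ∈ K, ¬ G.Adj a b) ∨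
        (cbar (G.induce K) = 2 ∧ ∃ a ∈ K, ∃ b ∈ K, G.Adj a b) ∨
        ∃ u : ℤ → V, CycMap G (cbar (G.induce K)) u ∧ Set.range u ⊆ K) := by
  classical
  set S : Set ℕ := {n : ℕ | (n = 1 ∧ Nonempty K) ∨ (n = 2 ∧ ∃ u v : K, (G.induce K).Adj u v) ∨
    ∃ (v : K) (c : (G.induce K).Walk v v), c.IsCycle ∧ c.length = n} with hS
  have hcS : cbar (G.induce K) = sSup S := rfl
  have hbdd : BddAbove S := by
    refine ⟨Fintype.card K + 2, ?_⟩
    rintro k (⟨rfl, -⟩ | ⟨rfl, -⟩ | ⟨v, c, hc, rfl⟩)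
    · omega
    · omega
    · have := hc.support_nodup.length_le_card
      rw [List.length_tail, Walk.length_support] at this
      omega
  refine ⟨?_, ?_⟩
  · intro v c hc hs
    rw [hcS]
    refine le_csSup hbdd (Or.inr (Or.inr ⟨_, c.induce K hs, ?_, ?_⟩))
    · rw [← Walk.isCycle_map_iff_of_injective (f := (Embedding.induce K).toHom)
        (Embedding.induce (G := G) K).injective]
      rwa [Walk.map_induce]
    · have := congrArg Walk.length (Walk.map_induce c hs)
      rwa [Walk.length_map] at this
  · rcases K.eq_empty_or_nonempty with hK | hK
    · left
      refine ⟨?_, hK⟩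
      have : S = ∅ := by
        rw [Set.eq_empty_iff_forall_notMem]
        rintro k (⟨-, ⟨x⟩⟩ | ⟨-, x, -⟩ | ⟨x, -⟩)
        all_goals exact Set.eq_empty_iff_forall_notMem.1 hK x x.2
      rw [hcS, this]
      exact csSup_empty
    · right
      have hne : S.Nonempty := ⟨1, Or.inl ⟨rfl, hK.to_subtype⟩⟩
      have hmem := Nat.sSup_mem hne hbdd
      rw [← hcS] at hmem
      rcases hmem with ⟨h1, -⟩ | ⟨h2, a, b, hab⟩ | ⟨v, c, hc, hl⟩
      · left
        refine ⟨h1, hK, fun a ha b hb hab => ?_⟩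
        have : 2 ≤ cbar (G.induce K) := by
          rw [hcS]
          exact le_csSup hbdd (Or.inr (Or.inl ⟨rfl, ⟨a, ha⟩, ⟨b, hb⟩, hab⟩))
        omega
      · right; left
        exact ⟨h2, a, a.2, b, b.2, hab⟩
      · right; right
        obtain ⟨u, hu, hr⟩ := exists_cycMap (c.map (Embedding.induce K).toHom)
          (hc.map (Embedding.induce (G := G) K).injective)
        rw [Walk.length_map, hl] at hu
        refine ⟨u, hu, ?_⟩
        rw [hr]
        intro x hx
        rw [Set.mem_ofPred_eq, Walk.support_map, List.mem_map] at hx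
        obtain ⟨y, -, rfl⟩ := hx
        exact y.2

theorem mul_le_of_le_cbar {n l m δ h : ℕ} {c : ℤ → V} (hc : CycMap G n c)
    (hlong : CyclesBounded G Set.univ n) (hδ : ∀ v, δ ≤ (nbrs G Set.univ v).card)
    (hδm : δ + 2 = l + m) (hl : 1 ≤ l) (hm : 2 ≤ m) (hlm : l ≤ m) (hG : IsKConnected G l)
    (hh : h = cbar (G.induce (Set.range c)ᶜ)) (hlh : l ≤ h + 1) : l * m ≤ n := by
  classical
  have h3 := hc.three_le
  obtain ⟨hK, hcase⟩ := cbar_induce_spec (G := G) (Set.range c)ᶜ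
  rw [← hh] at hK hcase
  rcases hcase with ⟨h0, hKe⟩ | ⟨h1, ⟨a, ha⟩, hno⟩ | ⟨h2, a, ha, b, hb, hab⟩ | ⟨u, hu, huK⟩
  · have h4 : nbrs G Set.univ (c 0) ⊆ Finset.univ.erase (c 0) := by
      intro x hx
      rw [mem_nbrs] at hx
      exact Finset.mem_erase.2 ⟨hx.2.ne', Finset.mem_univ _⟩
    have h5 := Finset.card_le_card h4
    rw [Finset.card_erase_of_mem (Finset.mem_univ _), Finset.card_univ] at h5
    have h6 := hc.ncard_range
    rw [Set.compl_empty_iff.1 hKe, Set.ncard_univ, Nat.card_eq_fintype_card] at h6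
    have h7 := hδ (c 0)
    obtain rfl : l = 1 := by omega
    omega
  · have := two_mul_le_of_no_edges hc hlong hδ ha hno
    obtain rfl | rfl : l = 1 ∨ l = 2 := by omega
    · omega
    · omega
  · subst h2
    have := three_mul_le_of_acyclic hc hlong hδ hK ha hb hab
    obtain rfl | rfl | rfl : l = 1 ∨ l = 2 ∨ l = 3 := by omega
    · omega
    · rcases hm.eq_or_lt with rfl | hm3
      · have hA : ({a, b} : Set V) ⊆ (Set.range c)ᶜ :=
          Set.insert_subset ha (Set.singleton_subset_iff.2 hb)
        have key : LinkedBy G {a, b} a b 0 :=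
          ⟨Walk.cons hab Walk.nil, by simpa using hab.ne, by simp, by simp⟩
        refine mul_le_of_linked_set hc hlong hG le_rfl (by omega) hA
          (by rw [Set.ncard_pair hab.ne]) (ℓ := 0) ?_
        rintro x (rfl | rfl) y (rfl | rfl) hxy
        · exact absurd rfl hxy
        · exact key
        · exact key.symm
        · exact absurd rfl hxy
      · omega
    · omega
  · have hu3 := hu.three_le
    rcases le_or_gt m h with hmh | hmh
    · rcases hl.eq_or_lt with rfl | hl2
      · obtain ⟨v, p, hp, hpl, -⟩ := hu.exists_isCycle
        have := hlong v p hp fun _ _ => Set.mem_univ _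
        omega
      · exact mul_le_of_large_cycle hc hlong hδ hδm hl2 hlm hG hu huK hK hmh
    · have h4 := mul_le_of_small_cycle hc hlong hδ hu huK hK
      obtain ⟨p, hp⟩ := Nat.exists_eq_add_of_le hlh
      obtain ⟨q, rfl⟩ := Nat.exists_eq_add_of_le (show h + 1 ≤ m by omega)
      obtain ⟨k, rfl⟩ := Nat.exists_eq_add_of_le (show 1 ≤ h by omega)
      obtain rfl : δ = l + k + q := by omega
      rw [Nat.add_sub_cancel_left] at h4
      have h5 : (1 + k + 1) * (l + q) ≤ n := by nlinarith
      have h6 : l * q ≤ (1 + k + 1) * q := Nat.mul_le_mul_right _ hlh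
      nlinarith

end

end LongCycle

/-- Theorem B reformulated: if `G` is `l`-connected then a longest cycle `C` satisfies
either `|C| ≥ l(δ-l+2)` or `c̄ ≤ min (l-2) (δ-l)`. -/
theorem stmt_8 {V : Type*} [Fintype V] [DecidableEq V] (G : SimpleGraph V)
    [DecidableRel G.Adj] (l : ℕ) (hl : 1 ≤ l) (hconn : IsKConnected G l)
    {v : V} (C : G.Walk v v) (hC : IsLongestCycle G C) :
    (C.length : ℤ) ≥ (l : ℤ) * ((G.minDegree : ℤ) - (l : ℤ) + 2) ∨
      (cbar (G.induce {x : V | x ∉ C.support}) : ℤ) ≤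
        min ((l : ℤ) - 2) ((G.minDegree : ℤ) - (l : ℤ)) := by
  obtain ⟨c, hc, hr⟩ := LongCycle.exists_cycMap C hC.1
  have hK : {x : V | x ∉ C.support} = (Set.range c)ᶜ := by rw [hr]; rfl
  rw [hK]
  have hδl := hconn.le_minDegree
  have hlong : LongCycle.CyclesBounded G Set.univ C.length := fun u D hD _ => hC.2 u D hD
  obtain ⟨d, hd⟩ := Nat.exists_eq_add_of_le hδl
  by_cases hcb : (cbar (G.induce (Set.range c)ᶜ) : ℤ) ≤ min ((l:ℤ)-2) ((G.minDegree:ℤ)-(l:ℤ))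
  · exact Or.inr hcb
  left
  rw [le_min_iff, not_and_or, not_le, not_le, hd] at hcb
  have main : l * (d + 2) ≤ C.length := by
    rcases le_total l (d + 2) with h | h
    · exact LongCycle.mul_le_of_le_cbar hc hlong LongCycle.minDegree_le_card_nbrs (by omega) hl
        (by omega) h hconn rfl (by omega)
    · rw [mul_comm]
      exact LongCycle.mul_le_of_le_cbar hc hlong LongCycle.minDegree_le_card_nbrs (by omega)
        (by omega) (by omega) h (hconn.mono h) rfl (by omega)
  rw [hd]
  push_cast
  rw [show (l : ℤ) + d - l + 2 = d + 2 by ring]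
  exact_mod_cast main
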